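/- Write the bigraded Poincaré series of the pure trace algebra of two generic 5×5 matrices in lowest terms, P(C_{5,2}; s,t) = N(s,t)/D(s,t), with N and D coprime polynomials normalized so that both have constant term 1. Then D(s,t) = Π_5(s,t), i.e. D(s,t) = (1−s)(1−t)·(1−s²)(1−st)²(1−t²)·(1−s³)(1−s²t)³(1−st²)³(1−t³)·(1−s⁴)(1−s³t)²(1−s²t²)²(1−st³)²(1−t⁴)·(1−s⁵)(1−s⁴t)(1−s³t²)(1−s²t³)(1−st⁴)(1−t⁵). -/

import Mathlib

open MvPolynomial Matrix

noncomputable section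

/-- Index type for the entries of a pair of generic `n × n` matrices:
`Sum.inl (i,j)` indexes the `(i,j)` entry of `x`, `Sum.inr (i,j)` that of `y`. -/
abbrev MatVar (n : ℕ) := (Fin n × Fin n) ⊕ (Fin n × Fin n)

/-- The substitution sending the variables to the entries of the pair `(A, B)`. -/
def pairSub {K : Type*} [CommSemiring K] {n : ℕ} (A B : Matrix (Fin n) (Fin n) K) :
    MatVar n → K
  | Sum.inl ij => A ij.1 ij.2
  | Sum.inr ij => B ij.1 ij.2

/-- A polynomial function on pairs of `n × n` matrices is `GLₙ`-invariant (for the action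
by simultaneous conjugation). -/
def IsMatInvariant {K : Type*} [Field K] {n : ℕ} (f : MvPolynomial (MatVar n) K) : Prop :=
  ∀ (a : GL (Fin n) K) (A B : Matrix (Fin n) (Fin n) K),
    MvPolynomial.eval
        (pairSub ((a : Matrix (Fin n) (Fin n) K) * A * ((a⁻¹ : GL (Fin n) K) : Matrix (Fin n) (Fin n) K))
          ((a : Matrix (Fin n) (Fin n) K) * B * ((a⁻¹ : GL (Fin n) K) : Matrix (Fin n) (Fin n) K))) f =
      MvPolynomial.eval (pairSub A B) f

/-- The weight giving the bidegree: entries of `x` have weight `(1,0)`,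
those of `y` have weight `(0,1)`. -/
def bideg (n : ℕ) : MatVar n → ℕ × ℕ
  | Sum.inl _ => (1, 0)
  | Sum.inr _ => (0, 1)

/-- The bigraded component of bidegree `(p, q)` of the pure trace algebra `C_{n,2}`. -/
def pureComponent (K : Type*) [Field K] (n p q : ℕ) : Set (MvPolynomial (MatVar n) K) :=
  {f | IsMatInvariant f ∧ f.IsWeightedHomogeneous (bideg n) (p, q)}

/-- `dim_K C_{n,2}^{(p,q)}`. -/
def pureDim (K : Type*) [Field K] (n p q : ℕ) : ℕ :=
  Set.finrank K (pureComponent K n p q)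

/-- The bigraded Poincaré series `P(C_{n,2}; s, t)`, with `s` the variable `X 0` and
`t` the variable `X 1`. -/
def purePS2 (K : Type*) [Field K] (n : ℕ) : MvPowerSeries (Fin 2) ℚ :=
  fun d => (pureDim K n (d 0) (d 1) : ℚ)

/-- abbreviation for the power series variable `s`. -/
def ps : MvPowerSeries (Fin 2) ℚ := MvPowerSeries.X 0

/-- abbreviation for the power series variable `t`. -/
def pt : MvPowerSeries (Fin 2) ℚ := MvPowerSeries.X 1


/-- The polynomial variable `s`. -/
def qs : MvPolynomial (Fin 2) ℚ := MvPolynomial.X 0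

/-- The polynomial variable `t`. -/
def qt : MvPolynomial (Fin 2) ℚ := MvPolynomial.X 1

/-- `Π_n(s,t) = ∏_{i=1}^{n} (1−s^i)(1−t^i) ∏_{j=1}^{i−1} (1−s^{i−j} t^j)^{min(i, n+1−i)}`. -/
def PiPoly (n : ℕ) : MvPolynomial (Fin 2) ℚ :=
  ∏ i ∈ Finset.range n,
    ((1 - qs ^ (i + 1)) * (1 - qt ^ (i + 1)) *
      ∏ j ∈ Finset.range i, (1 - qs ^ (i - j) * qt ^ (j + 1)) ^ min (i + 1) (n - i))

namespace C52

abbrev L5 := Fin 5 → ℤ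
abbrev A5 := AddMonoidAlgebra ℤ L5

/-- additive extension of a function on exponents -/
def lin {M : Type*} [AddCommGroup M] (g : L5 → M) : A5 →+ M :=
  (Finsupp.liftAddHom fun v => (smulAddHom ℤ M).flip (g v)).comp
    (AddMonoidAlgebra.coeffAddEquiv (R := ℤ) (M := L5)).toAddMonoidHom

theorem lin_single {M : Type*} [AddCommGroup M] (g : L5 → M) (v : L5) (n : ℤ) :
    lin g (AddMonoidAlgebra.single v n) = n • g v := by
  change Finsupp.liftAddHom (fun v => (smulAddHom ℤ M).flip (g v)) (Finsupp.single v n) = _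
  rw [Finsupp.liftAddHom_apply_single]
  rfl

theorem lin_comp {M N : Type*} [AddCommGroup M] [AddCommGroup N] (g : L5 → M) (φ : M →+ N)
    (x : A5) : φ (lin g x) = lin (fun v => φ (g v)) x := by
  have : φ.comp (lin g) = lin (fun v => φ (g v)) := by
    apply AddMonoidAlgebra.addMonoidHom_ext
    intro v n
    simp [lin_single]
  exact DFunLike.congr_fun this x

theorem hom_eq_lin {M : Type*} [AddCommGroup M] (φ : A5 →+ M) :
    φ = lin (fun v => φ (AddMonoidAlgebra.single v 1)) := by
  apply AddMonoidAlgebra.addMonoidHom_ext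
  intro v n
  rw [lin_single, ← map_zsmul]; congr 1
  ext; simp

/-- derivation `z^v ↦ ⟨ν,v⟩ z^v` -/
def DD (ν : L5) : A5 →+ A5 := lin fun v => AddMonoidAlgebra.single v (ν ⬝ᵥ v)

theorem DD_single (ν v : L5) (n : ℤ) :
    DD ν (AddMonoidAlgebra.single v n) = AddMonoidAlgebra.single v ((ν ⬝ᵥ v) * n) := by
  simp [DD, lin_single, mul_comm]

theorem DD_mul (ν : L5) (x y : A5) : DD ν (x * y) = DD ν x * y + x * DD ν y := by
  induction x using AddMonoidAlgebra.induction_linear with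
  | zero => simp
  | add a b ha hb => simp only [add_mul, map_add, ha, hb]; abel
  | single v n =>
    induction y using AddMonoidAlgebra.induction_linear with
    | zero => simp
    | add a b ha hb => simp only [mul_add, map_add, ha, hb]; abel
    | single w m =>
      simp only [AddMonoidAlgebra.single_mul_single, DD_single, ← AddMonoidAlgebra.single_add]
      congr 1
      rw [dotProduct_add]; ring

theorem DD_one (ν : L5) : DD ν 1 = 0 := by
  rw [AddMonoidAlgebra.one_def, DD_single]; simp

def rt (i j : Fin 5) : L5 := Pi.single i 1 - Pi.single j 1
def uu (i j : Fin 5) : A5 := AddMonoidAlgebra.single (rt i j) 1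
def ff (i j : Fin 5) : A5 := 1 - uu i j

theorem uu_mul (i j k : Fin 5) : uu i j * uu j k = uu i k := by
  simp only [uu, AddMonoidAlgebra.single_mul_single, rt]; congr 1; abel

theorem rt_dot (i j k l : Fin 5) : rt i j ⬝ᵥ rt k l =
    (if i = k then 1 else 0) - (if i = l then 1 else 0) - (if j = k then 1 else 0)
      + (if j = l then 1 else 0) := by
  simp only [rt, sub_dotProduct, dotProduct_sub, single_dotProduct, one_mul, Pi.single_apply]
  ring

theorem DD_uu (ν : L5) (k l : Fin 5) : DD ν (uu k l) = ((ν ⬝ᵥ rt k l : ℤ) : A5) * uu k l := by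
  rw [uu, DD_single, ← zsmul_eq_mul]; ext; simp

theorem DD_ff (ν : L5) (k l : Fin 5) :
    DD ν (ff k l) = -((ν ⬝ᵥ rt k l : ℤ) : A5) * (1 - ff k l) := by
  rw [ff, map_sub, DD_one, DD_uu]; ring

theorem ff_rel (i j k : Fin 5) : ff i k = ff i j + ff j k - ff i j * ff j k := by
  simp only [ff, ← uu_mul i j k]; ring

def delta : A5 := ff 0 1 * ff 0 2 * ff 0 3 * ff 0 4 * ff 1 2 * ff 1 3 * ff 1 4 * ff 2 3 * ff 2 4 * ff 3 4

def del01 : A5 := ff 0 2 * ff 0 3 * ff 0 4 * ff 1 2 * ff 1 3 * ff 1 4 * ff 2 3 * ff 2 4 * ff 3 4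
def del02 : A5 := ff 0 1 * ff 0 3 * ff 0 4 * ff 1 2 * ff 1 3 * ff 1 4 * ff 2 3 * ff 2 4 * ff 3 4
def del03 : A5 := ff 0 1 * ff 0 2 * ff 0 4 * ff 1 2 * ff 1 3 * ff 1 4 * ff 2 3 * ff 2 4 * ff 3 4
def del04 : A5 := ff 0 1 * ff 0 2 * ff 0 3 * ff 1 2 * ff 1 3 * ff 1 4 * ff 2 3 * ff 2 4 * ff 3 4
def del12 : A5 := ff 0 1 * ff 0 2 * ff 0 3 * ff 0 4 * ff 1 3 * ff 1 4 * ff 2 3 * ff 2 4 * ff 3 4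
def del13 : A5 := ff 0 1 * ff 0 2 * ff 0 3 * ff 0 4 * ff 1 2 * ff 1 4 * ff 2 3 * ff 2 4 * ff 3 4
def del14 : A5 := ff 0 1 * ff 0 2 * ff 0 3 * ff 0 4 * ff 1 2 * ff 1 3 * ff 2 3 * ff 2 4 * ff 3 4
def del23 : A5 := ff 0 1 * ff 0 2 * ff 0 3 * ff 0 4 * ff 1 2 * ff 1 3 * ff 1 4 * ff 2 4 * ff 3 4
def del24 : A5 := ff 0 1 * ff 0 2 * ff 0 3 * ff 0 4 * ff 1 2 * ff 1 3 * ff 1 4 * ff 2 3 * ff 3 4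
def del34 : A5 := ff 0 1 * ff 0 2 * ff 0 3 * ff 0 4 * ff 1 2 * ff 1 3 * ff 1 4 * ff 2 3 * ff 2 4

theorem sum_del : DD (rt 0 1) del01 + DD (rt 0 2) del02 + DD (rt 0 3) del03 + DD (rt 0 4) del04
    + DD (rt 1 2) del12 + DD (rt 1 3) del13 + DD (rt 1 4) del14 + DD (rt 2 3) del23
    + DD (rt 2 4) del24 + DD (rt 3 4) del34 = 0 := by
  simp only [del01, del02, del03, del04, del12, del13, del14, del23, del24, del34, DD_mul, DD_ff,
    rt_dot]
  simp only [Fin.isValue, Fin.reduceEq, if_true, if_false]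
  push_cast
  linear_combination (2 : A5) * (ff 0 3 * ff 0 4 * ff 1 3 * ff 1 4 * ff 2 3 * ff 2 4 * ff 3 4) * ff_rel 0 1 2
    + 2 * (ff 0 2 * ff 0 4 * ff 1 2 * ff 1 4 * ff 2 3 * ff 2 4 * ff 3 4) * ff_rel 0 1 3
    + 2 * (ff 0 2 * ff 0 3 * ff 1 2 * ff 1 3 * ff 2 3 * ff 2 4 * ff 3 4) * ff_rel 0 1 4
    + 2 * (ff 0 1 * ff 0 4 * ff 1 2 * ff 1 3 * ff 1 4 * ff 2 4 * ff 3 4) * ff_rel 0 2 3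
    + 2 * (ff 0 1 * ff 0 3 * ff 1 2 * ff 1 3 * ff 1 4 * ff 2 3 * ff 3 4) * ff_rel 0 2 4
    + 2 * (ff 0 1 * ff 0 2 * ff 1 2 * ff 1 3 * ff 1 4 * ff 2 3 * ff 2 4) * ff_rel 0 3 4
    + 2 * (ff 0 1 * ff 0 2 * ff 0 3 * ff 0 4 * ff 1 4 * ff 2 4 * ff 3 4) * ff_rel 1 2 3
    + 2 * (ff 0 1 * ff 0 2 * ff 0 3 * ff 0 4 * ff 1 3 * ff 2 3 * ff 3 4) * ff_rel 1 2 4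
    + 2 * (ff 0 1 * ff 0 2 * ff 0 3 * ff 0 4 * ff 1 2 * ff 2 3 * ff 2 4) * ff_rel 1 3 4
    + 2 * (ff 0 1 * ff 0 2 * ff 0 3 * ff 0 4 * ff 1 2 * ff 1 3 * ff 1 4) * ff_rel 2 3 4
end C52

namespace C52

def Lap : A5 →+ A5 := lin fun v => AddMonoidAlgebra.single v (v ⬝ᵥ v)

theorem Lap_single (v : L5) (n : ℤ) :
    Lap (AddMonoidAlgebra.single v n) = AddMonoidAlgebra.single v ((v ⬝ᵥ v) * n) := by
  simp [Lap, lin_single, mul_comm]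

theorem Lap_one : Lap 1 = 0 := by
  rw [AddMonoidAlgebra.one_def, Lap_single]; simp

theorem Lap_mul_uu (x : A5) (k l : Fin 5) : Lap (x * uu k l) =
    Lap x * uu k l + 2 * uu k l * DD (rt k l) x + ((rt k l ⬝ᵥ rt k l : ℤ) : A5) * uu k l * x := by
  induction x using AddMonoidAlgebra.induction_linear with
  | zero => simp
  | add a b ha hb => simp only [add_mul, map_add, ha, hb, mul_add]; abel
  | single v n =>
    have h2 : (2 : A5) = AddMonoidAlgebra.single 0 2 := by
      rw [show (2 : A5) = 1 + 1 by norm_num, AddMonoidAlgebra.one_def, ← AddMonoidAlgebra.single_add]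
      norm_num
    have hz : ∀ z : ℤ, (z : A5) = AddMonoidAlgebra.single 0 z := by
      intro z; rw [← zsmul_one, AddMonoidAlgebra.one_def]; ext; simp
    rw [hz, h2]
    simp only [uu, AddMonoidAlgebra.single_mul_single, DD_single, Lap_single, zero_add]
    rw [add_comm (rt k l) v, ← AddMonoidAlgebra.single_add, ← AddMonoidAlgebra.single_add]
    congr 1
    simp only [dotProduct_add, add_dotProduct]
    rw [dotProduct_comm v (rt k l)]; ring

theorem Lap_mul_ff (x : A5) (k l : Fin 5) : Lap (x * ff k l) =
    Lap x * ff k l - 2 * (1 - ff k l) * DD (rt k l) x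
      - ((rt k l ⬝ᵥ rt k l : ℤ) : A5) * (1 - ff k l) * x := by
  rw [ff, mul_sub, map_sub, Lap_mul_uu, mul_one]; ring

theorem Lap_ff (k l : Fin 5) : Lap (ff k l) = - ((rt k l ⬝ᵥ rt k l : ℤ) : A5) * (1 - ff k l) := by
  have := Lap_mul_ff 1 k l
  rw [one_mul, Lap_one, DD_one] at this
  rw [this]; ring

/-- the part of `Lap δ` -/
theorem Lap_delta : Lap delta =
  - ((1 - ff 0 1) * DD (rt 0 1) del01 + (1 - ff 0 2) * DD (rt 0 2) del02
    + (1 - ff 0 3) * DD (rt 0 3) del03 + (1 - ff 0 4) * DD (rt 0 4) del04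
    + (1 - ff 1 2) * DD (rt 1 2) del12 + (1 - ff 1 3) * DD (rt 1 3) del13
    + (1 - ff 1 4) * DD (rt 1 4) del14 + (1 - ff 2 3) * DD (rt 2 3) del23
    + (1 - ff 2 4) * DD (rt 2 4) del24 + (1 - ff 3 4) * DD (rt 3 4) del34)
  - 2 * ((1 - ff 0 1) * del01 + (1 - ff 0 2) * del02 + (1 - ff 0 3) * del03 + (1 - ff 0 4) * del04
    + (1 - ff 1 2) * del12 + (1 - ff 1 3) * del13 + (1 - ff 1 4) * del14 + (1 - ff 2 3) * del23
    + (1 - ff 2 4) * del24 + (1 - ff 3 4) * del34) := by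
  simp only [delta, del01, del02, del03, del04, del12, del13, del14, del23, del24, del34, DD_mul,
    DD_ff, Lap_mul_ff, Lap_ff, rt_dot]
  simp only [Fin.isValue, Fin.reduceEq, if_true, if_false]
  push_cast
  ring

theorem DD_up (k l : Fin 5) (hkl : k ≠ l) (y : A5) : DD (rt k l) ((1 + uu k l) * y) =
    2 * (1 - ff k l) * y + (2 - ff k l) * DD (rt k l) y := by
  rw [DD_mul, map_add, DD_one, DD_uu, rt_dot]
  simp only [if_true, if_neg hkl, if_neg hkl.symm, ff]
  push_cast
  ring

theorem key_identity : Lap delta + (DD (rt 0 1) ((1 + uu 0 1) * del01)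
    + DD (rt 0 2) ((1 + uu 0 2) * del02) + DD (rt 0 3) ((1 + uu 0 3) * del03)
    + DD (rt 0 4) ((1 + uu 0 4) * del04) + DD (rt 1 2) ((1 + uu 1 2) * del12)
    + DD (rt 1 3) ((1 + uu 1 3) * del13) + DD (rt 1 4) ((1 + uu 1 4) * del14)
    + DD (rt 2 3) ((1 + uu 2 3) * del23) + DD (rt 2 4) ((1 + uu 2 4) * del24)
    + DD (rt 3 4) ((1 + uu 3 4) * del34)) = 0 := by
  rw [Lap_delta, DD_up 0 1 (by decide), DD_up 0 2 (by decide), DD_up 0 3 (by decide),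
    DD_up 0 4 (by decide), DD_up 1 2 (by decide), DD_up 1 3 (by decide), DD_up 1 4 (by decide),
    DD_up 2 3 (by decide), DD_up 2 4 (by decide), DD_up 3 4 (by decide)]
  linear_combination sum_del

/-- the abstract trace functional argument -/
theorem functional_step {M : Type*} [AddCommGroup M] (c0 c1 : L5 → M) (E : Fin 5 → Fin 5 → L5 → M)
    (hE : ∀ i j v, i < j → E i j v - E i j (v + rt i j) = (rt i j ⬝ᵥ v) • c0 v)
    (hc : ∀ v, c1 v = (v ⬝ᵥ v) • c0 v +
      ∑ i, ∑ j, if i < j then E i j v + E i j (v + rt i j) else 0) :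
    lin c1 delta = 0 := by
  have e1 : ∀ i j, i < j → ∀ x, lin (E i j) (ff i j * x) = lin c0 (DD (rt i j) x) := by
    intro i j hij x
    induction x using AddMonoidAlgebra.induction_linear with
    | zero => simp
    | add a b ha hb => simp only [mul_add, map_add, ha, hb]
    | single v n =>
      simp only [ff, sub_mul, one_mul, uu, AddMonoidAlgebra.single_mul_single, map_sub, lin_single,
        DD_single, ← smul_sub]
      rw [add_comm, hE i j v hij, smul_smul, mul_comm]
  have e2 : ∀ x, lin c1 x = lin c0 (Lap x) + ∑ i, ∑ j, if i < j then
      lin (E i j) ((1 + uu i j) * x) else 0 := by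
    intro x
    induction x using AddMonoidAlgebra.induction_linear with
    | zero => simp
    | add a b ha hb =>
      simp only [mul_add, map_add, ha, hb]
      rw [add_add_add_comm, ← Finset.sum_add_distrib]
      congr 1
      apply Finset.sum_congr rfl; intro i _
      rw [← Finset.sum_add_distrib]
      apply Finset.sum_congr rfl; intro j _
      split_ifs <;> simp
    | single v n =>
      simp only [add_mul, one_mul, uu, AddMonoidAlgebra.single_mul_single, map_add, lin_single,
        Lap_single, hc, smul_add, Finset.smul_sum, smul_smul]
      rw [mul_comm n]
      congr 1
      apply Finset.sum_congr rfl; intro i _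
      apply Finset.sum_congr rfl; intro j _
      split_ifs
      · rw [smul_add, add_comm (rt i j) v]
      · simp
  have e3 : ∀ i j, i < j → ∀ y, delta = ff i j * y →
      lin (E i j) ((1 + uu i j) * delta) = lin c0 (DD (rt i j) ((1 + uu i j) * y)) := by
    intro i j hij y hy
    rw [← e1 i j hij, hy]; congr 1; ring
  rw [e2]
  simp only [Fin.sum_univ_five, Fin.isValue, Fin.reduceLT, if_true, if_false]
  rw [e3 0 1 (by decide) del01 (by simp only [delta, del01]; ring),
    e3 0 2 (by decide) del02 (by simp only [delta, del02]; ring),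
    e3 0 3 (by decide) del03 (by simp only [delta, del03]; ring),
    e3 0 4 (by decide) del04 (by simp only [delta, del04]; ring),
    e3 1 2 (by decide) del12 (by simp only [delta, del12]; ring),
    e3 1 3 (by decide) del13 (by simp only [delta, del13]; ring),
    e3 1 4 (by decide) del14 (by simp only [delta, del14]; ring),
    e3 2 3 (by decide) del23 (by simp only [delta, del23]; ring),
    e3 2 4 (by decide) del24 (by simp only [delta, del24]; ring),
    e3 3 4 (by decide) del34 (by simp only [delta, del34]; ring)]
  have := congrArg (lin c0) key_identity
  simp only [map_add, map_zero] at this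
  refine Eq.trans ?_ this
  abel

end C52

namespace C52

structure GlRep (K W : Type*) [Field K] [CharZero K] [AddCommGroup W] [Module K W] where
  e : Fin 5 → Fin 5 → Module.End K W
  I : Type
  fin : Fintype I
  b : Module.Basis I K W
  wt : I → L5
  comm : ∀ i j k l, e i j * e k l - e k l * e i j =
    (if j = k then e i l else 0) - (if i = l then e k j else 0)
  diag : ∀ i a, e i i (b a) = ((wt a i : ℤ) : K) • b a

namespace GlRep
variable {K W : Type*} [Field K] [CharZero K] [AddCommGroup W] [Module K W] (ρ : GlRep K W)

def P (μ : L5) : Module.End K W := ρ.b.constr K fun a => if ρ.wt a = μ then ρ.b a else 0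

theorem P_b (μ : L5) (a) : ρ.P μ (ρ.b a) = if ρ.wt a = μ then ρ.b a else 0 := by
  simp [P]

def IsWt (μ : L5) (w : W) : Prop := ∀ i, ρ.e i i w = ((μ i : ℤ) : K) • w

theorem isWt_b (a) : ρ.IsWt (ρ.wt a) (ρ.b a) := fun i => ρ.diag i a

theorem e_P (μ : L5) (i) : ρ.e i i * ρ.P μ = ((μ i : ℤ) : K) • ρ.P μ := by
  apply ρ.b.ext; intro a
  simp only [Module.End.mul_apply, P_b, LinearMap.smul_apply]
  split_ifs with h
  · rw [ρ.diag, h]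
  · simp

theorem P_e (μ : L5) (i) : ρ.P μ * ρ.e i i = ((μ i : ℤ) : K) • ρ.P μ := by
  apply ρ.b.ext; intro a
  simp only [Module.End.mul_apply, LinearMap.smul_apply, ρ.diag, map_smul, P_b]
  split_ifs with h
  · rw [h]
  · simp

theorem isWt_P (μ : L5) (w : W) : ρ.IsWt μ (ρ.P μ w) := fun i => by
  have := DFunLike.congr_fun (ρ.e_P μ i) w
  simpa using this

theorem P_of_ne {μ ν : L5} (h : ν ≠ μ) {w : W} (hw : ρ.IsWt μ w) : ρ.P ν w = 0 := by
  obtain ⟨i, hi⟩ := Function.ne_iff.1 h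
  have h1 := DFunLike.congr_fun (ρ.P_e ν i) w
  simp only [Module.End.mul_apply, LinearMap.smul_apply, hw i, map_smul] at h1
  have h2 : (((ν i : ℤ) : K) - ((μ i : ℤ) : K)) • ρ.P ν w = 0 := by
    rw [sub_smul, h1, sub_self]
  rcases smul_eq_zero.1 h2 with h3 | h3
  · exact absurd (by exact_mod_cast sub_eq_zero.1 h3) hi
  · exact h3

def wts : Finset L5 := by classical exact (@Finset.univ _ ρ.fin).image ρ.wt

theorem sum_P : ∑ ν ∈ ρ.wts, ρ.P ν = 1 := by
  classical
  apply ρ.b.ext; intro a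
  simp only [LinearMap.sum_apply, P_b, Module.End.one_apply]
  rw [Finset.sum_ite_eq, if_pos]
  simp only [wts]
  exact Finset.mem_image_of_mem _ (@Finset.mem_univ _ ρ.fin a)

theorem P_notMem {μ : L5} (h : μ ∉ ρ.wts) : ρ.P μ = 0 := by
  apply ρ.b.ext; intro a
  rw [P_b, if_neg]; · rfl
  rintro rfl
  apply h
  simp only [wts]
  exact Finset.mem_image_of_mem _ (@Finset.mem_univ _ ρ.fin a)

theorem sum_P_apply (w : W) : ∑ ν ∈ ρ.wts, ρ.P ν w = w := by
  have := DFunLike.congr_fun ρ.sum_P w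
  simpa using this

theorem P_of_isWt {μ : L5} {w : W} (hw : ρ.IsWt μ w) : ρ.P μ w = w := by
  have h := ρ.sum_P_apply w
  rw [Finset.sum_eq_single μ] at h
  · exact h
  · intro ν _ hν; exact ρ.P_of_ne hν hw
  · intro h; rw [ρ.P_notMem h]; rfl

theorem isWt_e {μ : L5} {w : W} (hw : ρ.IsWt μ w) (i j : Fin 5) :
    ρ.IsWt (μ + rt i j) (ρ.e i j w) := by
  intro k
  have h := DFunLike.congr_fun (ρ.comm k k i j) w
  simp only [LinearMap.sub_apply, Module.End.mul_apply, hw k, map_smul] at h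
  rw [sub_eq_iff_eq_add] at h
  rw [h]
  simp only [rt, Pi.add_apply, Pi.sub_apply, Pi.single_apply]
  push_cast
  rw [add_smul, sub_smul, add_comm]
  congr 1
  congr 1
  · split_ifs with h1
    · subst h1; simp
    · simp
  · split_ifs with h1
    · subst h1; simp
    · simp

theorem P_e_ij (μ : L5) (i j : Fin 5) : ρ.P (μ + rt i j) * ρ.e i j = ρ.e i j * ρ.P μ := by
  apply ρ.b.ext; intro a
  simp only [Module.End.mul_apply, P_b]
  split_ifs with h
  · subst h
    exact ρ.P_of_isWt (ρ.isWt_e (ρ.isWt_b a) i j)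
  · rw [map_zero]
    apply ρ.P_of_ne _ (ρ.isWt_e (ρ.isWt_b a) i j)
    intro h'; exact h (add_right_cancel h').symm

def Om : Module.End K W := ∑ i, ∑ j, ρ.e i j * ρ.e j i

theorem Om_comm (k l : Fin 5) : ρ.Om * ρ.e k l = ρ.e k l * ρ.Om := by
  rw [← sub_eq_zero]
  have h1 : ∀ i j, ρ.e i j * ρ.e j i * ρ.e k l - ρ.e k l * (ρ.e i j * ρ.e j i) =
      ρ.e i j * ((if i = k then ρ.e j l else 0) - (if j = l then ρ.e k i else 0))
      + ((if j = k then ρ.e i l else 0) - (if i = l then ρ.e k j else 0)) * ρ.e j i := by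
    intro i j
    rw [← ρ.comm j i k l, ← ρ.comm i j k l]
    noncomm_ring
  simp only [Om, Finset.sum_mul, Finset.mul_sum, ← Finset.sum_sub_distrib, h1]
  simp only [mul_sub, sub_mul, mul_ite, ite_mul, mul_zero, zero_mul, Finset.sum_add_distrib,
    Finset.sum_sub_distrib, Finset.sum_ite_eq', Finset.sum_ite_eq, Finset.mem_univ, if_true]
  rw [Finset.sum_comm]
  simp only [Finset.sum_ite_eq', Finset.sum_ite_eq, Finset.mem_univ, if_true]
  have : ∀ i, (∑ x, if i = l then ρ.e k x * ρ.e x i else 0) = if i = l then ∑ x, ρ.e k x * ρ.e x i else 0 := by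
    intro i; split_ifs <;> simp
  simp only [this, Finset.sum_ite_eq', Finset.mem_univ, if_true]
  abel

/-- main trace step -/
theorem trace_step (X : Module.End K W) (hX : ∀ i j, X * ρ.e i j = ρ.e i j * X) :
    lin (fun v => LinearMap.trace K W (ρ.P v * (ρ.Om * X))) delta = 0 := by
  have cyc : ∀ i j v, LinearMap.trace K W (ρ.P (v + rt i j) * (ρ.e i j * ρ.e j i * X)) =
      LinearMap.trace K W (ρ.P v * (ρ.e j i * ρ.e i j * X)) := by
    intro i j v
    rw [show ρ.P (v + rt i j) * (ρ.e i j * ρ.e j i * X) = ρ.e i j * (ρ.P v * ρ.e j i * X) by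
      rw [← mul_assoc, ← mul_assoc, P_e_ij]; noncomm_ring, LinearMap.trace_mul_comm]
    congr 1
    rw [mul_assoc (ρ.P v * ρ.e j i), hX]; noncomm_ring
  apply functional_step (fun v => LinearMap.trace K W (ρ.P v * X)) _
    (fun i j v => LinearMap.trace K W (ρ.P v * (ρ.e i j * ρ.e j i * X)))
  · intro i j v hij
    rw [cyc, ← map_sub, ← mul_sub, ← sub_mul, ρ.comm]
    rw [if_pos rfl, if_pos rfl, sub_mul, mul_sub, ← mul_assoc, ← mul_assoc, P_e, P_e, map_sub,
      smul_mul_assoc, smul_mul_assoc, map_smul, map_smul, ← sub_smul, zsmul_eq_mul, smul_eq_mul]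
    congr 1
    simp [rt, sub_dotProduct]
  · intro v
    simp only [cyc, ← map_add, ← mul_add, ← add_mul]
    have sq : ∀ i, LinearMap.trace K W (ρ.P v * (ρ.e i i * ρ.e i i * X)) =
        ((v i : ℤ) : K) * ((v i : ℤ) : K) * LinearMap.trace K W (ρ.P v * X) := by
      intro i
      rw [show ρ.P v * (ρ.e i i * ρ.e i i * X) = ρ.P v * ρ.e i i * ρ.e i i * X by noncomm_ring,
        P_e, smul_mul_assoc, P_e, smul_smul, smul_mul_assoc, map_smul, smul_eq_mul]
    simp only [Om, Fin.sum_univ_five, Fin.isValue, Fin.reduceLT, if_true, if_false, add_mul, mul_add,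
      map_add, sq, zsmul_eq_mul, dotProduct]
    push_cast
    ring

end GlRep
end C52

namespace C52

def hh (μ : L5) : ℤ := 4 * μ 0 + 2 * μ 1 - 2 * μ 3 - 4 * μ 4

theorem hh_add (μ ν : L5) : hh (μ + ν) = hh μ + hh ν := by simp only [hh, Pi.add_apply]; ring

theorem hh_rt (i j : Fin 5) (h : i < j) : 0 < hh (rt i j) := by
  revert i j; simp only [hh, rt]; decide

theorem hh_rt' (i j : Fin 5) (h : i < j) : hh (rt j i) < 0 := by
  revert i j; simp only [hh, rt]; decide

theorem rt_ne (i j : Fin 5) (h : i ≠ j) : rt i j ≠ 0 := by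
  revert i j; simp only [rt]; decide

def Good (x : A5) : Prop := ∀ (M : Type) [AddCommGroup M] (g : L5 → M),
  (∀ v, 1 ≤ hh v → g v = 0) → lin g x = g 0

theorem good_mul (x : A5) (hx : Good x) (i j : Fin 5) (hij : i < j) : Good (x * ff i j) := by
  intro M _ g hg
  have h1 : ∀ y, lin g (y * uu i j) = lin (fun v => g (v + rt i j)) y := by
    intro y
    induction y using AddMonoidAlgebra.induction_linear with
    | zero => simp
    | add a b ha hb => simp only [add_mul, map_add, ha, hb]
    | single v n => simp [uu, AddMonoidAlgebra.single_mul_single, lin_single]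
  have hp := hh_rt i j hij
  rw [ff, mul_sub, map_sub, h1, mul_one, hx M g hg, hx M (fun v => g (v + rt i j))]
  · rw [hg (0 + rt i j), sub_zero]
    rw [zero_add]; omega
  · intro v hv
    apply hg; rw [hh_add]; omega

theorem good_one : Good 1 := by
  intro M _ g hg
  rw [AddMonoidAlgebra.one_def, lin_single, one_smul]

theorem good_delta : Good delta := by
  rw [delta, ← one_mul (ff 0 1)]
  repeat' first
    | exact good_one
    | apply good_mul _ _ _ _ (by decide)

namespace GlRep
variable {K W : Type*} [Field K] [CharZero K] [AddCommGroup W] [Module K W] (ρ : GlRep K W)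

def inv : Submodule K W := ⨅ i, ⨅ j, LinearMap.ker (ρ.e i j)

theorem mem_inv (w : W) : w ∈ ρ.inv ↔ ∀ i j, ρ.e i j w = 0 := by
  simp [inv, Submodule.mem_iInf]

theorem comm_apply (i j : Fin 5) {μ : L5} {w : W} (hw : ρ.IsWt μ w) :
    ρ.e i j (ρ.e j i w) = ρ.e j i (ρ.e i j w) + (((μ i : ℤ) : K) - ((μ j : ℤ) : K)) • w := by
  have h := DFunLike.congr_fun (ρ.comm i j j i) w
  simp only [if_true, LinearMap.sub_apply, Module.End.mul_apply, hw i, hw j] at h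
  rw [sub_smul, ← h]; abel

theorem Om_apply (w : W) : ρ.Om w = ∑ i, ∑ j, ρ.e i j (ρ.e j i w) := by
  simp [Om, LinearMap.sum_apply]

theorem Om_high {μ : L5} {w : W} (hw : ρ.IsWt μ w) (h : ∀ i j, i < j → ρ.e i j w = 0) :
    ρ.Om w = ((μ ⬝ᵥ μ + hh μ : ℤ) : K) • w := by
  have h1 : ∀ i j, i < j → ρ.e i j (ρ.e j i w) = (((μ i : ℤ) : K) - ((μ j : ℤ) : K)) • w := by
    intro i j hij; rw [ρ.comm_apply i j hw, h i j hij, map_zero, zero_add]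
  have h2 : ∀ i j, i < j → ρ.e j i (ρ.e i j w) = 0 := by
    intro i j hij; rw [h i j hij, map_zero]
  rw [Om_apply]
  simp (discharger := decide) only [Fin.sum_univ_five, h1, h2]
  simp only [hw _, map_smul, smul_smul, hh, dotProduct, Fin.sum_univ_five]
  push_cast
  module

theorem Om_low {μ : L5} {w : W} (hw : ρ.IsWt μ w) (h : ∀ i j, i < j → ρ.e j i w = 0) :
    ρ.Om w = ((μ ⬝ᵥ μ - hh μ : ℤ) : K) • w := by
  have h1 : ∀ i j, i < j → ρ.e j i (ρ.e i j w) = (((μ j : ℤ) : K) - ((μ i : ℤ) : K)) • w := by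
    intro i j hij; rw [ρ.comm_apply j i hw, h i j hij, map_zero, zero_add]
  have h2 : ∀ i j, i < j → ρ.e i j (ρ.e j i w) = 0 := by
    intro i j hij; rw [h i j hij, map_zero]
  rw [Om_apply]
  simp (discharger := decide) only [Fin.sum_univ_five, h1, h2]
  simp only [hw _, map_smul, smul_smul, hh, dotProduct, Fin.sum_univ_five]
  push_cast
  module

theorem nil_zero {r : ℕ} {w : W} (hw : w ≠ 0) (c : ℤ) (h : ρ.Om w = (c : K) • w)
    (hr : (ρ.Om ^ r) w = 0) : c = 0 := by
  have : ∀ n, (ρ.Om ^ n) w = ((c : K) ^ n) • w := by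
    intro n
    induction n with
    | zero => simp
    | succ n ih => rw [pow_succ', Module.End.mul_apply, ih, map_smul, h, smul_smul, pow_succ]
  rw [this, smul_eq_zero] at hr
  rcases hr with hr | hr
  · by_contra hc
    exact pow_ne_zero r (Int.cast_ne_zero.2 hc) hr
  · exact absurd hr hw

theorem Om_pow_comm (r : ℕ) (i j : Fin 5) : ρ.Om ^ r * ρ.e i j = ρ.e i j * ρ.Om ^ r :=
  ((show Commute ρ.Om (ρ.e i j) from ρ.Om_comm i j).pow_left r)

theorem Om_P (μ : L5) : ρ.Om * ρ.P μ = ρ.P μ * ρ.Om := by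
  simp only [Om, Finset.sum_mul, Finset.mul_sum]
  refine Finset.sum_congr rfl fun i _ => Finset.sum_congr rfl fun j _ => ?_
  have h1 := ρ.P_e_ij μ j i
  have h2 := ρ.P_e_ij (μ + rt j i) i j
  rw [show μ + rt j i + rt i j = μ by simp only [rt]; abel] at h2
  rw [mul_assoc, ← h1, ← mul_assoc, ← h2, mul_assoc]

theorem Om_pow_P (r : ℕ) (μ : L5) : ρ.Om ^ r * ρ.P μ = ρ.P μ * ρ.Om ^ r :=
  ((show Commute ρ.Om (ρ.P μ) from ρ.Om_P μ).pow_left r)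

def IsW (r : ℕ) (μ : L5) : Prop := ∃ w, w ≠ 0 ∧ ρ.IsWt μ w ∧ (ρ.Om ^ r) w = 0

theorem isW_mem {r μ} (h : ρ.IsW r μ) : μ ∈ ρ.wts := by
  obtain ⟨w, h0, h1, _⟩ := h
  by_contra h
  have := ρ.P_of_isWt h1
  rw [ρ.P_notMem h] at this
  exact h0 this.symm

theorem isW_e {r μ} {w : W} (h1 : ρ.IsWt μ w) (h2 : (ρ.Om ^ r) w = 0) (i j)
    (h : ρ.e i j w ≠ 0) : ρ.IsW r (μ + rt i j) := by
  refine ⟨_, h, ρ.isWt_e h1 i j, ?_⟩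
  have := DFunLike.congr_fun (ρ.Om_pow_comm r i j) w
  simp only [Module.End.mul_apply, h2, map_zero] at this
  exact this

theorem isW_max {r μ} (h : ρ.IsW r μ) (hm : ∀ ν, ρ.IsW r ν → hh ν ≤ hh μ) :
    μ ⬝ᵥ μ + hh μ = 0 := by
  obtain ⟨w, h0, h1, h2⟩ := h
  apply ρ.nil_zero h0 _ (ρ.Om_high h1 _) h2
  intro i j hij
  by_contra hne
  have := hm _ (ρ.isW_e h1 h2 i j hne)
  rw [hh_add] at this
  have := hh_rt i j hij
  omega

theorem isW_min {r μ} (h : ρ.IsW r μ) (hm : ∀ ν, ρ.IsW r ν → hh μ ≤ hh ν) :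
    μ ⬝ᵥ μ - hh μ = 0 := by
  obtain ⟨w, h0, h1, h2⟩ := h
  apply ρ.nil_zero h0 _ (ρ.Om_low h1 _) h2
  intro i j hij
  by_contra hne
  have := hm _ (ρ.isW_e h1 h2 j i hne)
  rw [hh_add] at this
  have := hh_rt' i j hij
  omega

theorem dot_nonneg (μ : L5) : 0 ≤ μ ⬝ᵥ μ := Finset.sum_nonneg fun i _ => mul_self_nonneg _

theorem isW_zero {r μ} (h : ρ.IsW r μ) : μ = 0 := by
  classical
  let S := ρ.wts.filter (ρ.IsW r)
  have hS : ∀ ν, ν ∈ S ↔ ρ.IsW r ν := fun ν => by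
    simp only [S, Finset.mem_filter]; exact ⟨fun h => h.2, fun h => ⟨ρ.isW_mem h, h⟩⟩
  have hne : S.Nonempty := ⟨μ, (hS μ).2 h⟩
  obtain ⟨μ1, hm1, hx1⟩ := S.exists_max_image hh hne
  obtain ⟨μ2, hm2, hx2⟩ := S.exists_min_image hh hne
  have e1 := ρ.isW_max ((hS _).1 hm1) fun ν hν => hx1 ν ((hS _).2 hν)
  have e2 := ρ.isW_min ((hS _).1 hm2) fun ν hν => hx2 ν ((hS _).2 hν)
  have d1 := dot_nonneg μ1
  have d2 := dot_nonneg μ2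
  have all : ∀ ν, ρ.IsW r ν → hh ν = 0 := by
    intro ν hν
    have a1 := hx1 ν ((hS _).2 hν)
    have a2 := hx2 ν ((hS _).2 hν)
    omega
  have e3 := ρ.isW_max h fun ν hν => by rw [all ν hν, all μ h]
  rw [all μ h, add_zero] at e3
  exact dotProduct_self_eq_zero.1 e3

theorem ker_wt {r} {w : W} (hw : (ρ.Om ^ r) w = 0) {μ : L5} (hμ : μ ≠ 0) : ρ.P μ w = 0 := by
  by_contra hne
  apply hμ
  apply ρ.isW_zero (r := r)
  refine ⟨_, hne, ρ.isWt_P μ w, ?_⟩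
  have := DFunLike.congr_fun (ρ.Om_pow_P r μ) w
  simp only [Module.End.mul_apply, hw, map_zero] at this
  exact this

theorem ker_P0 {r} {w : W} (hw : (ρ.Om ^ r) w = 0) : ρ.P 0 w = w := by
  have h := ρ.sum_P_apply w
  rw [Finset.sum_eq_single 0] at h
  · exact h
  · intro ν _ hν; exact ρ.ker_wt hw hν
  · intro h; rw [ρ.P_notMem h]; rfl

theorem ker_eq_inv {r : ℕ} (hr : r ≠ 0) : LinearMap.ker (ρ.Om ^ r) = ρ.inv := by
  ext w
  rw [LinearMap.mem_ker, mem_inv]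
  constructor
  · intro hw i j
    have h0 : ρ.IsWt 0 w := by rw [← ρ.ker_P0 hw]; exact ρ.isWt_P 0 w
    by_cases hij : i = j
    · subst hij; rw [h0 i]; simp
    · by_contra hne
      have := ρ.isW_zero (ρ.isW_e h0 hw i j hne)
      rw [zero_add] at this
      exact rt_ne i j hij this
  · intro hw
    obtain ⟨k, rfl⟩ := Nat.exists_eq_succ_of_ne_zero hr
    rw [pow_succ, Module.End.mul_apply, Om_apply]
    simp [hw]

theorem aeval_comm (q : Polynomial K) (T : Module.End K W) (h : Commute ρ.Om T) :
    Commute (Polynomial.aeval ρ.Om q) T := by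
  induction q using Polynomial.induction_on' with
  | add p q hp hq => rw [map_add]; exact hp.add_left hq
  | monomial n a =>
    rw [Polynomial.aeval_monomial]
    exact (Algebra.commute_algebraMap_left a T).mul_left (h.pow_left n)

theorem tau (q : Polynomial K) :
    lin (fun v => LinearMap.trace K W (ρ.P v * Polynomial.aeval ρ.Om q)) delta =
      q.eval 0 * lin (fun v => LinearMap.trace K W (ρ.P v)) delta := by
  have hq : q = Polynomial.C (q.eval 0) + Polynomial.X * q.divX := by
    have := q.divX_mul_X_add
    rw [← Polynomial.coeff_zero_eq_eval_zero, mul_comm, add_comm]; exact this.symm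
  have h1 := ρ.trace_step (Polynomial.aeval ρ.Om q.divX)
    (fun i j => ρ.aeval_comm _ _ (ρ.Om_comm i j))
  have h2 : ∀ v, LinearMap.trace K W (ρ.P v * Polynomial.aeval ρ.Om q) =
      q.eval 0 * LinearMap.trace K W (ρ.P v) +
      LinearMap.trace K W (ρ.P v * (ρ.Om * Polynomial.aeval ρ.Om q.divX)) := by
    intro v
    conv_lhs => rw [hq]
    have h4 : Polynomial.aeval ρ.Om (Polynomial.C (q.eval 0) + Polynomial.X * q.divX) =
        algebraMap K (Module.End K W) (q.eval 0) + ρ.Om * Polynomial.aeval ρ.Om q.divX := by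
      rw [map_add, map_mul, Polynomial.aeval_C, Polynomial.aeval_X]
    rw [h4, mul_add, map_add]
    congr 1
    rw [← Algebra.commutes, ← Algebra.smul_def, map_smul, smul_eq_mul]
  have h3 : ∀ x, lin (fun v => LinearMap.trace K W (ρ.P v * Polynomial.aeval ρ.Om q)) x =
      q.eval 0 * lin (fun v => LinearMap.trace K W (ρ.P v)) x +
      lin (fun v => LinearMap.trace K W (ρ.P v * (ρ.Om * Polynomial.aeval ρ.Om q.divX))) x := by
    intro x
    induction x using AddMonoidAlgebra.induction_linear with
    | zero => simp
    | add a b ha hb => simp only [map_add, ha, hb]; ring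
    | single v n => simp only [lin_single, h2, zsmul_eq_mul]; ring
  rw [h3, h1, add_zero]

theorem main_trace [FiniteDimensional K W] : ((Module.finrank K ρ.inv : ℕ) : K) =
    lin (fun v => LinearMap.trace K W (ρ.P v)) delta := by
  set χ := Polynomial.X * ρ.Om.charpoly with hχ
  have hχ0 : χ ≠ 0 := mul_ne_zero Polynomial.X_ne_zero (LinearMap.charpoly_monic _).ne_zero
  have hχO : Polynomial.aeval ρ.Om χ = 0 := by
    rw [hχ, map_mul, LinearMap.aeval_self_charpoly, mul_zero]
  obtain ⟨g, hg, hnd⟩ := Polynomial.exists_eq_pow_rootMultiplicity_mul_and_not_dvd χ hχ0 0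
  set r := Polynomial.rootMultiplicity 0 χ with hr
  simp only [map_zero, sub_zero] at hg hnd
  have hr0 : r ≠ 0 := by
    intro h0
    rw [h0, pow_zero, one_mul] at hg
    exact hnd (hg ▸ ⟨_, hχ⟩)
  have hcop : IsCoprime (Polynomial.X ^ r) g :=
    (Polynomial.irreducible_X.coprime_iff_not_dvd.2 hnd).pow_left
  obtain ⟨u, v, huv⟩ := hcop
  set q := v * g with hq
  have hq0 : q.eval 0 = 1 := by
    have := congrArg (Polynomial.eval 0) huv
    simpa [hr0] using this
  set π := Polynomial.aeval ρ.Om q with hπ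
  have hπ1 : ∀ w, (ρ.Om ^ r) (π w) = 0 := by
    intro w
    have : ρ.Om ^ r * π = 0 := by
      rw [hπ, show ρ.Om ^ r = Polynomial.aeval ρ.Om (Polynomial.X ^ r : Polynomial K) by simp,
        ← map_mul, hq, show Polynomial.X ^ r * (v * g) = v * χ by rw [hg]; ring, map_mul, hχO,
        mul_zero]
    exact DFunLike.congr_fun this w
  have hπ2 : ∀ w, (ρ.Om ^ r) w = 0 → π w = w := by
    intro w hw
    have h := congrArg (Polynomial.aeval ρ.Om) huv
    rw [map_add, map_mul, map_pow, Polynomial.aeval_X, map_one] at h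
    have := DFunLike.congr_fun h w
    simpa [hw] using this
  have hproj : LinearMap.IsProj ρ.inv π := by
    rw [← ρ.ker_eq_inv hr0]
    exact ⟨fun w => hπ1 w, fun w hw => hπ2 w hw⟩
  have ht := ρ.tau q
  rw [hq0, one_mul] at ht
  rw [← ht]
  have hP : ∀ v, LinearMap.trace K W (ρ.P v * π) = if v = 0 then
      ((Module.finrank K ρ.inv : ℕ) : K) else 0 := by
    intro v
    split_ifs with hv
    · rw [← hproj.trace]; congr 1
      ext w
      rw [hv]; exact ρ.ker_P0 (hπ1 w)
    · have : ρ.P v * π = 0 := by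
        ext w; exact ρ.ker_wt (hπ1 w) hv
      rw [this, map_zero]
  simp only [← hπ, hP]
  have h1 : ∀ x : A5, lin (fun v => if v = 0 then ((Module.finrank K ρ.inv : ℕ) : K) else 0) x =
      ((Module.finrank K ρ.inv : ℕ) : K) * ((lin (fun v => if v = 0 then (1 : ℤ) else 0) x : ℤ) : K) := by
    intro x
    induction x using AddMonoidAlgebra.induction_linear with
    | zero => simp
    | add a b ha hb => simp only [map_add, ha, hb]; push_cast; ring
    | single v n => simp only [lin_single]; split_ifs <;> simp [mul_comm]
  rw [h1, good_delta ℤ _ _]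
  · simp
  · intro v hv
    rw [if_neg]
    rintro rfl
    simp [hh] at hv

theorem trace_P (v : L5) : LinearMap.trace K W (ρ.P v) = ((Nat.card {a // ρ.wt a = v} : ℕ) : K) := by
  classical
  letI := ρ.fin
  rw [LinearMap.trace_eq_matrix_trace K ρ.b, Matrix.trace]
  have : ∀ a, Matrix.diag (LinearMap.toMatrix ρ.b ρ.b (ρ.P v)) a = if ρ.wt a = v then (1 : K) else 0 := by
    intro a
    rw [Matrix.diag_apply, LinearMap.toMatrix_apply, P_b]
    split_ifs <;> simp
  simp only [this]
  rw [Finset.sum_boole, Nat.card_eq_fintype_card, Fintype.card_subtype]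

theorem main [FiniteDimensional K W] : ((Module.finrank K ρ.inv : ℕ) : ℤ) =
    lin (fun v => ((Nat.card {a // ρ.wt a = v} : ℕ) : ℤ)) delta := by
  have h := ρ.main_trace
  simp only [trace_P] at h
  have h2 := lin_comp (fun v => ((Nat.card {a // ρ.wt a = v} : ℕ) : ℤ)) (Int.castAddHom K) delta
  simp only [Int.coe_castAddHom, Int.cast_natCast] at h2
  rw [← h2] at h
  exact_mod_cast h

end GlRep
end C52

namespace C52

section
variable {K : Type*} [Field K] [CharZero K]

/-- weights of the variables -/
def matwt : MatVar 5 → L5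
  | Sum.inl (k, l) => rt l k
  | Sum.inr (k, l) => rt l k

def derX (K : Type*) [Field K] (i j : Fin 5) : MatVar 5 → MvPolynomial (MatVar 5) K
  | Sum.inl (a, b) => (if j = b then X (Sum.inl (a, i)) else 0) - (if a = i then X (Sum.inl (j, b)) else 0)
  | Sum.inr (a, b) => (if j = b then X (Sum.inr (a, i)) else 0) - (if a = i then X (Sum.inr (j, b)) else 0)

def der (K : Type*) [Field K] (i j : Fin 5) :
    Derivation K (MvPolynomial (MatVar 5) K) (MvPolynomial (MatVar 5) K) :=
  mkDerivation K (derX K i j)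

theorem der_X (i j : Fin 5) (v : MatVar 5) : der K i j (X v) = derX K i j v :=
  mkDerivation_X K _ v

def ind (K : Type*) [Field K] (c : Prop) [Decidable c] : MvPolynomial (MatVar 5) K := if c then 1 else 0

theorem ite_ind (c : Prop) [Decidable c] (x : MvPolynomial (MatVar 5) K) :
    (if c then x else 0) = ind K c * x := by
  unfold ind; split_ifs <;> simp

theorem ind_congr {c d : Prop} [Decidable c] [Decidable d] (h : c ↔ d) : ind K c = ind K d := by
  unfold ind; simp [h]

theorem der_comm (i j k l : Fin 5) : ⁅der K i j, der K k l⁆ =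
    (if j = k then der K i l else 0) - (if i = l then der K k j else 0) := by
  apply MvPolynomial.derivation_ext
  intro v
  have hl : ∀ (c : Prop) [Decidable c] (D : Derivation K (MvPolynomial (MatVar 5) K) (MvPolynomial (MatVar 5) K)) x,
     (if c then D else 0) x = if c then D x else 0 := by
    intro c _ D x; split_ifs <;> rfl
  have hr : ∀ (c : Prop) [Decidable c] (D : Derivation K (MvPolynomial (MatVar 5) K) (MvPolynomial (MatVar 5) K)) x,
     D (if c then x else 0) = if c then D x else 0 := by
    intro c _ D x; split_ifs <;> simp
  rw [Derivation.commutator_apply, Derivation.sub_apply, hl, hl]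
  rcases v with ⟨a, b⟩ | ⟨a, b⟩ <;>
  · simp only [der_X, derX, map_sub, hr]
    simp only [ite_ind]
    rw [ind_congr (eq_comm : i = l ↔ l = i)]
    ring

theorem derX_hom (i j : Fin 5) (v) : (derX K i j v).IsWeightedHomogeneous (bideg 5) (bideg 5 v) := by
  rcases v with ⟨a, b⟩ | ⟨a, b⟩ <;>
  · simp only [derX]
    apply (weightedHomogeneousSubmodule K (bideg 5) _).sub_mem
    · split_ifs
      · exact isWeightedHomogeneous_X K (bideg 5) _
      · exact Submodule.zero_mem _
    · split_ifs
      · exact isWeightedHomogeneous_X K (bideg 5) _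
      · exact Submodule.zero_mem _

theorem der_hom (i j : Fin 5) {f : MvPolynomial (MatVar 5) K} {n : ℕ × ℕ}
    (hf : f.IsWeightedHomogeneous (bideg 5) n) : (der K i j f).IsWeightedHomogeneous (bideg 5) n := by
  rw [f.as_sum, map_sum]
  apply (weightedHomogeneousSubmodule K (bideg 5) n).sum_mem
  intro d hd
  have hdn := hf (mem_support_iff.1 hd)
  rw [der, mkDerivation_monomial]
  apply (weightedHomogeneousSubmodule K (bideg 5) n).smul_mem
  apply (weightedHomogeneousSubmodule K (bideg 5) n).sum_mem
  intro v hv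
  have h1 := isWeightedHomogeneous_monomial (R := K) (bideg 5) (d - Finsupp.single v 1) ((d v : ℕ) : K) rfl
  have h2 := h1.mul (derX_hom (K := K) i j v)
  change (monomial _ _ • derX K i j v) ∈ weightedHomogeneousSubmodule K (bideg 5) n
  rw [smul_eq_mul]
  change IsWeightedHomogeneous _ _ _
  convert h2
  rw [← hdn]
  have : d = (d - Finsupp.single v 1) + Finsupp.single v 1 := by
    ext u
    simp only [Finsupp.add_apply, Finsupp.tsub_apply, Finsupp.single_apply]
    have := Finsupp.mem_support_iff.1 hv
    split_ifs with h
    · subst h; omega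
    · omega
  conv_lhs => rw [this]
  rw [map_add, Finsupp.weight_single, one_smul]

theorem derX_diag (i : Fin 5) (v) : derX K i i v = (((matwt v i : ℤ) : K)) • X v := by
  rcases v with ⟨a, b⟩ | ⟨a, b⟩ <;>
  · simp only [derX, matwt, rt, Pi.sub_apply, Pi.single_apply]
    push_cast
    rw [sub_smul]
    congr 1
    · split_ifs with h
      · subst h; simp
      · simp
    · by_cases h : a = i
      · subst h; simp
      · rw [if_neg h, if_neg (Ne.symm h)]; simp

theorem der_diag (i : Fin 5) (d : MatVar 5 →₀ ℕ) (r : K) : der K i i (monomial d r) =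
    (((Finsupp.weight matwt d i : ℤ) : K)) • monomial d r := by
  rw [der, mkDerivation_monomial, Finsupp.weight_apply, Finsupp.sum, Finsupp.sum, Finset.sum_apply]
  push_cast
  rw [Finset.sum_smul, Finset.smul_sum]
  apply Finset.sum_congr rfl
  intro v hv
  rw [derX_diag, smul_eq_mul, mul_smul_comm, X, monomial_mul, mul_one]
  have : (d - Finsupp.single v 1) + Finsupp.single v 1 = d := by
    ext u
    simp only [Finsupp.add_apply, Finsupp.tsub_apply, Finsupp.single_apply]
    have := Finsupp.mem_support_iff.1 hv
    split_ifs with h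
    · subst h; omega
    · omega
  rw [this]
  simp only [smul_monomial, Pi.smul_apply, smul_eq_mul]
  congr 1
  push_cast
  simp only [nsmul_eq_mul]
  push_cast
  ring

abbrev WW (K : Type*) [Field K] (p q : ℕ) : Submodule K (MvPolynomial (MatVar 5) K) :=
  weightedHomogeneousSubmodule K (bideg 5) (p, q)

abbrev II (p q : ℕ) := {d : MatVar 5 →₀ ℕ // Finsupp.weight (bideg 5) d = (p, q)}

theorem finite_II (p q : ℕ) : Finite (II p q) := by
  apply Set.Finite.subset (Set.finite_Iic (Finsupp.equivFunOnFinite.symm fun _ : MatVar 5 => p + q))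
  intro d hd
  rw [Set.mem_Iic, Finsupp.le_iff]
  intro v _
  have hd' : Finsupp.weight (bideg 5) d = (p, q) := hd
  rw [Finsupp.weight_apply, Finsupp.sum_fintype _ _ (by simp)] at hd'
  have h1 := congrArg Prod.fst hd'
  have h2 := congrArg Prod.snd hd'
  rw [Prod.fst_sum] at h1
  rw [Prod.snd_sum] at h2
  have h3 := Finset.single_le_sum (f := fun v => (d v • bideg 5 v).1) (fun _ _ => Nat.zero_le _) (Finset.mem_univ v)
  have h4 := Finset.single_le_sum (f := fun v => (d v • bideg 5 v).2) (fun _ _ => Nat.zero_le _) (Finset.mem_univ v)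
  simp only [Finsupp.equivFunOnFinite_symm_apply_apply]
  rcases v with v | v <;> simp [bideg] at * <;> omega

def bW (K : Type*) [Field K] (p q : ℕ) : Module.Basis (II p q) K (WW K p q) :=
  Module.Basis.mk (v := fun d => ⟨monomial d.1 1, isWeightedHomogeneous_monomial (R := K) (bideg 5) d.1 1 d.2⟩)
    (by
      apply LinearIndependent.of_comp (WW K p q).subtype
      have := (basisMonomials (MatVar 5) K).linearIndependent.comp
        (fun d : II p q => d.1) Subtype.val_injective
      rw [coe_basisMonomials] at this
      exact this)
    (by
      rintro ⟨f, hf⟩ -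
      have : (⟨f, hf⟩ : WW K p q) = ∑ d ∈ f.support.attach, (coeff d.1 f) •
          (⟨monomial d.1 1, isWeightedHomogeneous_monomial (R := K) (bideg 5) d.1 1
            (hf (mem_support_iff.1 d.2))⟩ : WW K p q) := by
        apply Subtype.ext
        rw [Submodule.coe_sum]
        simp only [Submodule.coe_smul, smul_monomial, smul_eq_mul, mul_one]
        rw [Finset.sum_attach f.support (fun d => monomial d (coeff d f))]
        exact f.as_sum
      rw [this]
      apply Submodule.sum_mem
      intro d _
      apply Submodule.smul_mem
      apply Submodule.subset_span
      exact ⟨⟨d.1, hf (mem_support_iff.1 d.2)⟩, rfl⟩)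

theorem bW_apply (p q : ℕ) (d : II p q) : ((bW K p q d : WW K p q) : MvPolynomial (MatVar 5) K) = monomial d.1 1 := by
  simp [bW]

def polyRep (K : Type*) [Field K] [CharZero K] (p q : ℕ) : GlRep K (WW K p q) where
  e i j := (der K i j).toLinearMap.restrict (p := WW K p q) (q := WW K p q) (fun f hf => (mem_weightedHomogeneousSubmodule K _ _ _).2 (der_hom i j ((mem_weightedHomogeneousSubmodule K _ _ _).1 hf)))
  I := II p q
  fin := @Fintype.ofFinite _ (finite_II p q)
  b := bW K p q
  wt d := Finsupp.weight matwt d.1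
  comm i j k l := by
    ext1 ⟨f, hf⟩
    apply Subtype.ext
    have := DFunLike.congr_fun (der_comm (K := K) i j k l) f
    rw [Derivation.commutator_apply] at this
    split_ifs at this ⊢ <;> exact this
  diag i d := by
    apply Subtype.ext
    rw [Submodule.coe_smul, bW_apply]
    change der K i i (bW K p q d : WW K p q).1 = _
    rw [bW_apply]
    exact der_diag i d.1 1

end
end C52

namespace C52

section
variable {K : Type*} [Field K] [CharZero K]

def pind (K : Type*) [Field K] (c : Prop) [Decidable c] : Polynomial K := if c then 1 else 0

def pth (i j : Fin 5) (M : Matrix (Fin 5) (Fin 5) K) (a b : Fin 5) : Polynomial K :=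
  Polynomial.C (M a b) + pind K (a = i) * Polynomial.X * Polynomial.C (M j b)
    - pind K (j = b) * Polynomial.X * Polynomial.C (M a i)
    - pind K (a = i) * pind K (j = b) * Polynomial.X ^ 2 * Polynomial.C (M j i)

def pthS (i j : Fin 5) (A B : Matrix (Fin 5) (Fin 5) K) : MatVar 5 → Polynomial K
  | Sum.inl ab => pth i j A ab.1 ab.2
  | Sum.inr ab => pth i j B ab.1 ab.2

theorem der_pind (c : Prop) [Decidable c] : Polynomial.derivative (pind K c) = 0 := by
  unfold pind; split_ifs <;> simp

theorem pth_deriv {i j : Fin 5} (hij : i ≠ j) (M : Matrix (Fin 5) (Fin 5) K) (a b : Fin 5) :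
    Polynomial.derivative (pth i j M a b) =
      -(pind K (j = b) * pth i j M a i - pind K (a = i) * pth i j M j b) := by
  have h1 : pind K (j = i) = 0 := by simp [pind, hij.symm]
  simp only [pth, map_add, map_sub, Polynomial.derivative_mul, Polynomial.derivative_C,
    Polynomial.derivative_X, der_pind, h1, Polynomial.derivative_X_pow]
  push_cast
  simp only [map_ofNat]
  ring

theorem pthS_deriv {i j : Fin 5} (hij : i ≠ j) (A B : Matrix (Fin 5) (Fin 5) K)
    (f : MvPolynomial (MatVar 5) K) :
    Polynomial.derivative (aeval (pthS i j A B) f) = - aeval (pthS i j A B) (der K i j f) := by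
  induction f using MvPolynomial.induction_on with
  | C a => simp [MvPolynomial.algebraMap_eq]
  | add f g hf hg => simp only [map_add, hf, hg]; ring
  | mul_X f v hf =>
    have hv : Polynomial.derivative (pthS i j A B v) = - aeval (pthS i j A B) (derX K i j v) := by
      have hi : ∀ (c : Prop) [Decidable c] (x : MvPolynomial (MatVar 5) K), aeval (pthS i j A B) (if c then x else 0) =
          pind K c * aeval (pthS i j A B) x := by
        intro c _ x; unfold pind; split_ifs <;> simp
      rcases v with ⟨a, b⟩ | ⟨a, b⟩ <;>
      · simp only [pthS, derX, map_sub, hi, aeval_X]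
        exact pth_deriv hij _ a b
    rw [Derivation.leibniz, der_X]
    simp only [map_mul, map_add, smul_eq_mul, aeval_X, Polynomial.derivative_mul, hf, hv]
    ring

theorem pth_eval {i j : Fin 5} (M : Matrix (Fin 5) (Fin 5) K) (a b : Fin 5) (c : K) :
    (pth i j M a b).eval c = (transvection i j c * M * transvection i j (-c)) a b := by
  have h1 : ∀ (N : Matrix (Fin 5) (Fin 5) K) a b c, (transvection i j c * N) a b = N a b +
      (if a = i then 1 else 0) * c * N j b := by
    intro N a b c
    by_cases h : a = i
    · subst h; simp
    · simp [h]
  have h2 : ∀ (N : Matrix (Fin 5) (Fin 5) K) a b c, (N * transvection i j c) a b = N a b +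
      (if j = b then 1 else 0) * c * N a i := by
    intro N a b c
    by_cases h : j = b
    · subst h; simp
    · simp [h, Ne.symm h]
  have h3 : ∀ (p : Prop) [Decidable p], (pind K p).eval c = if p then 1 else 0 := by
    intro p _; unfold pind; split_ifs <;> simp
  rw [h2, h1, h1]
  simp only [pth, Polynomial.eval_add, Polynomial.eval_sub, Polynomial.eval_mul, Polynomial.eval_C,
    Polynomial.eval_X, Polynomial.eval_pow, h3]
  ring

theorem pthS_eval {i j : Fin 5} (A B : Matrix (Fin 5) (Fin 5) K) (f : MvPolynomial (MatVar 5) K) (c : K) :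
    (aeval (pthS i j A B) f).eval c = MvPolynomial.eval
      (pairSub (transvection i j c * A * transvection i j (-c)) (transvection i j c * B * transvection i j (-c))) f := by
  rw [← Polynomial.coe_aeval_eq_eval, MvPolynomial.comp_aeval_apply]
  have : (fun v => Polynomial.aeval c (pthS i j A B v)) = (pairSub (transvection i j c * A * transvection i j (-c)) (transvection i j c * B * transvection i j (-c))) := by
    funext v
    rw [Polynomial.coe_aeval_eq_eval]
    rcases v with ⟨a, b⟩ | ⟨a, b⟩ <;> exact pth_eval _ a b c
  rw [this]
  exact congrArg (fun g => g f) (MvPolynomial.coe_aeval_eq_eval _)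

theorem pairSub_surj (x : MatVar 5 → K) : ∃ A B, pairSub A B = x :=
  ⟨fun a b => x (Sum.inl (a, b)), fun a b => x (Sum.inr (a, b)), by
    funext v; rcases v with ⟨a, b⟩ | ⟨a, b⟩ <;> rfl⟩

theorem transv_iff {i j : Fin 5} (hij : i ≠ j) (f : MvPolynomial (MatVar 5) K) :
    der K i j f = 0 ↔ ∀ (c : K) (A B : Matrix (Fin 5) (Fin 5) K), MvPolynomial.eval
      (pairSub (transvection i j c * A * transvection i j (-c)) (transvection i j c * B * transvection i j (-c))) f
      = MvPolynomial.eval (pairSub A B) f := by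
  constructor
  · intro h c A B
    have h1 := pthS_deriv hij A B f
    rw [h, map_zero, neg_zero] at h1
    have h2 := Polynomial.derivative_eq_zero.1 h1
    rw [← pthS_eval, Polynomial.eq_C_of_natDegree_eq_zero h2, Polynomial.eval_C]
    have h3 := pthS_eval (i := i) (j := j) A B f 0
    rw [Polynomial.eq_C_of_natDegree_eq_zero h2, Polynomial.eval_C] at h3
    rw [h3]
    simp
  · intro h
    apply MvPolynomial.funext
    intro x
    obtain ⟨A, B, rfl⟩ := pairSub_surj x
    have h1 : aeval (pthS i j A B) f = Polynomial.C (MvPolynomial.eval (pairSub A B) f) := by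
      apply Polynomial.funext
      intro c
      rw [pthS_eval, h, Polynomial.eval_C]
    have h2 := pthS_deriv hij A B f
    rw [h1, Polynomial.derivative_C] at h2
    have h3 := pthS_eval (i := i) (j := j) A B (der K i j f) 0
    rw [neg_eq_zero.1 h2.symm] at h3
    simp at h3
    rw [← h3, map_zero]

theorem der_sum_diag : ∑ i : Fin 5, der K i i = 0 := by
  apply MvPolynomial.derivation_ext
  intro v
  have : ∀ x, (∑ i : Fin 5, der K i i) x = ∑ i : Fin 5, der K i i x := by
    intro x
    simp [Fin.sum_univ_five]
  rw [this]
  simp only [der_X]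
  rcases v with ⟨a, b⟩ | ⟨a, b⟩ <;> simp [derX, Finset.sum_sub_distrib]

theorem der_diag_zero {f : MvPolynomial (MatVar 5) K} (h : ∀ i j, i ≠ j → der K i j f = 0) (i : Fin 5) :
    der K i i f = 0 := by
  have h1 : ∀ j, der K j j f = der K i i f := by
    intro j
    by_cases hij : i = j
    · rw [hij]
    · have := DFunLike.congr_fun (der_comm (K := K) i j j i) f
      rw [Derivation.commutator_apply, h i j hij, h j i (Ne.symm hij), if_pos rfl, if_pos rfl] at this
      simp only [map_zero, sub_zero, Derivation.sub_apply] at this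
      exact (sub_eq_zero.1 this.symm).symm
  have h2 := DFunLike.congr_fun (der_sum_diag (K := K)) f
  rw [Fin.sum_univ_five] at h2
  simp only [Derivation.add_apply, Derivation.zero_apply] at h2
  rw [h1 0, h1 1, h1 2, h1 3, h1 4] at h2
  have h3 : (5 : MvPolynomial (MatVar 5) K) * der K i i f = 0 := by rw [← h2]; ring
  rcases mul_eq_zero.1 h3 with h4 | h4
  · exfalso
    have : (5 : MvPolynomial (MatVar 5) K) ≠ 0 := by norm_num
    exact this h4
  · exact h4

theorem weight_zero {f : MvPolynomial (MatVar 5) K} (h : ∀ i, der K i i f = 0) {d : MatVar 5 →₀ ℕ}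
    (hd : coeff d f ≠ 0) : Finsupp.weight matwt d = 0 := by
  funext i
  have h1 := congrArg (coeff d) (h i)
  rw [f.as_sum, map_sum] at h1
  simp only [der_diag, coeff_sum, coeff_smul, coeff_monomial, coeff_zero] at h1
  rw [Finset.sum_eq_single d] at h1
  · simp only [if_true, smul_eq_mul] at h1
    rcases mul_eq_zero.1 h1 with h2 | h2
    · exact_mod_cast h2
    · exact absurd h2 hd
  · intro e _ he
    simp [he]
  · intro h2
    simp at h2
    simp [h2]

def ZZ (D : Fin 5 → K) (w : L5) : K := ∏ i, D i ^ (w i)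

theorem ZZ_rt {D : Fin 5 → K} (hD : ∀ i, D i ≠ 0) (k l : Fin 5) : ZZ D (rt l k) = D l * (D k)⁻¹ := by
  unfold ZZ rt
  simp only [Pi.sub_apply]
  rw [Finset.prod_congr rfl (fun i _ => zpow_sub₀ (hD i) _ _), Finset.prod_div_distrib, div_eq_mul_inv]
  congr 2
  · rw [Finset.prod_eq_single l] <;> simp +contextual
  · rw [Finset.prod_eq_single k] <;> simp +contextual

theorem diag_inv {f : MvPolynomial (MatVar 5) K} (h : ∀ i, der K i i f = 0) {D : Fin 5 → K}
    (hD : ∀ i, D i ≠ 0) (A B : Matrix (Fin 5) (Fin 5) K) : MvPolynomial.eval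
      (pairSub (diagonal D * A * diagonal (fun i => (D i)⁻¹)) (diagonal D * B * diagonal (fun i => (D i)⁻¹))) f
      = MvPolynomial.eval (pairSub A B) f := by
  have h1 : ∀ v, pairSub (diagonal D * A * diagonal (fun i => (D i)⁻¹)) (diagonal D * B * diagonal (fun i => (D i)⁻¹)) v
      = (ZZ D (matwt v))⁻¹ * pairSub A B v := by
    intro v
    rcases v with ⟨a, b⟩ | ⟨a, b⟩ <;>
    · simp only [pairSub, matwt, ZZ_rt hD, mul_diagonal, diagonal_mul, mul_inv, inv_inv]
      ring
  rw [eval_eq, eval_eq]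
  apply Finset.sum_congr rfl
  intro d hd
  congr 1
  simp only [h1, mul_pow]
  rw [Finset.prod_mul_distrib]
  have h2 : ∏ v ∈ d.support, (ZZ D (matwt v))⁻¹ ^ d v = 1 := by
    simp only [inv_pow]
    rw [Finset.prod_inv_distrib, inv_eq_one]
    have h3 := weight_zero h (mem_support_iff.1 hd)
    rw [Finsupp.weight_apply, Finsupp.sum] at h3
    unfold ZZ
    simp only [← Finset.prod_pow]
    rw [Finset.prod_comm]
    apply Finset.prod_eq_one
    intro i _
    have h4 := congrFun h3 i
    rw [Finset.sum_apply] at h4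
    have h5 : ∀ s : Finset (MatVar 5), ∏ x ∈ s, (D i ^ matwt x i) ^ d x = D i ^ (∑ x ∈ s, (d x • matwt x) i) := by
      intro s
      induction s using Finset.induction_on with
      | empty => simp
      | insert a s ha ih =>
        rw [Finset.prod_insert ha, Finset.sum_insert ha, zpow_add₀ (hD i), ih]
        congr 1
        rw [Pi.smul_apply, ← zpow_natCast, ← _root_.zpow_mul, nsmul_eq_mul, mul_comm]
    rw [h5, h4]
    simp
  rw [h2, one_mul]

theorem inv_iff (f : MvPolynomial (MatVar 5) K) : IsMatInvariant f ↔ ∀ i j, der K i j f = 0 := by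
  constructor
  · intro h
    have h1 : ∀ i j, i ≠ j → der K i j f = 0 := by
      intro i j hij
      rw [transv_iff hij]
      intro c A B
      have h2 := h ⟨transvection i j c, transvection i j (-c),
        by rw [transvection_mul_transvection_same _ _ hij]; simp,
        by rw [transvection_mul_transvection_same _ _ hij]; simp⟩ A B
      exact h2
    intro i j
    by_cases hij : i = j
    · subst hij; exact der_diag_zero h1 i
    · exact h1 i j hij
  · intro h a A B
    have key : ∀ M : Matrix (Fin 5) (Fin 5) K, M.det ≠ 0 → ∀ A B, MvPolynomial.eval
      (pairSub (M * A * M⁻¹) (M * B * M⁻¹)) f = MvPolynomial.eval (pairSub A B) f := by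
      intro M hM
      refine diagonal_transvection_induction_of_det_ne_zero (fun M => ∀ A B, MvPolynomial.eval
        (pairSub (M * A * M⁻¹) (M * B * M⁻¹)) f = MvPolynomial.eval (pairSub A B) f) M hM ?_ ?_ ?_
      · intro D hD A B
        have hD' : ∀ i, D i ≠ 0 := by
          rw [det_diagonal, Finset.prod_ne_zero_iff] at hD
          exact fun i => hD i (Finset.mem_univ i)
        have : (diagonal D)⁻¹ = diagonal (fun i => (D i)⁻¹) := by
          apply inv_eq_right_inv
          rw [diagonal_mul_diagonal, ← diagonal_one]
          congr 1
          funext i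
          exact mul_inv_cancel₀ (hD' i)
        rw [this]
        exact diag_inv (fun i => h i i) hD' A B
      · intro t A B
        have : (t.toMatrix)⁻¹ = transvection t.i t.j (-t.c) := by
          apply inv_eq_right_inv
          rw [TransvectionStruct.toMatrix, transvection_mul_transvection_same _ _ t.hij]; simp
        rw [this]
        exact (transv_iff t.hij f).1 (h t.i t.j) t.c A B
      · intro M N hM hN h1 h2 A B
        rw [Matrix.mul_inv_rev, ← h2 A B, ← h1 (N * A * N⁻¹)]
        simp only [Matrix.mul_assoc]
    have := key a.1 (by
      have := a.isUnit
      rw [Matrix.isUnit_iff_isUnit_det] at this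
      exact this.ne_zero) A B
    rw [coe_units_inv]
    exact this

theorem pureDim_eq (p q : ℕ) : ((pureDim K 5 p q : ℕ) : ℤ) =
    lin (fun v => ((Nat.card {d : II p q // Finsupp.weight matwt d.1 = v} : ℕ) : ℤ)) delta := by
  have : Finite (II p q) := finite_II p q
  have : FiniteDimensional K (WW K p q) := Module.Finite.of_basis (bW K p q)
  have h := (polyRep K p q).main
  rw [show (fun v => ((Nat.card {d : II p q // Finsupp.weight matwt d.1 = v} : ℕ) : ℤ)) =
    (fun v => ((Nat.card {a // (polyRep K p q).wt a = v} : ℕ) : ℤ)) from rfl, ← h]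
  congr 1
  have h1 : pureComponent K 5 p q = (((polyRep K p q).inv.map (WW K p q).subtype : Submodule K _) : Set _) := by
    ext f
    simp only [pureComponent, Set.mem_ofPred_eq, SetLike.mem_coe, Submodule.mem_map]
    constructor
    · rintro ⟨h1, h2⟩
      refine ⟨⟨f, h2⟩, ?_, rfl⟩
      rw [GlRep.mem_inv]
      intro i j
      exact Subtype.ext ((inv_iff f).1 h1 i j)
    · rintro ⟨⟨g, hg⟩, h1, rfl⟩
      refine ⟨?_, hg⟩
      rw [inv_iff]
      intro i j
      exact congrArg Subtype.val (GlRep.mem_inv _ _ |>.1 h1 i j)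
  rw [pureDim, Set.finrank, h1, Submodule.span_eq]
  exact LinearEquiv.finrank_eq (Submodule.equivMapOfInjective _ (Submodule.subtype_injective _) _).symm
end
end C52

namespace C52

abbrev Gm := Lex (Fin 7 → ℤ)
abbrev HH := HahnSeries Gm ℚ

def mono (v : Gm) : HH := HahnSeries.single v 1

theorem mono_add (u v : Gm) : mono (u + v) = mono u * mono v := by
  simp [mono, HahnSeries.single_mul_single]

theorem mono_zero : mono 0 = 1 := rfl

theorem mono_ne_zero (v : Gm) : mono v ≠ 0 := by
  simp [mono]

theorem mono_neg (v : Gm) : mono (-v) = (mono v)⁻¹ := by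
  apply eq_inv_of_mul_eq_one_left
  rw [← mono_add, neg_add_cancel, mono_zero]

theorem mono_sub (u v : Gm) : mono (u - v) = mono u / mono v := by
  rw [sub_eq_add_neg, mono_add, mono_neg, div_eq_mul_inv]

theorem mono_nsmul (n : ℕ) (v : Gm) : mono (n • v) = mono v ^ n := by
  induction n with
  | zero => simp [mono_zero]
  | succ n ih => rw [succ_nsmul, mono_add, ih, pow_succ]

theorem mono_zsmul (n : ℤ) (v : Gm) : mono (n • v) = mono v ^ n := by
  cases n with
  | ofNat n => simpa using mono_nsmul n v
  | negSucc n => rw [negSucc_zsmul, mono_neg, mono_nsmul, zpow_negSucc]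

theorem coeff_mono_mul (u v : Gm) (h : HH) : (mono u * h).coeff v = h.coeff (v - u) := by
  have := HahnSeries.coeff_single_mul_add (r := (1 : ℚ)) (x := h) (a := v - u) (b := u)
  rw [sub_add_cancel, one_mul] at this
  exact this

theorem coeff_mono (u v : Gm) : (mono u).coeff v = if v = u then 1 else 0 := by
  simp [mono, HahnSeries.coeff_single]

theorem mono_inj {u v : Gm} (h : mono u = mono v) : u = v := by
  by_contra hne
  have := congrArg (fun f => f.coeff u) h
  simp [coeff_mono, hne] at this

theorem one_sub_ne_zero {v : Gm} (h : v ≠ 0) : 1 - mono v ≠ 0 := by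
  intro h1
  exact h (mono_inj (by rw [← sub_eq_zero.1 h1, mono_zero]))

open Classical in
/-- restriction of the support -/
def res (S : Set Gm) : HH →+ HH where
  toFun h := ⟨fun v => if v ∈ S then h.coeff v else 0, h.isPWO_support.mono (by
    intro v hv
    simp only [Function.mem_support] at hv
    rw [HahnSeries.mem_support]
    intro h0
    exact hv (by simp [h0]))⟩
  map_zero' := by ext v; simp
  map_add' f g := by
    ext v
    simp only [HahnSeries.coeff_add]
    split_ifs <;> simp

open Classical in
theorem coeff_res (S : Set Gm) (h : HH) (v : Gm) : (res S h).coeff v = if v ∈ S then h.coeff v else 0 := rfl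

/-- series with support in a submonoid -/
def SM (M : AddSubmonoid Gm) : Subring HH where
  carrier := {h | h.support ⊆ M}
  mul_mem' {a b} ha hb := by
    intro v hv
    obtain ⟨x, hx, y, hy, rfl⟩ := HahnSeries.support_mul_subset hv
    exact M.add_mem (ha hx) (hb hy)
  one_mem' := by
    intro v hv
    by_contra h
    apply hv
    rw [← mono_zero, coeff_mono, if_neg]
    rintro rfl
    exact h M.zero_mem
  add_mem' {a b} ha hb := by
    intro v hv
    by_contra h
    apply hv
    have h1 : a.coeff v = 0 := by by_contra h2; exact h (ha h2)
    have h2 : b.coeff v = 0 := by by_contra h2; exact h (hb h2)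
    simp [h1, h2]
  zero_mem' := by intro v hv; simp at hv
  neg_mem' {a} ha := by
    intro v hv
    apply ha
    simpa using hv

theorem mem_SM {M : AddSubmonoid Gm} {h : HH} : h ∈ SM M ↔ ∀ v, h.coeff v ≠ 0 → v ∈ M := Iff.rfl

theorem mono_mem_SM {M : AddSubmonoid Gm} {v : Gm} (h : v ∈ M) : mono v ∈ SM M := by
  rw [mem_SM]
  intro u hu
  rw [coeff_mono] at hu
  split_ifs at hu with h1
  · rwa [h1]
  · exact absurd rfl hu

open Classical in
def geo (w : Gm) (hw : 0 < w) : HH :=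
  ⟨fun v => if v ∈ AddSubmonoid.multiples w then 1 else 0, by
    have : (Set.IsPWO ((AddSubmonoid.closure {w} : AddSubmonoid Gm) : Set Gm)) :=
      Set.IsPWO.addSubmonoid_closure (by simpa using hw.le) (Set.isPWO_singleton w)
    apply this.mono
    intro v hv
    rw [AddSubmonoid.closure_singleton_eq]
    simp only [Function.mem_support, ne_eq, ite_eq_right_iff, not_forall] at hv
    exact hv.1⟩

theorem geo_mul (w : Gm) (hw : 0 < w) : (1 - mono w) * geo w hw = 1 := by
  ext v
  rw [sub_mul, one_mul, HahnSeries.coeff_sub, coeff_mono_mul, ← mono_zero, coeff_mono]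
  simp only [geo]
  have h1 : v = 0 → v - w ∉ AddSubmonoid.multiples w := by
    rintro rfl ⟨n, hn⟩
    have h2 : 0 ≤ n • w := nsmul_nonneg hw.le n
    simp only at hn
    rw [hn] at h2
    have : (0 : Gm) - w < 0 := by simpa using hw
    exact absurd h2 (not_le.2 this)
  have h2 : v - w ∈ AddSubmonoid.multiples w → v ∈ AddSubmonoid.multiples w := by
    rintro ⟨n, hn⟩
    refine ⟨n + 1, ?_⟩
    simp only at hn ⊢
    rw [succ_nsmul, hn, sub_add_cancel]
  have h3 : v ≠ 0 → v ∈ AddSubmonoid.multiples w → v - w ∈ AddSubmonoid.multiples w := by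
    rintro h0 ⟨n, hn⟩
    cases n with
    | zero => simp at hn; exact absurd hn.symm h0
    | succ n =>
      refine ⟨n, ?_⟩
      simp only at hn ⊢
      rw [← hn, succ_nsmul, add_sub_cancel_right]
  by_cases hv : v = 0
  · rw [if_pos hv, if_neg (h1 hv), if_pos (by rw [hv]; exact zero_mem _)]; simp
  · rw [if_neg hv]
    by_cases h4 : v ∈ AddSubmonoid.multiples w
    · rw [if_pos h4, if_pos (h3 hv h4)]; simp
    · rw [if_neg h4, if_neg (fun h => h4 (h2 h))]; simp

theorem inv_mem_SM {M : AddSubmonoid Gm} {w : Gm} (hw : 0 < w) (h : w ∈ M) : (1 - mono w)⁻¹ ∈ SM M := by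
  have h1 : (1 - mono w)⁻¹ = geo w hw := (eq_inv_of_mul_eq_one_right (geo_mul w hw)).symm
  rw [h1, mem_SM]
  intro v hv
  simp only [geo] at hv
  split_ifs at hv with h2
  · obtain ⟨n, rfl⟩ := h2
    exact M.nsmul_mem h n
  · exact absurd rfl hv

section CT
/-- constant term in the variable `k` -/
def CT (k : Fin 7) : HH →+ HH := res {v | ofLex v k = 0}

theorem coeff_CT (k : Fin 7) (h : HH) (v : Gm) : (CT k h).coeff v = if ofLex v k = 0 then h.coeff v else 0 := by
  rw [CT, coeff_res]
  congr 1

theorem CT_one (k) : CT k 1 = 1 := by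
  ext v
  rw [coeff_CT, ← mono_zero, coeff_mono]
  by_cases h : v = 0
  · rw [if_pos h, if_pos]
    rw [h]; rfl
  · simp [h]

def FF (k : Fin 7) : Subfield HH where
  carrier := {r | ∀ h, CT k (r * h) = r * CT k h}
  mul_mem' {a b} ha hb h := by rw [mul_assoc, ha, hb, mul_assoc]
  one_mem' h := by simp
  add_mem' {a b} ha hb h := by rw [add_mul, map_add, ha, hb, add_mul]
  zero_mem' h := by simp
  neg_mem' {a} ha h := by rw [neg_mul, map_neg, ha, neg_mul]
  inv_mem' a ha h := by
    by_cases h0 : a = 0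
    · subst h0; simp
    · have := ha (a⁻¹ * h)
      rw [mul_inv_cancel_left₀ h0] at this
      rw [this, inv_mul_cancel_left₀ h0]

theorem mem_FF {k : Fin 7} {r : HH} : r ∈ FF k ↔ ∀ h, CT k (r * h) = r * CT k h := Iff.rfl

theorem CT_FF {k : Fin 7} {r : HH} (h : r ∈ FF k) : CT k r = r := by
  have := mem_FF.1 h 1
  rwa [mul_one, CT_one, mul_one] at this

theorem mono_mem_FF {k : Fin 7} {v : Gm} (hv : ofLex v k = 0) : mono v ∈ FF k := by
  rw [mem_FF]
  intro h
  ext u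
  rw [coeff_CT, coeff_mono_mul, coeff_mono_mul, coeff_CT]
  have : (ofLex (u - v)) k = ofLex u k := by
    change ofLex u k - ofLex v k = _
    rw [hv, sub_zero]
  rw [this]

theorem coeff_FF {k : Fin 7} {r : HH} (hr : r ∈ FF k) {v : Gm} (h : r.coeff v ≠ 0) : ofLex v k = 0 := by
  rw [← CT_FF hr, coeff_CT] at h
  by_contra h1
  rw [if_neg h1] at h
  exact h rfl

end CT
end C52

namespace C52

def picks {α : Type*} : List α → List (α × List α)
  | [] => []
  | a :: l => (a, l) :: (picks l).map (fun x => (x.1, a :: x.2))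

def halfM (k : Fin 7) (σ : ℤ) : AddSubmonoid Gm where
  carrier := {v | 0 ≤ σ * ofLex v k}
  add_mem' {a b} ha hb := by
    change 0 ≤ σ * (ofLex a k + ofLex b k)
    rw [mul_add]
    exact add_nonneg ha hb
  zero_mem' := by
    change 0 ≤ σ * (0 : ℤ)
    simp

section
variable (k : Fin 7) (σ : ℤ)

def ek : Gm := toLex (Pi.single k σ)

def Zk : HH := mono (ek k σ)

theorem ek_k : ofLex (ek k σ) k = σ := by simp [ek]

theorem ek_nsmul (n : ℕ) : ofLex (n • ek k σ) k = n * σ := by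
  have : ofLex (n • ek k σ) k = n • (ofLex (ek k σ) k) := rfl
  rw [this, ek_k, nsmul_eq_mul]

theorem CT_shift_zero (hσ : σ * σ = 1) {h : HH} (hh : h ∈ SM (halfM k σ)) {u : Gm} (hu : 0 < σ * ofLex u k) :
    CT k (mono u * h) = 0 := by
  ext v
  rw [coeff_CT, coeff_mono_mul]
  split_ifs with h1
  · by_contra h2
    have h3 : 0 ≤ σ * (ofLex v k - ofLex u k) := mem_SM.1 hh _ h2
    rw [h1] at h3
    linarith
  · rfl

theorem CT_geo (hσ : σ * σ = 1) {a : Gm} (ha : 0 < a) (hk : ofLex a k = σ) : CT k (1 - mono a)⁻¹ = 1 := by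
  have hne : 1 - mono a ≠ 0 := one_sub_ne_zero ha.ne'
  have h1 : (1 - mono a)⁻¹ = 1 + mono a * (1 - mono a)⁻¹ := by
    field_simp; ring
  rw [h1, map_add, CT_one, CT_shift_zero k σ hσ, add_zero]
  · apply inv_mem_SM ha
    change 0 ≤ σ * ofLex a k
    rw [hk, hσ]; norm_num
  · rw [hk, hσ]; norm_num

def Sm (α : FF k) : Prop := ∃ a : Gm, (α : HH) * Zk k σ = mono a ∧ 0 < a ∧ ofLex a k = σ
def Lg (α : FF k) : Prop := ∃ a : Gm, (α : HH) * Zk k σ = mono a ∧ a < 0 ∧ ofLex a k = σ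

def lpol (l : List (FF k)) : Polynomial (FF k) := (l.map fun β => 1 - Polynomial.C β * Polynomial.X).prod

theorem degree_C_mul_le' (c : FF k) (p : Polynomial (FF k)) : (Polynomial.C c * p).degree ≤ p.degree := by
  refine (Polynomial.degree_mul_le _ _).trans ?_
  calc _ ≤ 0 + p.degree := by gcongr; exact Polynomial.degree_C_le
    _ = _ := zero_add _

theorem lpol_deg (l : List (FF k)) : (lpol k l).degree ≤ (l.length : ℕ) := by
  induction l with
  | nil => simp [lpol]
  | cons a l ih =>
    rw [lpol, List.map_cons, List.prod_cons, List.length_cons]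
    refine (Polynomial.degree_mul_le _ _).trans ?_
    rw [add_comm]
    push_cast
    refine add_le_add ih ?_
    refine (Polynomial.degree_sub_le _ _).trans (max_le ?_ ?_)
    · exact Polynomial.degree_one_le.trans (by norm_num)
    · exact (Polynomial.degree_C_mul_X_le _)

theorem lpol_eval (l : List (FF k)) (x : FF k) : (lpol k l).eval x = (l.map fun β => 1 - β * x).prod := by
  induction l with
  | nil => simp [lpol]
  | cons a l ih =>
    rw [lpol, List.map_cons, List.prod_cons, Polynomial.eval_mul, List.map_cons, List.prod_cons, ← ih]
    simp [lpol]

theorem lpol_aeval (l : List (FF k)) (x : HH) : Polynomial.aeval x (lpol k l) = (l.map fun β : FF k => 1 - (β : HH) * x).prod := by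
  induction l with
  | nil => simp [lpol]
  | cons a l ih =>
    rw [lpol, List.map_cons, List.prod_cons, map_mul, List.map_cons, List.prod_cons, ← ih]
    simp [lpol]
    exact Or.inl (Or.inl rfl)

theorem lg_inv (hσ : σ * σ = 1) (B : List (FF k)) (hB : ∀ β ∈ B, Lg k σ β) :
    ∃ h ∈ SM (halfM k (-σ)), (Polynomial.aeval (Zk k σ) (lpol k B))⁻¹ = mono (-(B.length • ek k σ)) * h := by
  induction B with
  | nil => exact ⟨1, one_mem _, by simp [lpol, mono_zero]⟩
  | cons b B ih =>
    obtain ⟨h, hh, h1⟩ := ih (fun β hβ => hB β (List.mem_cons_of_mem _ hβ))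
    obtain ⟨a, ha, ha0, hak⟩ := hB b (List.mem_cons_self)
    have ha1 : 0 < -a := by simpa using ha0
    refine ⟨-(mono (ek k σ - a) * (1 - mono (-a))⁻¹ * h), ?_, ?_⟩
    · apply neg_mem
      apply mul_mem _ hh
      apply mul_mem
      · apply mono_mem_SM
        change 0 ≤ -σ * (ofLex (ek k σ) k - ofLex a k)
        rw [ek_k, hak]; simp
      · apply inv_mem_SM ha1
        change 0 ≤ -σ * (- ofLex a k)
        rw [hak]; simp [hσ]
    · rw [lpol_aeval] at h1 ⊢
      rw [List.map_cons, List.prod_cons, mul_inv, h1, ha]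
      have h2 : (1 - mono a)⁻¹ = - (mono (-a) * (1 - mono (-a))⁻¹) := by
        have h3 : 1 - mono a ≠ 0 := one_sub_ne_zero ha0.ne
        have h4 : 1 - mono (-a) ≠ 0 := one_sub_ne_zero ha1.ne'
        have h5 : mono a * mono (-a) = 1 := by rw [← mono_add]; simp [mono_zero]
        field_simp
        linear_combination (-1) * h5
      rw [h2, List.length_cons, succ_nsmul, neg_add, mono_add, sub_eq_add_neg (ek k σ), mono_add (ek k σ)]
      have h5 : mono (ek k σ) * mono (-(ek k σ)) = 1 := by rw [← mono_add]; simp [mono_zero]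
      linear_combination (mono (-a) * (1 - mono (-a))⁻¹ * mono (-(B.length • ek k σ)) * h) * h5

theorem CT_base (hσ : σ * σ = 1) (B : List (FF k)) (hB : ∀ β ∈ B, Lg k σ β) (p : Polynomial (FF k))
    (hp : p.degree < (B.length : ℕ)) :
    CT k (Polynomial.aeval (Zk k σ) p / Polynomial.aeval (Zk k σ) (lpol k B)) = 0 := by
  by_cases hp0 : p = 0
  · simp [hp0]
  obtain ⟨h, hh, h1⟩ := lg_inv k σ hσ B hB
  rw [div_eq_mul_inv, h1, Polynomial.aeval_eq_sum_range' ((Polynomial.natDegree_lt_iff_degree_lt hp0).2 hp),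
    Finset.sum_mul, map_sum]
  apply Finset.sum_eq_zero
  intro i hi
  rw [Finset.mem_range] at hi
  have h2 : p.coeff i • Zk k σ ^ i * (mono (-(B.length • ek k σ)) * h) =
      (p.coeff i : HH) * (mono (i • ek k σ + -(B.length • ek k σ)) * h) := by
    rw [mono_add, mono_nsmul, Zk, Subfield.smul_def, smul_eq_mul]; ring
  rw [h2, mem_FF.1 (p.coeff i).2, CT_shift_zero k (-σ) (by simpa using hσ) hh, mul_zero]
  change 0 < -σ * (ofLex (i • ek k σ) k + - ofLex (B.length • ek k σ) k)
  rw [ek_nsmul, ek_nsmul]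
  have : -σ * (i * σ + -(B.length * σ)) = (B.length - i) * (σ * σ) := by ring
  rw [this, hσ]
  have : (i : ℤ) < B.length := by exact_mod_cast hi
  linarith

theorem Sm.ne_zero {k σ} {α : FF k} (h : Sm k σ α) : α ≠ 0 := by
  rintro rfl
  obtain ⟨a, ha, -⟩ := h
  simp at ha
  exact mono_ne_zero a ha.symm

theorem CT_main (hσ : σ * σ = 1) (B : List (FF k)) (hB : ∀ β ∈ B, Lg k σ β) (A : List (FF k))
    (hA : ∀ α ∈ A, Sm k σ α) (hAB : ∀ x ∈ picks A, ∀ β ∈ x.2 ++ B, 1 - β * x.1⁻¹ ≠ 0)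
    (p : Polynomial (FF k)) (hp : p.degree < ((A.length + B.length : ℕ) : WithBot ℕ)) :
    CT k (Polynomial.aeval (Zk k σ) p / Polynomial.aeval (Zk k σ) (lpol k (A ++ B))) =
      ((picks A).map fun x => ((p.eval x.1⁻¹ / (lpol k (x.2 ++ B)).eval x.1⁻¹ : FF k) : HH)).sum := by
  induction A generalizing p with
  | nil => simpa [picks] using CT_base k σ hσ B hB p (by simpa using hp)
  | cons α A ih =>
    have hα := hA α List.mem_cons_self
    have hα0 := hα.ne_zero
    obtain ⟨a, haZ, ha0, hak⟩ := hα
    have hq : (lpol k (A ++ B)).eval α⁻¹ ≠ 0 := by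
      rw [lpol_eval]
      apply List.prod_ne_zero
      intro h
      rw [List.mem_map] at h
      obtain ⟨β, hβ, h⟩ := h
      exact hAB (α, A) (by simp [picks]) β hβ h
    set q := lpol k (A ++ B) with hqd
    set r := p.eval α⁻¹ / q.eval α⁻¹ with hr
    have hroot : (p - Polynomial.C r * q).IsRoot α⁻¹ := by
      simp only [Polynomial.IsRoot.def, Polynomial.eval_sub, Polynomial.eval_mul, Polynomial.eval_C, hr]
      rw [div_mul_cancel₀ _ hq, sub_self]
    obtain ⟨p2, hp2⟩ := Polynomial.dvd_iff_isRoot.2 hroot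
    have hdeg : p2.degree < ((A.length + B.length : ℕ) : WithBot ℕ) := by
      by_cases h0 : p2 = 0
      · rw [h0, Polynomial.degree_zero]; exact WithBot.bot_lt_coe _
      have h1 : (p - Polynomial.C r * q).degree ≤ ((A.length + B.length : ℕ) : WithBot ℕ) := by
        refine (Polynomial.degree_sub_le _ _).trans (max_le ?_ ?_)
        · rw [List.length_cons] at hp
          by_cases hp0 : p = 0
          · rw [hp0, Polynomial.degree_zero]; exact bot_le
          rw [Polynomial.degree_eq_natDegree hp0] at hp ⊢
          norm_cast at hp ⊢
          omega
        · refine (degree_C_mul_le' k _ _).trans ?_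
          refine (lpol_deg k _).trans ?_
          rw [List.length_append]
      rw [hp2, Polynomial.degree_mul, Polynomial.degree_X_sub_C, Polynomial.degree_eq_natDegree h0] at h1
      rw [Polynomial.degree_eq_natDegree h0]
      norm_cast at h1 ⊢
      omega
    have hpe : p = Polynomial.C r * q + (1 - Polynomial.C α * Polynomial.X) * (Polynomial.C (-α⁻¹) * p2) := by
      have h1 : (1 - Polynomial.C α * Polynomial.X) * (Polynomial.C (-α⁻¹) * p2) = (Polynomial.X - Polynomial.C α⁻¹) * p2 := by
        have h2 : (Polynomial.C α * Polynomial.C α⁻¹ : Polynomial (FF k)) = 1 := by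
          rw [← Polynomial.C_mul, mul_inv_cancel₀ hα0, Polynomial.C_1]
        rw [Polynomial.C_neg]
        linear_combination (Polynomial.X * p2) * h2
      rw [h1, ← hp2]; ring
    have hih := ih (fun β hβ => hA β (List.mem_cons_of_mem _ hβ))
      (fun x hx β hβ => hAB (x.1, α :: x.2) (by
        rw [picks]; apply List.mem_cons_of_mem; exact List.mem_map.2 ⟨x, hx, rfl⟩) β (by
          rw [List.cons_append]; exact List.mem_cons_of_mem _ hβ)) (Polynomial.C (-α⁻¹) * p2)
      ((degree_C_mul_le' k _ _).trans_lt hdeg)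
    have hne : ∀ β ∈ A ++ B, 1 - (β : HH) * Zk k σ ≠ 0 := by
      intro β hβ
      rcases List.mem_append.1 hβ with h | h
      · obtain ⟨b, hb, hb0, -⟩ := hA β (List.mem_cons_of_mem _ h)
        rw [hb]; exact one_sub_ne_zero hb0.ne'
      · obtain ⟨b, hb, hb0, -⟩ := hB β h
        rw [hb]; exact one_sub_ne_zero hb0.ne
    have hQ : Polynomial.aeval (Zk k σ) q ≠ 0 := by
      rw [hqd, lpol_aeval]
      apply List.prod_ne_zero
      intro h
      rw [List.mem_map] at h
      obtain ⟨β, hβ, h⟩ := h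
      exact hne β hβ h
    have hal : 1 - mono a ≠ 0 := one_sub_ne_zero ha0.ne'
    have hZ : Polynomial.aeval (Zk k σ) p / Polynomial.aeval (Zk k σ) (lpol k (α :: A ++ B)) =
        (r : HH) * (1 - mono a)⁻¹ + Polynomial.aeval (Zk k σ) (Polynomial.C (-α⁻¹) * p2) / Polynomial.aeval (Zk k σ) q := by
      have h1 : Polynomial.aeval (Zk k σ) (lpol k (α :: A ++ B)) = (1 - mono a) * Polynomial.aeval (Zk k σ) q := by
        rw [hqd, lpol_aeval, lpol_aeval, List.cons_append, List.map_cons, List.prod_cons, haZ]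
      have h2 : Polynomial.aeval (Zk k σ) p = (r : HH) * Polynomial.aeval (Zk k σ) q +
          (1 - mono a) * Polynomial.aeval (Zk k σ) (Polynomial.C (-α⁻¹) * p2) := by
        conv_lhs => rw [hpe]
        rw [map_add, map_mul, map_mul _ (1 - _), map_sub, map_one, map_mul _ (Polynomial.C α), Polynomial.aeval_C,
          Polynomial.aeval_C, Polynomial.aeval_X, ← haZ]
        rfl
      rw [h1, h2]
      field_simp
    rw [hZ, map_add, mem_FF.1 r.2, CT_geo k σ hσ ha0 hak, mul_one, hih]
    rw [picks, List.map_cons, List.sum_cons, List.map_map]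
    congr 1
    apply congrArg List.sum
    apply List.map_congr_left
    intro x hx
    simp only [Function.comp]
    congr 1
    have hxm : (x.1, α :: x.2) ∈ picks (α :: A) := by
      rw [picks]; apply List.mem_cons_of_mem; exact List.mem_map.2 ⟨x, hx, rfl⟩
    have h1 : 1 - α * x.1⁻¹ ≠ 0 := hAB _ hxm α (by simp)
    have hxA : x.1 ∈ A := by
      clear * - hx
      induction A generalizing x with
      | nil => simp [picks] at hx
      | cons b A ih =>
        rw [picks] at hx
        rcases List.mem_cons.1 hx with rfl | hx
        · simp
        · obtain ⟨y, hy, rfl⟩ := List.mem_map.1 hx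
          exact List.mem_cons_of_mem _ (ih y hy)
    have hx0 : x.1 ≠ 0 := (hA x.1 (List.mem_cons_of_mem _ hxA)).ne_zero
    have h2 : q.eval x.1⁻¹ = 0 := by
      rw [hqd, lpol_eval]
      apply List.prod_eq_zero
      rw [List.mem_map]
      exact ⟨x.1, List.mem_append_left _ hxA, by rw [mul_inv_cancel₀ hx0, sub_self]⟩
    have h3 : p.eval x.1⁻¹ = (1 - α * x.1⁻¹) * (Polynomial.C (-α⁻¹) * p2).eval x.1⁻¹ := by
      conv_lhs => rw [hpe]
      simp [h2]
    rw [h3, List.cons_append]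
    rw [show (lpol k (α :: (x.2 ++ B))).eval x.1⁻¹ = (1 - α * x.1⁻¹) * (lpol k (x.2 ++ B)).eval x.1⁻¹ by
      rw [lpol_eval, lpol_eval, List.map_cons, List.prod_cons]]
    rw [mul_div_mul_left _ _ h1]
end
end C52

namespace C52

structure V where
  s : Int
  t : Int
  a : Int
  b : Int
  c : Int
  d : Int
  e : Int

namespace V
def eqb (u v : V) : Bool := u.s == v.s && u.t == v.t && u.a == v.a && u.b == v.b && u.c == v.c && u.d == v.d && u.e == v.e

theorem eqb_iff (u v : V) : eqb u v = true ↔ u = v := by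
  cases u; cases v
  simp [eqb, and_assoc]

instance : DecidableEq V := fun u v =>
  if h : eqb u v = true then isTrue ((eqb_iff u v).1 h) else isFalse (fun h1 => h ((eqb_iff u v).2 h1))

def get (v : V) : Nat → Int
  | 0 => v.s
  | 1 => v.t
  | 2 => v.a
  | 3 => v.b
  | 4 => v.c
  | 5 => v.d
  | _ => v.e

def add (u v : V) : V := ⟨u.s + v.s, u.t + v.t, u.a + v.a, u.b + v.b, u.c + v.c, u.d + v.d, u.e + v.e⟩
def sub (u v : V) : V := ⟨u.s - v.s, u.t - v.t, u.a - v.a, u.b - v.b, u.c - v.c, u.d - v.d, u.e - v.e⟩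
def neg (u : V) : V := ⟨-u.s, -u.t, -u.a, -u.b, -u.c, -u.d, -u.e⟩
def smul (n : Int) (u : V) : V := ⟨n * u.s, n * u.t, n * u.a, n * u.b, n * u.c, n * u.d, n * u.e⟩
def zero : V := ⟨0, 0, 0, 0, 0, 0, 0⟩

def posl : List Int → Bool
  | [] => false
  | x :: l => if 0 < x then true else if x < 0 then false else posl l

def pos (u : V) : Bool := posl [u.s, u.t, u.a, u.b, u.c, u.d, u.e]

def vec (v : V) : Gm := toLex ![v.s, v.t, v.a, v.b, v.c, v.d, v.e]

theorem get_vec (v : V) (k : Fin 7) : ofLex v.vec k = v.get k.1 := by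
  fin_cases k <;> rfl

theorem vec_add (u v : V) : (u.add v).vec = u.vec + v.vec := by
  apply ofLex.injective
  funext k
  change ofLex (u.add v).vec k = ofLex u.vec k + ofLex v.vec k
  simp only [get_vec]
  fin_cases k <;> rfl

theorem vec_sub (u v : V) : (u.sub v).vec = u.vec - v.vec := by
  apply ofLex.injective
  funext k
  change ofLex (u.sub v).vec k = ofLex u.vec k - ofLex v.vec k
  simp only [get_vec]
  fin_cases k <;> rfl

theorem vec_neg (u : V) : (u.neg).vec = - u.vec := by
  apply ofLex.injective
  funext k
  change ofLex u.neg.vec k = - ofLex u.vec k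
  simp only [get_vec]
  fin_cases k <;> rfl

theorem vec_smul (n : ℤ) (u : V) : (smul n u).vec = n • u.vec := by
  apply ofLex.injective
  funext k
  change ofLex (smul n u).vec k = n • ofLex u.vec k
  simp only [get_vec, smul_eq_mul]
  fin_cases k <;> rfl

theorem vec_zero : zero.vec = 0 := by
  apply ofLex.injective
  funext k
  change ofLex zero.vec k = (0 : ℤ)
  simp only [get_vec]
  fin_cases k <;> rfl

theorem vec_inj {u v : V} (h : u.vec = v.vec) : u = v := by
  have h1 : ∀ k, u.get k = v.get k := by
    intro k
    by_cases hk : k < 7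
    · rw [← get_vec u ⟨k, hk⟩, ← get_vec v ⟨k, hk⟩, h]
    · have h6 : u.get 6 = v.get 6 := by
        have := get_vec u 6
        have h2 := get_vec v 6
        rw [h, h2] at this
        exact this.symm
      match k, hk with
      | (n+7), _ => exact h6
  cases u; cases v
  simp only [V.mk.injEq]
  exact ⟨h1 0, h1 1, h1 2, h1 3, h1 4, h1 5, h1 6⟩

theorem vec_ne_zero {u : V} (h : u ≠ zero) : u.vec ≠ 0 := fun h1 => h (vec_inj (h1.trans vec_zero.symm))

theorem posl_iff (l : List Int) (h : posl l = true) : ∃ i : ℕ, ∃ hi : i < l.length, 0 < l[i] ∧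
    ∀ j (hj : j < i), l[j]'(hj.trans hi) = 0 := by
  induction l with
  | nil => simp [posl] at h
  | cons x l ih =>
    unfold posl at h
    split_ifs at h with h1 h2
    · exact ⟨0, by simp, by simpa using h1, by simp⟩
    · obtain ⟨i, hi, h3, h4⟩ := ih h
      refine ⟨i + 1, by simpa using hi, by simpa using h3, ?_⟩
      intro j hj
      cases j with
      | zero => simp; omega
      | succ j => simpa using h4 j (by omega)

theorem pos_vec {u : V} (h : u.pos = true) : 0 < u.vec := by
  obtain ⟨i, hi, h1, h2⟩ := posl_iff _ h
  have hi7 : i < 7 := hi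
  have hg : ∀ k (hk : k < 7), ([u.s, u.t, u.a, u.b, u.c, u.d, u.e] : List Int)[k]'hk = ofLex u.vec ⟨k, hk⟩ := by
    intro k hk
    interval_cases k <;> rfl
  refine ⟨⟨i, hi7⟩, ?_, ?_⟩
  · intro j hj
    have := h2 j.1 hj
    rw [hg] at this
    exact this.symm
  · rw [hg i hi7] at h1
    exact h1
end V

def om (v : V) : HH := 1 - mono v.vec
def prodOM (l : List V) : HH := (l.map om).prod

theorem prodOM_nil : prodOM [] = 1 := rfl
theorem prodOM_cons (v l) : prodOM (v :: l) = om v * prodOM l := by simp [prodOM]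
theorem prodOM_append (l l') : prodOM (l ++ l') = prodOM l * prodOM l' := by simp [prodOM]
theorem prodOM_perm {l l' : List V} (h : l.Perm l') : prodOM l = prodOM l' := (h.map om).prod_eq

theorem om_ne_zero {v : V} (h : v.pos = true) : om v ≠ 0 := one_sub_ne_zero (V.pos_vec h).ne'

theorem prodOM_filter (p : V → Bool) (l : List V) :
    prodOM l = prodOM (l.filter p) * prodOM (l.filter fun v => !p v) := by
  induction l with
  | nil => simp [prodOM]
  | cons v l ih =>
    rw [prodOM_cons, ih]
    by_cases h : p v = true
    · rw [List.filter_cons_of_pos h, List.filter_cons_of_neg (by simp [h]), prodOM_cons]; ring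
    · rw [List.filter_cons_of_neg h, List.filter_cons_of_pos (by simpa using h), prodOM_cons]; ring

structure Tm where
  c : Int
  m : V
  num : List V
  den : List V

def Tm.val (T : Tm) : HH := (T.c : HH) * mono T.m.vec * prodOM T.num / prodOM T.den
def vals (l : List Tm) : HH := (l.map Tm.val).sum
theorem vals_nil : vals [] = 0 := rfl
theorem vals_cons (T l) : vals (T :: l) = T.val + vals l := by simp [vals]
theorem vals_append (l l') : vals (l ++ l') = vals l + vals l' := by simp [vals]

/-- flip the factors satisfying `p` -/
def flip (p : V → Bool) : List V → Int × V × List V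
  | [] => (1, V.zero, [])
  | v :: l => match flip p l with
    | (c, m, l') => if p v then (-c, m.add v, v.neg :: l') else (c, m, v :: l')

theorem flip_spec (p : V → Bool) (l : List V) : prodOM l = ((flip p l).1 : HH) * mono (flip p l).2.1.vec * prodOM (flip p l).2.2 ∧
    (flip p l).1 * (flip p l).1 = 1 := by
  induction l with
  | nil => simp [flip, prodOM_nil, V.vec_zero, mono_zero]
  | cons v l ih =>
    obtain ⟨h1, h2⟩ := ih
    rw [flip]
    split_ifs with h
    · constructor
      · simp only [prodOM_cons]
        rw [h1, V.vec_add, mono_add]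
        have h3 : om v = - (mono v.vec * om v.neg) := by
          have h5 : mono v.vec * mono (-v.vec) = 1 := by rw [← mono_add]; simp [mono_zero]
          simp only [om, V.vec_neg]
          linear_combination (-1) * h5
        rw [h3]
        push_cast
        ring
      · simpa using h2
    · constructor
      · simp only [prodOM_cons]
        rw [h1]; ring
      · exact h2

def orient (p : V → Bool) (T : Tm) : Tm :=
  match flip p T.num, flip p T.den with
  | (c1, m1, n), (c2, m2, d) => ⟨T.c * c1 * c2, (T.m.add m1).sub m2, n, d⟩

theorem orient_val (p : V → Bool) (T : Tm) : (orient p T).val = T.val := by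
  obtain ⟨h1, h2⟩ := flip_spec p T.num
  obtain ⟨h3, h4⟩ := flip_spec p T.den
  simp only [Tm.val, orient]
  rw [h1, h3, V.vec_sub, V.vec_add, mono_sub, mono_add]
  have h5 : (((flip p T.den).1 : ℤ) : HH)⁻¹ = ((flip p T.den).1 : HH) := by
    symm
    apply eq_inv_of_mul_eq_one_left
    rw [← Int.cast_mul, h4, Int.cast_one]
  simp only [div_eq_mul_inv, mul_inv, h5]
  push_cast
  ring

def cancel : List V → List V → List V × List V
  | [], d => ([], d)
  | v :: l, d => if v.pos && d.contains v then cancel l (d.erase v) else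
      match cancel l d with
      | (n, d') => (v :: n, d')

theorem prodOM_erase {v : V} {d : List V} (h : v ∈ d) : prodOM d = om v * prodOM (d.erase v) := by
  rw [← prodOM_cons]
  exact prodOM_perm (List.perm_cons_erase h)

theorem cancel_spec (l d : List V) : prodOM l / prodOM d = prodOM (cancel l d).1 / prodOM (cancel l d).2 := by
  induction l generalizing d with
  | nil => rfl
  | cons v l ih =>
    rw [cancel]
    split_ifs with h
    · rw [Bool.and_eq_true] at h
      rw [← ih, prodOM_cons, prodOM_erase (v := v) (d := d) (by simpa using h.2), mul_div_mul_left _ _ (om_ne_zero h.1)]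
    · simp only [prodOM_cons]
      rw [mul_div_assoc, ih, mul_div_assoc]

def norm (T : Tm) : List Tm :=
  match orient (fun v => v.neg.pos) T with
  | ⟨c, m, n, d⟩ => if n.contains V.zero then [] else
    match cancel n d with
    | (n', d') => [⟨c, m, n', d'⟩]

theorem norm_val (T : Tm) : vals (norm T) = T.val := by
  rw [← orient_val (fun v => v.neg.pos) T, norm]
  generalize orient (fun v => v.neg.pos) T = S
  obtain ⟨c, m, n, d⟩ := S
  simp only
  split_ifs with h
  · rw [vals_nil, Tm.val]
    have : prodOM n = 0 := by
      rw [prodOM_erase (v := V.zero) (by simpa using h), om, V.vec_zero, mono_zero]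
      simp
    simp [this]
  · rw [vals_cons, vals_nil, add_zero, Tm.val, Tm.val]
    simp only
    rw [mul_div_assoc, mul_div_assoc, ← cancel_spec]

def normAll (l : List Tm) : List Tm := l.flatMap norm

theorem normAll_val (l : List Tm) : vals (normAll l) = vals l := by
  induction l with
  | nil => rfl
  | cons T l ih =>
    rw [normAll, List.flatMap_cons, vals_append, norm_val, vals_cons, ← ih, normAll]

end C52

namespace C52

def substT (num0 numK den0 B : List V) (c : Int) (m : V) (e : Int) (x : V × List V) : Tm :=
  ⟨c, m.sub (V.smul e x.1), num0 ++ numK.map (fun w => w.sub x.1), den0 ++ (x.2 ++ B).map (fun w => w.sub x.1)⟩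

def rule (k : Nat) (σ : Int) (T : Tm) : Option (List Tm) :=
  match orient (fun v => v.get k == -σ) T with
  | ⟨c, m, num, den⟩ =>
    let num0 := num.filter (fun v => v.get k == 0)
    let numK := num.filter (fun v => !(v.get k == 0))
    let den0 := den.filter (fun v => v.get k == 0)
    let denK := den.filter (fun v => !(v.get k == 0))
    let A := denK.filter (fun v => v.pos)
    let B := denK.filter (fun v => !v.pos)
    let e := σ * m.get k
    if numK.all (fun v => v.get k == σ) && denK.all (fun v => v.get k == σ) && B.all (fun v => v.neg.pos)
      && decide (0 ≤ e) && decide (e.toNat + numK.length < A.length + B.length)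
      && (picks A).all (fun x => (x.2 ++ B).all (fun b => !(b == x.1))) then
      some ((picks A).map (substT num0 numK den0 B c m e))
    else none

section
variable (k : Fin 7) (σ : ℤ)

open Classical in
def al (a : V) : FF k := if h : ofLex a.vec k = σ then ⟨mono (a.vec - ek k σ), mono_mem_FF (by
    change ofLex a.vec k - ofLex (ek k σ) k = 0
    rw [h, ek_k, sub_self])⟩ else 0

variable {k σ}

theorem al_coe {a : V} (h : a.get k.1 = σ) : (al k σ a : HH) = mono (a.vec - ek k σ) := by
  rw [al, dif_pos (by rw [V.get_vec, h])]

theorem al_Z {a : V} (h : a.get k.1 = σ) : (al k σ a : HH) * Zk k σ = mono a.vec := by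
  rw [al_coe h, Zk, ← mono_add, sub_add_cancel]

theorem al_ratio {a b : V} (ha : a.get k.1 = σ) (hb : b.get k.1 = σ) :
    (al k σ b : HH) * (al k σ a : HH)⁻¹ = mono (b.sub a).vec := by
  rw [al_coe ha, al_coe hb, ← mono_neg, ← mono_add, V.vec_sub]
  congr 1; abel

theorem picks_map {α β : Type*} (f : α → β) (l : List α) :
    picks (l.map f) = (picks l).map (fun x => (f x.1, x.2.map f)) := by
  induction l with
  | nil => rfl
  | cons a l ih =>
    simp only [List.map_cons, picks, ih, List.map_map]
    rfl

theorem mem_picks {α : Type*} {l : List α} {x : α × List α} (h : x ∈ picks l) :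
    x.1 ∈ l ∧ ∀ y ∈ x.2, y ∈ l := by
  induction l generalizing x with
  | nil => simp [picks] at h
  | cons a l ih =>
    rw [picks] at h
    rcases List.mem_cons.1 h with rfl | h
    · exact ⟨by simp, fun y hy => List.mem_cons_of_mem _ hy⟩
    · obtain ⟨y, hy, rfl⟩ := List.mem_map.1 h
      obtain ⟨h1, h2⟩ := ih hy
      refine ⟨List.mem_cons_of_mem _ h1, ?_⟩
      intro z hz
      rcases List.mem_cons.1 hz with rfl | hz
      · simp
      · exact List.mem_cons_of_mem _ (h2 z hz)

theorem prodOM_FF {l : List V} (h : ∀ v ∈ l, v.get k.1 = 0) : prodOM l ∈ FF k := by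
  apply Subfield.list_prod_mem
  intro x hx
  obtain ⟨v, hv, rfl⟩ := List.mem_map.1 hx
  exact sub_mem (one_mem _) (mono_mem_FF (by rw [V.get_vec, h v hv]))

theorem lpol_al_aeval {l : List V} (h : ∀ v ∈ l, v.get k.1 = σ) :
    Polynomial.aeval (Zk k σ) (lpol k (l.map (al k σ))) = prodOM l := by
  rw [lpol_aeval, List.map_map, prodOM]
  congr 1
  apply List.map_congr_left
  intro v hv
  simp only [Function.comp, om]
  rw [al_Z (h v hv)]

theorem lpol_al_eval {l : List V} (h : ∀ v ∈ l, v.get k.1 = σ) {a : V} (ha : a.get k.1 = σ) :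
    (((lpol k (l.map (al k σ))).eval (al k σ a)⁻¹ : FF k) : HH) = prodOM (l.map fun w => w.sub a) := by
  rw [lpol_eval]
  induction l with
  | nil => simp [prodOM]
  | cons v l ih =>
    simp only [List.map_cons, List.prod_cons, prodOM_cons]
    rw [← ih (fun w hw => h w (List.mem_cons_of_mem _ hw))]
    push_cast
    rw [al_ratio ha (h v List.mem_cons_self), om]

theorem aux_abel {G : Type*} [AddCommGroup G] (m x y : G) (e : ℕ) :
    m - (e : ℤ) • x = m - e • y + e • -(x - y) := by
  rw [natCast_zsmul, smul_neg, smul_sub]; abel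

theorem rule_core (hσ : σ * σ = 1) (num0 numK den0 A B : List V) (c : ℤ) (m : V) (e : ℕ)
    (hn0 : ∀ v ∈ num0, v.get k.1 = 0) (hd0 : ∀ v ∈ den0, v.get k.1 = 0)
    (hnK : ∀ v ∈ numK, v.get k.1 = σ) (hA : ∀ v ∈ A, v.get k.1 = σ) (hB : ∀ v ∈ B, v.get k.1 = σ)
    (hAp : ∀ v ∈ A, v.pos = true) (hBp : ∀ v ∈ B, v.neg.pos = true) (hm : m.get k.1 = σ * e)
    (hdeg : e + numK.length < A.length + B.length)
    (hne : ∀ x ∈ picks A, ∀ b ∈ x.2 ++ B, b ≠ x.1) :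
    CT k ((c : HH) * mono m.vec * (prodOM num0 * prodOM numK) / (prodOM den0 * prodOM (A ++ B))) =
      vals ((picks A).map (substT num0 numK den0 B c m e)) := by
  have hcm : (c : HH) * mono (m.vec - e • ek k σ) ∈ FF k := by
    apply mul_mem (intCast_mem _ _)
    apply mono_mem_FF
    change ofLex m.vec k - ofLex (e • ek k σ) k = 0
    rw [V.get_vec, hm, ek_nsmul]; ring
  have hR : prodOM num0 / prodOM den0 ∈ FF k := div_mem (prodOM_FF hn0) (prodOM_FF hd0)
  set p : Polynomial (FF k) := Polynomial.C ⟨_, hcm⟩ * (Polynomial.X ^ e * lpol k (numK.map (al k σ))) with hp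
  have hpa : Polynomial.aeval (Zk k σ) p = (c : HH) * mono m.vec * prodOM numK := by
    rw [hp, map_mul, map_mul, Polynomial.aeval_C, map_pow, Polynomial.aeval_X, lpol_al_aeval hnK]
    change (c : HH) * mono (m.vec - e • ek k σ) * (Zk k σ ^ e * prodOM numK) = _
    rw [Zk, ← mono_nsmul]
    have : mono m.vec = mono (m.vec - e • ek k σ) * mono (e • ek k σ) := by
      rw [← mono_add, sub_add_cancel]
    rw [this]; ring
  have hAB : ∀ v ∈ A ++ B, v.get k.1 = σ := by
    intro v hv
    rcases List.mem_append.1 hv with h | h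
    · exact hA v h
    · exact hB v h
  have h1 : (c : HH) * mono m.vec * (prodOM num0 * prodOM numK) / (prodOM den0 * prodOM (A ++ B)) =
      (prodOM num0 / prodOM den0) * (Polynomial.aeval (Zk k σ) p / Polynomial.aeval (Zk k σ) (lpol k (A.map (al k σ) ++ B.map (al k σ)))) := by
    rw [← List.map_append, lpol_al_aeval hAB, hpa]
    simp only [div_eq_mul_inv, mul_inv]; ring
  have hratio : ∀ {a b : V}, a.get k.1 = σ → b.get k.1 = σ → b ≠ a → 1 - al k σ b * (al k σ a)⁻¹ ≠ 0 := by
    intro a b ha hb hab h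
    have h2 := congrArg (Subtype.val) h
    push_cast at h2
    rw [al_ratio ha hb] at h2
    refine one_sub_ne_zero ?_ h2
    rw [V.vec_sub]
    intro h3
    exact hab (V.vec_inj (sub_eq_zero.1 h3))
  rw [h1, mem_FF.1 hR, CT_main k σ hσ]
  · rw [picks_map, List.map_map, vals, List.map_map, ← List.sum_map_mul_left]
    congr 1
    apply List.map_congr_left
    intro x hx
    obtain ⟨hx1, hx2⟩ := mem_picks hx
    have hxA := hA _ hx1
    have hxB : ∀ v ∈ x.2 ++ B, v.get k.1 = σ := by
      intro v hv
      rcases List.mem_append.1 hv with h | h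
      · exact hA v (hx2 v h)
      · exact hB v h
    simp only [Function.comp, substT, Tm.val]
    rw [← List.map_append]
    push_cast
    rw [lpol_al_eval hxB hxA, hp, Polynomial.eval_mul, Polynomial.eval_mul, Polynomial.eval_C, Polynomial.eval_pow,
      Polynomial.eval_X]
    push_cast
    rw [lpol_al_eval hnK hxA, prodOM_append, prodOM_append, al_coe hxA, V.vec_sub, V.vec_smul]
    have h3 : mono (m.vec - (e : ℤ) • x.1.vec) = mono (m.vec - e • ek k σ) * (mono (x.1.vec - ek k σ))⁻¹ ^ e := by
      rw [← mono_neg, ← mono_nsmul, ← mono_add]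
      congr 1
      exact aux_abel _ _ _ _
    rw [h3]
    simp only [div_eq_mul_inv, mul_inv]; ring
  · intro β hβ
    obtain ⟨v, hv, rfl⟩ := List.mem_map.1 hβ
    refine ⟨v.vec, al_Z (hB v hv), ?_, by rw [V.get_vec, hB v hv]⟩
    have := V.pos_vec (hBp v hv)
    rw [V.vec_neg] at this
    simpa using this
  · intro β hβ
    obtain ⟨v, hv, rfl⟩ := List.mem_map.1 hβ
    exact ⟨v.vec, al_Z (hA v hv), V.pos_vec (hAp v hv), by rw [V.get_vec, hA v hv]⟩
  · intro x hx β hβ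
    rw [picks_map] at hx
    obtain ⟨y, hy, rfl⟩ := List.mem_map.1 hx
    obtain ⟨hx1, hx2⟩ := mem_picks hy
    rw [← List.map_append] at hβ
    obtain ⟨b, hb, rfl⟩ := List.mem_map.1 hβ
    refine hratio (hA _ hx1) ?_ (hne y hy b hb)
    rcases List.mem_append.1 hb with h | h
    · exact hA _ (hx2 b h)
    · exact hB b h
  · rw [hp]
    refine (degree_C_mul_le' k _ _).trans_lt ?_
    refine (Polynomial.degree_mul_le _ _).trans_lt ?_
    rw [Polynomial.degree_X_pow]
    refine (add_le_add le_rfl (lpol_deg k _)).trans_lt ?_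
    simp only [List.length_map]
    exact_mod_cast hdeg

theorem rule_sound (hσ : σ * σ = 1) (T : Tm) (L : List Tm) (h : rule k.1 σ T = some L) : CT k T.val = vals L := by
  rw [← orient_val (fun v => v.get k.1 == -σ) T]
  rw [rule] at h
  generalize orient (fun v => v.get k.1 == -σ) T = S at h
  obtain ⟨c, m, num, den⟩ := S
  simp only at h
  split_ifs at h with hc
  simp only [Bool.and_eq_true, decide_eq_true_eq, List.all_eq_true, beq_iff_eq] at hc
  obtain ⟨⟨⟨⟨⟨h1, h2⟩, h3⟩, h4⟩, h5⟩, h6⟩ := hc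
  have h7 := Option.some.inj h
  obtain ⟨e, he⟩ := Int.eq_ofNat_of_zero_le h4
  rw [← h7, he]
  have hm : m.get k.1 = σ * e := by
    rw [← he, ← mul_assoc, hσ, one_mul]
  rw [he] at h5
  rw [← rule_core (k := k) hσ]
  · rw [Tm.val]
    simp only
    rw [prodOM_filter (fun v => v.get k.1 == 0) num, prodOM_filter (fun v => v.get k.1 == 0) den,
      prodOM_append, ← prodOM_filter (fun v => v.pos)]
  · intro v hv; simpa using (List.mem_filter.1 hv).2
  · intro v hv; simpa using (List.mem_filter.1 hv).2
  · exact h1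
  · intro v hv; exact h2 v (List.mem_filter.1 hv).1
  · intro v hv; exact h2 v (List.mem_filter.1 hv).1
  · intro v hv; simpa using (List.mem_filter.1 hv).2
  · exact h3
  · exact hm
  · simpa using h5
  · intro x hx b hb
    simpa using h6 x hx b hb
end

def rules (k : Nat) (T : Tm) : Option (List Tm) :=
  match rule k (-1) T with
  | some L => some L
  | none => rule k 1 T

theorem rules_sound (k : Fin 7) (T : Tm) (L : List Tm) (h : rules k.1 T = some L) : CT k T.val = vals L := by
  rw [rules] at h
  split at h
  · rename_i L' h'
    exact rule_sound (by norm_num) T _ (h'.trans h)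
  · exact rule_sound (by norm_num) T _ h

def mapAll (f : Tm → Option (List Tm)) : List Tm → Option (List Tm)
  | [] => some []
  | T :: l => match f T, mapAll f l with
    | some a, some b => some (normAll a ++ b)
    | _, _ => none

theorem mapAll_sound (k : Fin 7) (f : Tm → Option (List Tm)) (hf : ∀ T L, f T = some L → CT k T.val = vals L)
    (l L : List Tm) (h : mapAll f l = some L) : CT k (vals l) = vals L := by
  induction l generalizing L with
  | nil => simp [mapAll] at h; subst h; simp [vals_nil]
  | cons T l ih =>
    rw [mapAll] at h
    split at h
    · rename_i a b ha hb
      have := Option.some.inj h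
      rw [← this, vals_append, normAll_val, ← ih b hb, ← hf T a ha, vals_cons, map_add]
    · cases h

def split (k : Nat) (T : Tm) : Option (List Tm) :=
  match T.den.find? (fun v => v.get k == 1 && (T.den.erase v).contains v),
    T.den.find? (fun v => v.get k == -1 && (T.den.erase v).contains v) with
  | some a, some b =>
    if a.pos && b.pos && (a.add b).pos && T.den.contains a && (T.den.erase a).contains b then
      some [⟨T.c, T.m, T.num, a :: a.add b :: (T.den.erase a).erase b⟩, ⟨T.c, T.m.add b, T.num, b :: a.add b :: (T.den.erase a).erase b⟩]
    else none
  | _, _ => none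

theorem split_sound (k : ℕ) (T : Tm) (L : List Tm) (h : split k T = some L) : T.val = vals L := by
  rw [split] at h
  split at h
  · rename_i a b _ _
    split_ifs at h with hc
    simp only [Bool.and_eq_true] at hc
    obtain ⟨⟨⟨⟨h1, h2⟩, h3⟩, h4⟩, h5⟩ := hc
    rw [← Option.some.inj h, vals_cons, vals_cons, vals_nil, add_zero]
    simp only [Tm.val]
    rw [prodOM_erase (v := a) (d := T.den) (by simpa using h4), prodOM_erase (v := b) (d := T.den.erase a) (by simpa using h5)]
    simp only [prodOM_cons]
    have ha := om_ne_zero h1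
    have hb := om_ne_zero h2
    have hab := om_ne_zero h3
    have hid : om (a.add b) = om b + mono b.vec * om a := by
      simp only [om, V.vec_add, mono_add]; ring
    have h6 : (om a)⁻¹ * (om b)⁻¹ = (om a)⁻¹ * (om (a.add b))⁻¹ + mono b.vec * ((om b)⁻¹ * (om (a.add b))⁻¹) := by
      field_simp
      rw [hid]
      ring
    rw [V.vec_add, mono_add]
    simp only [div_eq_mul_inv, mul_inv]
    linear_combination (T.c * mono T.m.vec * prodOM T.num * (prodOM ((T.den.erase a).erase b))⁻¹) * h6
  · cases h

def step (k : Nat) (T : Tm) : Option (List Tm) :=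
  match rules k T with
  | some L => some L
  | none => match split k T with
    | some L => mapAll (rules k) (normAll L)
    | none => none

theorem step_sound (k : Fin 7) (T : Tm) (L : List Tm) (h : step k.1 T = some L) : CT k T.val = vals L := by
  rw [step] at h
  split at h
  · rename_i L' h'
    exact rules_sound k T _ (h'.trans h)
  · split at h
    · rename_i L' h'
      rw [split_sound k.1 T L' h', ← normAll_val]
      exact mapAll_sound k _ (rules_sound k) _ _ h
    · cases h

def elim (k : Nat) (l : List Tm) : Option (List Tm) := mapAll (step k) l

theorem elim_sound (k : Fin 7) (l L : List Tm) (h : elim k.1 l = some L) : CT k (vals l) = vals L :=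
  mapAll_sound k _ (step_sound k) _ _ h

/-- initial integrand -/
def unit5 (i : Nat) : V := ⟨0, 0, if i = 0 then 1 else 0, if i = 1 then 1 else 0, if i = 2 then 1 else 0, if i = 3 then 1 else 0, if i = 4 then 1 else 0⟩
def vs : V := ⟨1, 0, 0, 0, 0, 0, 0⟩
def vt : V := ⟨0, 1, 0, 0, 0, 0, 0⟩
def vr (i j : Nat) : V := (unit5 i).sub (unit5 j)
def pairsLt : List (Nat × Nat) := [(0,1),(0,2),(0,3),(0,4),(1,2),(1,3),(1,4),(2,3),(2,4),(3,4)]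
def T0 : Tm := ⟨1, V.zero, pairsLt.map (fun x => vr x.1 x.2),
  pairsLt.map (fun x => vs.add (vr x.1 x.2)) ++ (pairsLt.map (fun x => vt.add (vr x.1 x.2)) ++ pairsLt.map (fun x => vt.add (vr x.2 x.1)))⟩

def bindElim (k : Nat) : Option (List Tm) → Option (List Tm)
  | some l => elim k l
  | none => none

def leaves : Option (List Tm) := bindElim 5 (bindElim 2 (bindElim 4 (bindElim 3 (some (norm T0)))))

end C52

namespace C52

def emb : (ℕ × ℕ) × L5 →+ Gm where
  toFun x := toLex ![(x.1.1 : ℤ), (x.1.2 : ℤ), x.2 0, x.2 1, x.2 2, x.2 3, x.2 4]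
  map_zero' := by
    apply ofLex.injective
    funext k
    fin_cases k <;> rfl
  map_add' x y := by
    apply ofLex.injective
    funext k
    fin_cases k
    · exact Nat.cast_add _ _
    · exact Nat.cast_add _ _
    all_goals rfl

theorem emb_inj {x y : (ℕ × ℕ) × L5} (h : emb x = emb y) : x = y := by
  have h1 : ∀ k, ofLex (emb x) k = ofLex (emb y) k := fun k => by rw [h]
  have a0 : (x.1.1 : ℤ) = y.1.1 := h1 0
  have a1 : (x.1.2 : ℤ) = y.1.2 := h1 1
  refine Prod.ext (Prod.ext (by exact_mod_cast a0) (by exact_mod_cast a1)) ?_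
  funext k
  fin_cases k
  · exact h1 2
  · exact h1 3
  · exact h1 4
  · exact h1 5
  · exact h1 6

def wH (a : MatVar 5) : Gm := emb (bideg 5 a, - matwt a)

theorem weight_wH (d : MatVar 5 →₀ ℕ) :
    Finsupp.weight wH d = emb (Finsupp.weight (bideg 5) d, - Finsupp.weight matwt d) := by
  induction d using Finsupp.induction_linear with
  | zero =>
    simp only [map_zero, neg_zero]
    exact (map_zero emb).symm
  | add f g hf hg =>
    have e1 := map_add (Finsupp.weight (bideg 5)) f g
    have e2 := map_add (Finsupp.weight matwt) f g
    rw [map_add, hf, hg, e1, e2, neg_add, ← Prod.mk_add_mk, map_add]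
  | single a n =>
    simp only [Finsupp.weight_single]
    rw [wH, ← map_nsmul, Prod.smul_mk, smul_neg]

theorem wH_pos (a : MatVar 5) : 0 < wH a := by
  rcases a with a | a
  · refine ⟨0, ?_, ?_⟩
    · intro j hj; exact absurd hj (Fin.not_lt_zero j)
    · change (0 : ℤ) < ((1 : ℕ) : ℤ); norm_num
  · refine ⟨1, ?_, ?_⟩
    · intro j hj
      have : j = 0 := by omega
      subst this
      rfl
    · change (0 : ℤ) < ((1 : ℕ) : ℤ); norm_num

def dS (S : Finset (MatVar 5)) (v : Gm) : Set (MatVar 5 →₀ ℕ) := {d | d.support ⊆ S ∧ Finsupp.weight wH d = v}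

theorem dS_finite (S v) : (dS S v).Finite := by
  by_cases h : ∃ d, d ∈ dS S v
  · obtain ⟨d0, h0⟩ := h
    have := finite_II (Finsupp.weight (bideg 5) d0).1 (Finsupp.weight (bideg 5) d0).2
    refine Set.Finite.subset (s := {d | Finsupp.weight (bideg 5) d = ((Finsupp.weight (bideg 5) d0).1, (Finsupp.weight (bideg 5) d0).2)}) this ?_
    intro d hd
    have h1 := hd.2.trans h0.2.symm
    rw [weight_wH, weight_wH] at h1
    exact congrArg Prod.fst (emb_inj h1)
  · push Not at h
    rw [Set.eq_empty_of_forall_notMem h]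
    exact Set.finite_empty

def CS (S : Finset (MatVar 5)) : HH :=
  ⟨fun v => ((dS S v).ncard : ℚ), by
    have : (Set.IsPWO ((AddSubmonoid.closure (Set.range wH) : AddSubmonoid Gm) : Set Gm)) := by
      apply Set.IsPWO.addSubmonoid_closure
      · rintro _ ⟨a, rfl⟩; exact (wH_pos a).le
      · exact (Set.finite_range wH).isPWO
    refine this.mono ?_
    intro v hv
    have h1 : (dS S v).ncard ≠ 0 := by simpa using hv
    obtain ⟨d, hd⟩ := Set.nonempty_of_ncard_ne_zero h1
    rw [← hd.2, Finsupp.weight_apply]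
    refine AddSubmonoid.sum_mem _ ?_
    intro a _
    exact AddSubmonoid.nsmul_mem _ (AddSubmonoid.subset_closure (Set.mem_range_self a)) _⟩

theorem CS_coeff (S v) : (CS S).coeff v = ((dS S v).ncard : ℚ) := rfl

theorem CS_empty : CS ∅ = 1 := by
  ext v
  rw [CS_coeff, ← mono_zero, coeff_mono]
  split_ifs with h
  · have : dS ∅ v = {0} := by
      ext d
      simp only [dS, Finset.subset_empty, Finsupp.support_eq_empty, Set.mem_ofPred_eq, Set.mem_singleton_iff]
      constructor
      · exact fun h => h.1
      · rintro rfl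
        exact ⟨rfl, by rw [map_zero, h]⟩
    rw [this]; simp
  · have : dS ∅ v = ∅ := by
      ext d
      simp only [dS, Finset.subset_empty, Finsupp.support_eq_empty, Set.mem_ofPred_eq, Set.mem_empty_iff_false, iff_false]
      rintro ⟨rfl, h1⟩
      exact h (by rw [← h1, map_zero])
    rw [this]; simp

theorem CS_insert (a : MatVar 5) (S : Finset (MatVar 5)) (ha : a ∉ S) :
    (1 - mono (wH a)) * CS (insert a S) = CS S := by
  ext v
  rw [sub_mul, one_mul, HahnSeries.coeff_sub, coeff_mono_mul, CS_coeff, CS_coeff, CS_coeff, sub_eq_iff_eq_add]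
  have h1 : dS (insert a S) v = dS S v ∪ (fun d => d + Finsupp.single a 1) '' dS (insert a S) (v - wH a) := by
    ext d
    simp only [Set.mem_union, Set.mem_image]
    constructor
    · rintro ⟨h1, h2⟩
      by_cases hd : d a = 0
      · left
        refine ⟨?_, h2⟩
        intro b hb
        rcases Finset.mem_insert.1 (h1 hb) with rfl | h
        · simp [hd] at hb
        · exact h
      · right
        have hle : Finsupp.single a 1 ≤ d := by
          rw [Finsupp.single_le_iff]; omega
        refine ⟨d - Finsupp.single a 1, ⟨?_, ?_⟩, tsub_add_cancel_of_le hle⟩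
        · refine Finset.Subset.trans ?_ h1
          intro b hb
          simp only [Finsupp.mem_support_iff, Finsupp.coe_tsub, Pi.sub_apply] at hb ⊢
          omega
        · have h3 : Finsupp.weight wH (d - Finsupp.single a 1 + Finsupp.single a 1) = v := by
            rw [tsub_add_cancel_of_le hle, h2]
          rw [map_add, Finsupp.weight_single, one_smul] at h3
          exact eq_sub_of_add_eq h3
    · rintro (⟨h1, h2⟩ | ⟨d, ⟨h1, h2⟩, rfl⟩)
      · exact ⟨h1.trans (Finset.subset_insert _ _), h2⟩
      · refine ⟨?_, ?_⟩
        · refine Finsupp.support_add.trans (Finset.union_subset h1 ?_)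
          refine Finsupp.support_single_subset.trans ?_
          simp
        · rw [map_add, Finsupp.weight_single, one_smul, h2, sub_add_cancel]
  rw [h1, Set.ncard_union_eq _ (dS_finite _ _) ((dS_finite _ _).image _), Set.ncard_image_of_injective _ (add_left_injective _)]
  · push_cast; rfl
  · rw [Set.disjoint_left]
    rintro d ⟨h1, _⟩ ⟨d', _, rfl⟩
    apply ha
    apply h1
    simp

theorem CS_prod (S : Finset (MatVar 5)) : (∏ a ∈ S, (1 - mono (wH a))) * CS S = 1 := by
  induction S using Finset.induction_on with
  | empty => rw [CS_empty]; simp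
  | insert a S ha ih =>
    rw [Finset.prod_insert ha, mul_right_comm, CS_insert a S ha, mul_comm, ih]

def GG : HH := CS Finset.univ
theorem GG_eq : (∏ a : MatVar 5, (1 - mono (wH a))) * GG = 1 := CS_prod _

def TT : HH →+ HH := (CT 6).comp ((CT 5).comp ((CT 2).comp ((CT 4).comp (CT 3))))

theorem coeff_TT (h : HH) (v : Gm) : (TT h).coeff v =
    if ofLex v 2 = 0 ∧ ofLex v 3 = 0 ∧ ofLex v 4 = 0 ∧ ofLex v 5 = 0 ∧ ofLex v 6 = 0 then h.coeff v else 0 := by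
  change (CT 6 (CT 5 (CT 2 (CT 4 (CT 3 h))))).coeff v = _
  rw [coeff_CT, coeff_CT, coeff_CT, coeff_CT, coeff_CT]
  split_ifs <;> first | rfl | (exfalso; tauto)

theorem coeff_TT_emb (h : HH) (p : ℕ × ℕ) : (TT h).coeff (emb (p, 0)) = h.coeff (emb (p, 0)) := by
  rw [coeff_TT, if_pos]
  exact ⟨rfl, rfl, rfl, rfl, rfl⟩

def FFF : Subfield HH := FF 6 ⊓ FF 5 ⊓ FF 2 ⊓ FF 4 ⊓ FF 3

theorem TT_mul {r : HH} (hr : r ∈ FFF) (h : HH) : TT (r * h) = r * TT h := by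
  obtain ⟨⟨⟨⟨h6, h5⟩, h2⟩, h4⟩, h3⟩ := hr
  change (CT 6 (CT 5 (CT 2 (CT 4 (CT 3 _))))) = _
  rw [mem_FF.1 h3, mem_FF.1 h4, mem_FF.1 h2, mem_FF.1 h5, mem_FF.1 h6]
  rfl

theorem mono_FFF {v : V} (ha : v.a = 0) (hb : v.b = 0) (hc : v.c = 0) (hd : v.d = 0) (he : v.e = 0) : mono v.vec ∈ FFF :=
  ⟨⟨⟨⟨mono_mem_FF (by rw [V.get_vec]; exact he), mono_mem_FF (by rw [V.get_vec]; exact hd)⟩,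
    mono_mem_FF (by rw [V.get_vec]; exact ha)⟩, mono_mem_FF (by rw [V.get_vec]; exact hc)⟩, mono_mem_FF (by rw [V.get_vec]; exact hb)⟩

/-- permuting -/
def pV (τ : Equiv.Perm (Fin 5)) : MatVar 5 ≃ MatVar 5 :=
  Equiv.sumCongr (Equiv.prodCongr τ τ) (Equiv.prodCongr τ τ)

theorem bideg_pV (τ) (a) : bideg 5 (pV τ a) = bideg 5 a := by
  rcases a with a | a <;> rfl

theorem rt_perm (τ : Equiv.Perm (Fin 5)) (i j k : Fin 5) : rt (τ i) (τ j) (τ k) = rt i j k := by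
  simp [rt, Pi.single_apply]

theorem matwt_pV (τ : Equiv.Perm (Fin 5)) (a) (k) : matwt (pV τ a) (τ k) = matwt a k := by
  rcases a with ⟨a, b⟩ | ⟨a, b⟩ <;> exact rt_perm τ _ _ _

theorem weight_perm (τ : Equiv.Perm (Fin 5)) (d : MatVar 5 →₀ ℕ) :
    Finsupp.weight (bideg 5) (d.equivMapDomain (pV τ)) = Finsupp.weight (bideg 5) d ∧
    ∀ k, Finsupp.weight matwt (d.equivMapDomain (pV τ)) (τ k) = Finsupp.weight matwt d k := by
  simp only [Finsupp.equivMapDomain_eq_mapDomain]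
  induction d using Finsupp.induction_linear with
  | zero => simp
  | add f g hf hg =>
    simp only [Finsupp.mapDomain_add, map_add, hf.1, hg.1, Pi.add_apply, hf.2, hg.2]
    simp
  | single a n =>
    simp only [Finsupp.mapDomain_single, Finsupp.weight_single, bideg_pV, Pi.smul_apply, matwt_pV]
    simp

theorem GG_perm (τ : Equiv.Perm (Fin 5)) (p : ℕ × ℕ) (v : L5) :
    GG.coeff (emb (p, v ∘ τ)) = GG.coeff (emb (p, v)) := by
  rw [GG, CS_coeff, CS_coeff]
  congr 1
  symm
  rw [← Set.ncard_image_of_injective (dS Finset.univ (emb (p, v ∘ τ))) (f := fun d => d.equivMapDomain (pV τ))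
    (Finsupp.equivCongrLeft (pV τ)).injective]
  congr 1
  ext d
  constructor
  · rintro ⟨_, h⟩
    refine ⟨d.equivMapDomain (pV τ).symm, ⟨Finset.subset_univ _, ?_⟩, ?_⟩
    · have h2 := weight_perm τ (d.equivMapDomain (pV τ).symm)
      have h3 : (d.equivMapDomain (pV τ).symm).equivMapDomain (pV τ) = d :=
        (Finsupp.equivCongrLeft (pV τ)).right_inv d
      rw [h3] at h2
      rw [weight_wH] at h ⊢
      have h4 := emb_inj h
      rw [Prod.mk.injEq] at h4
      rw [← h2.1, h4.1]
      congr 2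
      funext k
      have h5 := congrFun h4.2 (τ k)
      change - _ = v (τ k) at h5
      change - _ = v (τ k)
      rw [← h2.2 k, ← h5]
    · exact (Finsupp.equivCongrLeft (pV τ)).right_inv d
  · rintro ⟨d, ⟨_, h⟩, rfl⟩
    refine ⟨Finset.subset_univ _, ?_⟩
    have h2 := weight_perm τ d
    rw [weight_wH] at h ⊢
    have h4 := emb_inj h
    rw [Prod.mk.injEq] at h4
    change emb (Finsupp.weight (bideg 5) (d.equivMapDomain (pV τ)), - Finsupp.weight matwt (d.equivMapDomain (pV τ))) = _
    rw [h2.1, h4.1]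
    congr 2
    funext k
    obtain ⟨k, rfl⟩ := τ.surjective k
    have h5 := congrFun h4.2 k
    change - _ = v (τ k) at h5
    change - _ = v (τ k)
    rw [h2.2 k, ← h5]

end C52

namespace C52

def zv : L5 →+ Gm := emb.comp (AddMonoidHom.inr (ℕ × ℕ) L5)

theorem zv_apply (v : L5) : zv v = emb (0, v) := rfl

def io : A5 →+* HH := (AddMonoidAlgebra.lift ℤ HH L5
  { toFun := fun v => mono (zv v.toAdd)
    map_one' := by
      change mono (zv 0) = 1
      rw [map_zero, mono_zero]
    map_mul' := fun x y => by
      change mono (zv (x.toAdd + y.toAdd)) = _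
      rw [map_add, mono_add] }).toRingHom

theorem io_single (v : L5) : io (AddMonoidAlgebra.single v 1) = mono (zv v) := by
  change AddMonoidAlgebra.lift ℤ HH L5 _ _ = _
  rw [AddMonoidAlgebra.lift_single]
  simp

def Th : A5 →+ HH := TT.comp ((AddMonoidHom.mulRight GG).comp io.toAddMonoidHom)
theorem Th_apply (x : A5) : Th x = TT (io x * GG) := rfl

theorem GG_perm' (τ : Equiv.Perm (Fin 5)) (u : Gm) (v : L5)
    (hu : ofLex u 2 = 0 ∧ ofLex u 3 = 0 ∧ ofLex u 4 = 0 ∧ ofLex u 5 = 0 ∧ ofLex u 6 = 0) :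
    GG.coeff (u - zv (v ∘ τ)) = GG.coeff (u - zv v) := by
  by_cases h : ∃ p, u = emb (p, 0)
  · obtain ⟨p, rfl⟩ := h
    have h1 : ∀ w : L5, emb (p, 0) - zv w = emb (p, -w) := by
      intro w
      rw [sub_eq_iff_eq_add, zv_apply, ← map_add, Prod.mk_add_mk, add_zero, neg_add_cancel]
    rw [h1, h1]
    exact GG_perm τ p (-v)
  · have h1 : ∀ w : L5, GG.coeff (u - zv w) = 0 := by
      intro w
      by_contra hne
      rw [GG, CS_coeff] at hne
      have h2 : (dS Finset.univ (u - zv w)).ncard ≠ 0 := by exact_mod_cast hne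
      obtain ⟨d, _, hd⟩ := Set.nonempty_of_ncard_ne_zero h2
      rw [weight_wH] at hd
      have h3 := eq_sub_iff_add_eq.1 hd
      rw [zv_apply, ← map_add, Prod.mk_add_mk] at h3
      apply h
      refine ⟨Finsupp.weight (bideg 5) d, ?_⟩
      rw [← h3, add_zero]
      congr 2
      rw [← h3] at hu
      funext k
      fin_cases k
      · exact hu.1
      · exact hu.2.1
      · exact hu.2.2.1
      · exact hu.2.2.2.1
      · exact hu.2.2.2.2
    rw [h1, h1]

def sA (τ : Equiv.Perm (Fin 5)) : A5 →+* A5 := AddMonoidAlgebra.mapDomainRingHom ℤ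
  ({ toFun := fun v => v ∘ τ, map_zero' := rfl, map_add' := fun _ _ => rfl } : L5 →+ L5)

theorem sA_single (τ) (v : L5) : sA τ (AddMonoidAlgebra.single v 1) = AddMonoidAlgebra.single (v ∘ τ) 1 := by
  simp [sA]

theorem Th_sA (τ) (x : A5) : Th (sA τ x) = Th x := by
  have : Th.comp (sA τ).toAddMonoidHom = Th := by
    rw [hom_eq_lin (Th.comp (sA τ).toAddMonoidHom), hom_eq_lin Th]
    congr 1
    funext v
    rw [← hom_eq_lin]
    change Th (sA τ (AddMonoidAlgebra.single v 1)) = _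
    rw [sA_single, Th_apply, Th_apply, io_single, io_single]
    ext u
    rw [coeff_TT, coeff_TT, coeff_mono_mul, coeff_mono_mul]
    split_ifs with h
    · exact GG_perm' τ u v h
    · rfl
  exact DFunLike.congr_fun this x

def zA (i : Fin 5) : A5 := AddMonoidAlgebra.single (Pi.single i 1) 1
def VA : A5 := (zA 1 - zA 0) * (zA 2 - zA 0) * (zA 3 - zA 0) * (zA 4 - zA 0) * (zA 2 - zA 1) * (zA 3 - zA 1) *
  (zA 4 - zA 1) * (zA 3 - zA 2) * (zA 4 - zA 2) * (zA 4 - zA 3)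

theorem sA_zA (τ : Equiv.Perm (Fin 5)) (i : Fin 5) : sA τ (zA i) = zA (τ.symm i) := by
  rw [zA, sA_single, zA]
  congr 1
  funext k
  simp [Pi.single_apply, Equiv.eq_symm_apply]

theorem sA_VA (i j : Fin 5) (h : (i, j) = (0, 1) ∨ (i, j) = (1, 2) ∨ (i, j) = (2, 3) ∨ (i, j) = (3, 4)) :
    sA (Equiv.swap i j) VA = - VA := by
  simp only [VA, map_mul, map_sub, sA_zA, Equiv.symm_swap]
  rcases h with h | h | h | h <;> obtain ⟨rfl, rfl⟩ := Prod.mk.inj h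
  · rw [show Equiv.swap (0 : Fin 5) 1 0 = 1 from rfl, show Equiv.swap (0 : Fin 5) 1 1 = 0 from rfl,
      show Equiv.swap (0 : Fin 5) 1 2 = 2 from rfl, show Equiv.swap (0 : Fin 5) 1 3 = 3 from rfl,
      show Equiv.swap (0 : Fin 5) 1 4 = 4 from rfl]
    ring
  · rw [show Equiv.swap (1 : Fin 5) 2 0 = 0 from rfl, show Equiv.swap (1 : Fin 5) 2 1 = 2 from rfl,
      show Equiv.swap (1 : Fin 5) 2 2 = 1 from rfl, show Equiv.swap (1 : Fin 5) 2 3 = 3 from rfl,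
      show Equiv.swap (1 : Fin 5) 2 4 = 4 from rfl]
    ring
  · rw [show Equiv.swap (2 : Fin 5) 3 0 = 0 from rfl, show Equiv.swap (2 : Fin 5) 3 1 = 1 from rfl,
      show Equiv.swap (2 : Fin 5) 3 2 = 3 from rfl, show Equiv.swap (2 : Fin 5) 3 3 = 2 from rfl,
      show Equiv.swap (2 : Fin 5) 3 4 = 4 from rfl]
    ring
  · rw [show Equiv.swap (3 : Fin 5) 4 0 = 0 from rfl, show Equiv.swap (3 : Fin 5) 4 1 = 1 from rfl,
      show Equiv.swap (3 : Fin 5) 4 2 = 2 from rfl, show Equiv.swap (3 : Fin 5) 4 3 = 4 from rfl,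
      show Equiv.swap (3 : Fin 5) 4 4 = 3 from rfl]
    ring

theorem ff_zA (i j : Fin 5) : ff i j * zA j = zA j - zA i := by
  have : uu i j * zA j = zA i := by
    rw [uu, zA, AddMonoidAlgebra.single_mul_single, rt, sub_add_cancel, one_mul, zA]
  rw [ff, sub_mul, one_mul, this]

theorem VA_eq : VA = delta * (zA 1 * zA 2 ^ 2 * zA 3 ^ 3 * zA 4 ^ 4) := by
  simp only [VA, ← ff_zA, delta]
  ring

def PA (κ : L5) : HH := Th (VA * AddMonoidAlgebra.single κ 1)

theorem PA_swap (κ : L5) (i j : Fin 5) (h : (i, j) = (0, 1) ∨ (i, j) = (1, 2) ∨ (i, j) = (2, 3) ∨ (i, j) = (3, 4)) :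
    PA (κ ∘ Equiv.swap i j) = - PA κ := by
  rw [PA, PA, ← Th_sA (Equiv.swap i j) (VA * AddMonoidAlgebra.single κ 1), map_mul (sA _), sA_VA i j h, sA_single, neg_mul, map_neg, neg_neg]

theorem PA_zero (κ : L5) (i j : Fin 5) (h : (i, j) = (0, 1) ∨ (i, j) = (1, 2) ∨ (i, j) = (2, 3) ∨ (i, j) = (3, 4))
    (hk : κ i = κ j) : PA κ = 0 := by
  have h1 := PA_swap κ i j h
  have h2 : κ ∘ Equiv.swap i j = κ := by
    funext l
    simp only [Function.comp, Equiv.swap_apply_def]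
    split_ifs with h3 h4
    · rw [h3, hk]
    · rw [h4, hk]
    · rfl
  rw [h2] at h1
  have h3 : (2 : HH) * PA κ = 0 := by linear_combination h1
  rcases mul_eq_zero.1 h3 with h | h
  · have h5 := congrArg (fun f : HH => f.coeff 0) h
    rw [← one_add_one_eq_two, ← mono_zero] at h5
    simp only [HahnSeries.coeff_add, coeff_mono, HahnSeries.coeff_zero] at h5
    norm_num at h5
  · exact h

def zz (κ : V) : L5 := ![κ.a, κ.b, κ.c, κ.d, κ.e]
def stp (κ : V) : V := ⟨κ.s, κ.t, 0, 0, 0, 0, 0⟩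

theorem vec_split (κ : V) : κ.vec = (stp κ).vec + zv (zz κ) := by
  apply ofLex.injective
  funext k
  change ofLex κ.vec k = ofLex (stp κ).vec k + ofLex (zv (zz κ)) k
  rw [V.get_vec, V.get_vec]
  fin_cases k
  · change κ.s = κ.s + 0; ring
  · change κ.t = κ.t + 0; ring
  · change κ.a = 0 + κ.a; ring
  · change κ.b = 0 + κ.b; ring
  · change κ.c = 0 + κ.c; ring
  · change κ.d = 0 + κ.d; ring
  · change κ.e = 0 + κ.e; ring

def PV (κ : V) : HH := TT (io VA * mono κ.vec * GG)

theorem PV_eq (κ : V) : PV κ = mono (stp κ).vec * PA (zz κ) := by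
  rw [PV, PA, Th_apply, map_mul io, io_single, ← TT_mul (mono_FFF rfl rfl rfl rfl rfl), vec_split, mono_add]
  congr 1; ring

def sw0 (x : Int × V) : Int × V := match x with
  | (n, ⟨s, t, a, b, c, d, e⟩) => if a < b then (-n, ⟨s, t, b, a, c, d, e⟩) else (n, ⟨s, t, a, b, c, d, e⟩)
def sw1 (x : Int × V) : Int × V := match x with
  | (n, ⟨s, t, a, b, c, d, e⟩) => if b < c then (-n, ⟨s, t, a, c, b, d, e⟩) else (n, ⟨s, t, a, b, c, d, e⟩)
def sw2 (x : Int × V) : Int × V := match x with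
  | (n, ⟨s, t, a, b, c, d, e⟩) => if c < d then (-n, ⟨s, t, a, b, d, c, e⟩) else (n, ⟨s, t, a, b, c, d, e⟩)
def sw3 (x : Int × V) : Int × V := match x with
  | (n, ⟨s, t, a, b, c, d, e⟩) => if d < e then (-n, ⟨s, t, a, b, c, e, d⟩) else (n, ⟨s, t, a, b, c, d, e⟩)

def pv (x : Int × V) : HH := (x.1 : HH) * PV x.2

theorem pv_sw_aux {n s t a b c d e a' b' c' d' e' : ℤ} (i j : Fin 5) (h : (i, j) = (0, 1) ∨ (i, j) = (1, 2) ∨ (i, j) = (2, 3) ∨ (i, j) = (3, 4))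
    (h2 : (![a', b', c', d', e'] : L5) = (![a, b, c, d, e] : L5) ∘ Equiv.swap i j) :
    pv (-n, ⟨s, t, a', b', c', d', e'⟩) = pv (n, ⟨s, t, a, b, c, d, e⟩) := by
  simp only [pv]
  rw [PV_eq, PV_eq]
  simp only [zz, stp]
  rw [h2, PA_swap _ i j h]
  push_cast; ring

theorem pv_sw0 (x) : pv (sw0 x) = pv x := by
  obtain ⟨n, s, t, a, b, c, d, e⟩ := x
  simp only [sw0]
  split_ifs
  · exact pv_sw_aux 0 1 (by simp) (by funext k; fin_cases k <;> rfl)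
  · rfl
theorem pv_sw1 (x) : pv (sw1 x) = pv x := by
  obtain ⟨n, s, t, a, b, c, d, e⟩ := x
  simp only [sw1]
  split_ifs
  · exact pv_sw_aux 1 2 (by simp) (by funext k; fin_cases k <;> rfl)
  · rfl
theorem pv_sw2 (x) : pv (sw2 x) = pv x := by
  obtain ⟨n, s, t, a, b, c, d, e⟩ := x
  simp only [sw2]
  split_ifs
  · exact pv_sw_aux 2 3 (by simp) (by funext k; fin_cases k <;> rfl)
  · rfl
theorem pv_sw3 (x) : pv (sw3 x) = pv x := by
  obtain ⟨n, s, t, a, b, c, d, e⟩ := x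
  simp only [sw3]
  split_ifs
  · exact pv_sw_aux 3 4 (by simp) (by funext k; fin_cases k <;> rfl)
  · rfl

def srt (x : Int × V) : Int × V := sw0 (sw1 (sw0 (sw2 (sw1 (sw0 (sw3 (sw2 (sw1 (sw0 x)))))))))
theorem pv_srt (x) : pv (srt x) = pv x := by
  simp only [srt, pv_sw0, pv_sw1, pv_sw2, pv_sw3]

/-- Laurent polynomials in `s`, coefficient lists -/
def evL : List Int → HH
  | [] => 0
  | c :: l => (c : HH) + mono vs.vec * evL l

def addAt : Nat → Int → List Int → List Int
  | _, _, [] => []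
  | 0, c, x :: l => (x + c) :: l
  | n+1, c, x :: l => x :: addAt n c l

theorem evL_addAt (n : ℕ) (c : ℤ) (l : List ℤ) (h : n < l.length) :
    evL (addAt n c l) = (c : HH) * mono vs.vec ^ n + evL l := by
  induction n generalizing l with
  | zero =>
    cases l with
    | nil => simp at h
    | cons x l =>
      simp only [addAt, evL]
      push_cast; ring
  | succ n ih =>
    cases l with
    | nil => simp at h
    | cons x l =>
      simp only [addAt, evL]
      rw [ih l (by simpa using h)]
      ring

def acc : List (Int × V) → Option (List Int)
  | [] => some [0,0,0,0,0,0,0,0,0,0,0]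
  | x :: l => match acc l with
    | none => none
    | some r => match srt x with
      | (n, ⟨s, t, a, b, c, d, e⟩) =>
        if a == b || b == c || c == d || d == e then some r
        else if a == 0 && b == -1 && c == -2 && d == -3 && e == -4 && t == 0 && decide (0 ≤ s) && decide (s.toNat < r.length) then
          some (addAt s.toNat n r) else none

def mrho : V := ⟨0, 0, 0, -1, -2, -3, -4⟩

theorem acc_sound (l : List (Int × V)) (r : List Int) (h : acc l = some r) :
    (l.map pv).sum = evL r * PV mrho := by
  induction l generalizing r with
  | nil =>
    simp only [acc] at h
    rw [← Option.some.inj h]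
    simp [evL]
  | cons x l ih =>
    simp only [acc] at h
    split at h
    · cases h
    · rename_i r' hr'
      rw [List.map_cons, List.sum_cons, ih r' hr', ← pv_srt]
      generalize srt x = y at h ⊢
      obtain ⟨n, s, t, a, b, c, d, e⟩ := y
      simp only at h
      split_ifs at h with h1 h2
      · rw [← Option.some.inj h]
        suffices pv (n, ⟨s, t, a, b, c, d, e⟩) = 0 by rw [this, zero_add]
        simp only [pv]
        rw [PV_eq]
        simp only [Bool.or_eq_true, beq_iff_eq] at h1
        rcases h1 with ((h1 | h1) | h1) | h1
        · rw [PA_zero _ 0 1 (by simp) h1]; simp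
        · rw [PA_zero _ 1 2 (by simp) h1]; simp
        · rw [PA_zero _ 2 3 (by simp) h1]; simp
        · rw [PA_zero _ 3 4 (by simp) h1]; simp
      · simp only [Bool.and_eq_true, beq_iff_eq, decide_eq_true_eq] at h2
        obtain ⟨⟨⟨⟨⟨⟨⟨rfl, rfl⟩, rfl⟩, rfl⟩, rfl⟩, rfl⟩, h3⟩, h4⟩ := h2
        rw [← Option.some.inj h, evL_addAt _ _ _ h4, add_mul]
        congr 1
        simp only [pv]
        rw [PV_eq, PV_eq mrho]
        have e1 : (stp ⟨s, 0, 0, -1, -2, -3, -4⟩).vec = s.toNat • vs.vec := by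
          rw [← natCast_zsmul, Int.toNat_of_nonneg h3, ← V.vec_smul]
          congr 1
          simp [stp, V.smul, vs]
        have e2 : (stp mrho).vec = 0 := V.vec_zero
        rw [e1, e2, mono_zero, mono_nsmul, one_mul, mul_assoc]
        rfl

def expand : List (V × V) → Int → V → List (Int × V)
  | [], c, κ => [(c, κ)]
  | (a, b) :: fs, c, κ => expand fs c (κ.add a) ++ expand fs (-c) (κ.add b)

theorem expand_sound (fs : List (V × V)) (c : ℤ) (κ : V) : ((expand fs c κ).map pv).sum =
    TT (io VA * ((c : HH) * mono κ.vec * (fs.map fun f => mono f.1.vec - mono f.2.vec).prod) * GG) := by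
  induction fs generalizing c κ with
  | nil =>
    simp only [expand, List.map_cons, List.map_nil, List.sum_cons, List.sum_nil, List.prod_nil, add_zero, pv, PV, mul_one]
    rw [← TT_mul (intCast_mem _ _)]
    congr 1; ring
  | cons f fs ih =>
    obtain ⟨a, b⟩ := f
    simp only [expand, List.map_append, List.sum_append, ih, List.map_cons, List.prod_cons]
    rw [← map_add]
    congr 1
    rw [V.vec_add, V.vec_add, mono_add, mono_add]
    push_cast; ring

def facs : List (V × V) := pairsLt.map fun x => ((unit5 x.2).neg, vs.sub (unit5 x.1))

set_option maxRecDepth 100000 in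
theorem acc_facs : acc (expand facs 1 V.zero) = some [1,4,9,15,20,22,20,15,9,4,1] := by decide +kernel

theorem key1 : TT (io VA * (facs.map fun f => mono f.1.vec - mono f.2.vec).prod * GG) =
    evL [1,4,9,15,20,22,20,15,9,4,1] * PV mrho := by
  rw [← acc_sound _ _ acc_facs, expand_sound, V.vec_zero, mono_zero]
  simp

theorem single_pow' (v : L5) (n : ℕ) : (AddMonoidAlgebra.single v (1 : ℤ)) ^ n = AddMonoidAlgebra.single (n • v) 1 := by
  rw [AddMonoidAlgebra.single_pow, one_pow]

theorem VA_mrho : VA * AddMonoidAlgebra.single (zz mrho) 1 = delta := by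
  rw [VA_eq, mul_assoc]
  have : zA 1 * zA 2 ^ 2 * zA 3 ^ 3 * zA 4 ^ 4 * AddMonoidAlgebra.single (zz mrho) 1 = 1 := by
    simp only [zA, single_pow', AddMonoidAlgebra.single_mul_single, one_mul]
    rw [AddMonoidAlgebra.one_def]
    congr 1
    funext k
    fin_cases k <;> rfl
  rw [this, mul_one]

theorem PV_mrho : PV mrho = Th delta := by
  rw [PV_eq, PA, VA_mrho]
  have e2 : (stp mrho).vec = 0 := V.vec_zero
  rw [e2, mono_zero, one_mul]
end C52

namespace C52

theorem wH_inl (i j : Fin 5) : wH (Sum.inl (i, j)) = (vs.add (vr i j)).vec := by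
  apply ofLex.injective
  funext k
  revert i j k
  decide +kernel

theorem wH_inr (i j : Fin 5) : wH (Sum.inr (i, j)) = (vt.add (vr i j)).vec := by
  apply ofLex.injective
  funext k
  revert i j k
  decide +kernel

theorem io_ff (i j : Fin 5) : io (ff i j) = om (vr i j) := by
  rw [ff, map_sub, map_one, uu, io_single, om]
  congr 2
  apply ofLex.injective
  funext k
  revert i j k
  decide +kernel

theorem io_delta : io delta = prodOM T0.num := by
  simp only [delta, map_mul, io_ff]
  simp only [T0, pairsLt, List.map_cons, List.map_nil, prodOM_cons, prodOM_nil, mul_one]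
  simp only [mul_assoc]
  rfl

theorem facs_prod : (facs.map fun f => mono f.1.vec - mono f.2.vec).prod =
    mono mrho.vec * prodOM (pairsLt.map fun x => vs.add (vr x.2 x.1)) := by
  have h : ∀ x : ℕ × ℕ, mono ((unit5 x.2).neg).vec - mono (vs.sub (unit5 x.1)).vec =
      mono ((unit5 x.2).neg).vec * om (vs.add (vr x.2 x.1)) := by
    intro x
    rw [om, mul_sub, mul_one, ← mono_add]
    congr 2
    rw [V.vec_neg, V.vec_sub, V.vec_add, vr, V.vec_sub]
    abel
  have h2 : ∀ l : List (ℕ × ℕ), ((l.map fun x => ((unit5 x.2).neg, vs.sub (unit5 x.1))).map fun f : V × V => mono f.1.vec - mono f.2.vec).prod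
      = mono ((l.map fun x => (unit5 x.2).neg.vec).sum) * prodOM (l.map fun x => vs.add (vr x.2 x.1)) := by
    intro l
    induction l with
    | nil => simp [prodOM_nil, mono_zero]
    | cons x l ih =>
      simp only [List.map_cons, List.prod_cons, List.sum_cons, prodOM_cons, mono_add] at ih ⊢
      rw [ih, h]; ring
  rw [facs, h2]
  congr 2
  simp only [pairsLt, List.map_cons, List.map_nil, List.sum_cons, List.sum_nil, add_zero, ← V.vec_add]
  rfl

theorem io_VA_mrho : io VA * mono mrho.vec = io delta := by
  rw [← VA_mrho, map_mul, io_single]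
  congr 2

def Elist : List V := [vt, vt, vt, vt, vt, vs, V.smul 2 vs, V.smul 3 vs, V.smul 4 vs, V.smul 5 vs]

theorem vr_self (i : ℕ) : vr i i = V.zero := by
  simp [vr, V.sub, V.zero]
theorem add_zero' (v : V) : v.add V.zero = v := by
  simp [V.add, V.zero]

theorem prod55 {R : Type*} [CommRing R] (f : ℕ → ℕ → R) (x : R) (h : ∀ i, f i i = x) :
    ∏ a : Fin 5 × Fin 5, f a.1 a.2 = x ^ 5 * (pairsLt.map fun a => f a.1 a.2).prod * (pairsLt.map fun a => f a.2 a.1).prod := by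
  rw [Fintype.prod_prod_type]
  simp only [Fin.prod_univ_five, pairsLt, List.map_cons, List.map_nil, List.prod_cons, List.prod_nil]
  simp only [Fin.isValue, Fin.coe_ofNat_eq_mod, Nat.reduceMod, h]
  ring

theorem prodW (u : V) : ∏ a : Fin 5 × Fin 5, (1 - mono (u.add (vr a.1 a.2)).vec) =
    om u ^ 5 * prodOM (pairsLt.map fun a => u.add (vr a.1 a.2)) * prodOM (pairsLt.map fun a => u.add (vr a.2 a.1)) := by
  have := prod55 (fun i j => om (u.add (vr i j))) (om u) (fun i => by rw [vr_self, add_zero'])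
  rw [prodOM, prodOM, List.map_map, List.map_map]
  exact this

theorem prod_sum {R : Type*} [CommRing R] (f : MatVar 5 → R) (g : R) (h : (∏ a, f a) * g = 1) :
    (∏ a : Fin 5 × Fin 5, f (Sum.inl a)) * (∏ a : Fin 5 × Fin 5, f (Sum.inr a)) * g = 1 := by
  rw [← h, Fintype.prod_sum_type f]

theorem T0_eq : om vs ^ 5 * om vt ^ 5 * (io VA * (facs.map fun f => mono f.1.vec - mono f.2.vec).prod * GG) = T0.val := by
  rw [facs_prod, ← mul_assoc (io VA), io_VA_mrho, Tm.val, ← io_delta]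
  have hd : prodOM T0.den ≠ 0 := by
    rw [prodOM]
    apply List.prod_ne_zero
    intro h
    obtain ⟨v, hv, h0⟩ := List.mem_map.1 h
    refine om_ne_zero ?_ h0
    have : ∀ v ∈ T0.den, v.pos = true := by decide +kernel
    exact this v hv
  rw [eq_div_iff hd]
  have hG : (∏ a : Fin 5 × Fin 5, (1 - mono (wH (Sum.inl a)))) * (∏ a : Fin 5 × Fin 5, (1 - mono (wH (Sum.inr a)))) * GG = 1 :=
    prod_sum (fun a : MatVar 5 => 1 - mono (wH a)) GG GG_eq
  have e1 : ∏ a : Fin 5 × Fin 5, (1 - mono (wH (Sum.inl a))) = _ :=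
    (Finset.prod_congr rfl fun a _ => by rw [← wH_inl a.1 a.2]).trans (prodW vs)
  have e2 : ∏ a : Fin 5 × Fin 5, (1 - mono (wH (Sum.inr a))) = _ :=
    (Finset.prod_congr rfl fun a _ => by rw [← wH_inr a.1 a.2]).trans (prodW vt)
  rw [e1, e2] at hG
  have hm : mono T0.m.vec = 1 := by
    change mono V.zero.vec = 1
    rw [V.vec_zero, mono_zero]
  have hc : ((T0.c : ℤ) : HH) = 1 := Int.cast_one
  rw [hm, hc]
  have hden : prodOM T0.den = prodOM (pairsLt.map fun a => vs.add (vr a.1 a.2)) *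
    (prodOM (pairsLt.map fun a => vt.add (vr a.1 a.2)) * prodOM (pairsLt.map fun a => vt.add (vr a.2 a.1))) := by
    rw [← prodOM_append, ← prodOM_append]; rfl
  rw [hden]
  linear_combination (io delta) * hG

theorem evL_eq : evL [1,4,9,15,20,22,20,15,9,4,1] * om vs ^ 5 * om vt ^ 5 = prodOM Elist := by
  simp only [evL, Elist, prodOM_cons, prodOM_nil, om, V.vec_smul, mono_zsmul]
  generalize mono vs.vec = s
  generalize mono vt.vec = t
  push_cast
  simp only [show (2 : ℤ) = ((2 : ℕ) : ℤ) from rfl, show (3 : ℤ) = ((3 : ℕ) : ℤ) from rfl,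
    show (4 : ℤ) = ((4 : ℕ) : ℤ) from rfl, show (5 : ℤ) = ((5 : ℕ) : ℤ) from rfl, zpow_natCast]
  ring

theorem om_FFF {v : V} (ha : v.a = 0) (hb : v.b = 0) (hc : v.c = 0) (hd : v.d = 0) (he : v.e = 0) : om v ∈ FFF :=
  sub_mem (one_mem _) (mono_FFF ha hb hc hd he)

theorem Th_E : Th delta * prodOM Elist = TT T0.val := by
  rw [← T0_eq, TT_mul (mul_mem (pow_mem (om_FFF rfl rfl rfl rfl rfl) _) (pow_mem (om_FFF rfl rfl rfl rfl rfl) _)), key1, PV_mrho, ← evL_eq]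
  ring

def zf (v : V) : Bool := v.a == 0 && v.b == 0 && v.c == 0 && v.d == 0 && v.e == 0

theorem prodOM_FFF {l : List V} (h : l.all zf = true) : prodOM l ∈ FFF := by
  apply Subfield.list_prod_mem
  intro x hx
  obtain ⟨v, hv, rfl⟩ := List.mem_map.1 hx
  rw [List.all_eq_true] at h
  have := h v hv
  simp only [zf, Bool.and_eq_true, beq_iff_eq] at this
  obtain ⟨⟨⟨⟨h1, h2⟩, h3⟩, h4⟩, h5⟩ := this
  exact om_FFF h1 h2 h3 h4 h5

def zft (T : Tm) : Bool := zf T.m && T.num.all zf && T.den.all zf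

theorem zft_FFF {T : Tm} (h : zft T = true) : T.val ∈ FFF := by
  simp only [zft, Bool.and_eq_true] at h
  obtain ⟨⟨h0, hn⟩, hd⟩ := h
  simp only [zf, Bool.and_eq_true, beq_iff_eq] at h0
  obtain ⟨⟨⟨⟨h1, h2⟩, h3⟩, h4⟩, h5⟩ := h0
  exact div_mem (mul_mem (mul_mem (intCast_mem _ _) (mono_FFF h1 h2 h3 h4 h5)) (prodOM_FFF hn)) (prodOM_FFF hd)

theorem vals_FFF {l : List Tm} (h : l.all zft = true) : vals l ∈ FFF := by
  apply Subfield.list_sum_mem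
  intro x hx
  obtain ⟨T, hT, rfl⟩ := List.mem_map.1 hx
  rw [List.all_eq_true] at h
  exact zft_FFF (h T hT)

theorem bindElim_sound (k : Fin 7) (o : Option (List Tm)) (L : List Tm) (h : bindElim k.1 o = some L) :
    ∃ l, o = some l ∧ CT k (vals l) = vals L := by
  cases o with
  | none => simp [bindElim] at h
  | some l => exact ⟨l, rfl, elim_sound k l L h⟩

theorem leaves_sound (L : List Tm) (h : leaves = some L) (hz : L.all zft = true) : TT T0.val = vals L := by
  obtain ⟨l1, h1, e1⟩ := bindElim_sound 5 _ _ h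
  obtain ⟨l2, h2, e2⟩ := bindElim_sound 2 _ _ h1
  obtain ⟨l3, h3, e3⟩ := bindElim_sound 4 _ _ h2
  obtain ⟨l4, h4, e4⟩ := bindElim_sound 3 _ _ h3
  change CT 6 (CT 5 (CT 2 (CT 4 (CT 3 T0.val)))) = _
  rw [← norm_val T0, Option.some.inj h4, e4, e3, e2, e1]
  exact CT_FF (vals_FFF hz).1.1.1.1

/-- comparison with power series -/
def d2 (p q : ℕ) : Fin 2 →₀ ℕ := Finsupp.equivFunOnFinite.symm ![p, q]

structure Rel (f : MvPowerSeries (Fin 2) ℚ) (h : HH) : Prop where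
  co : ∀ d : Fin 2 →₀ ℕ, h.coeff (emb ((d 0, d 1), 0)) = MvPowerSeries.coeff d f
  ze : ∀ u, (∀ p, u ≠ emb (p, 0)) → h.coeff u = 0

theorem Rel.unique {f g : MvPowerSeries (Fin 2) ℚ} {h : HH} (hf : Rel f h) (hg : Rel g h) : f = g := by
  ext d
  rw [← hf.co, ← hg.co]

theorem Rel.add {f g : MvPowerSeries (Fin 2) ℚ} {h k : HH} (hf : Rel f h) (hg : Rel g k) : Rel (f + g) (h + k) := by
  constructor
  · intro d
    rw [HahnSeries.coeff_add, hf.co, hg.co, map_add]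
  · intro u hu
    rw [HahnSeries.coeff_add, hf.ze u hu, hg.ze u hu, add_zero]

theorem Rel.neg {f : MvPowerSeries (Fin 2) ℚ} {h : HH} (hf : Rel f h) : Rel (-f) (-h) := by
  constructor
  · intro d
    rw [HahnSeries.coeff_neg, hf.co, map_neg]
  · intro u hu
    rw [HahnSeries.coeff_neg, hf.ze u hu, neg_zero]

theorem Rel.mono {f : MvPowerSeries (Fin 2) ℚ} {h : HH} (hf : Rel f h) (e : Fin 2 →₀ ℕ) :
    Rel (MvPowerSeries.monomial e 1 * f) (mono (emb ((e 0, e 1), 0)) * h) := by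
  constructor
  · intro d
    rw [coeff_mono_mul, MvPowerSeries.coeff_monomial_mul, one_mul]
    split_ifs with hle
    · rw [← hf.co]
      congr 1
      rw [sub_eq_iff_eq_add, ← map_add]
      congr 1
      have h0 := hle 0
      have h1 := hle 1
      simp only [Prod.mk_add_mk, add_zero, Finsupp.coe_tsub, Pi.sub_apply, Prod.mk.injEq, and_true]
      omega
    · apply hf.ze
      intro p hp
      apply hle
      rw [sub_eq_iff_eq_add, ← map_add] at hp
      have := emb_inj hp
      simp only [Prod.mk_add_mk, add_zero, Prod.mk.injEq, and_true] at this
      obtain ⟨p1, p2⟩ := p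
      simp only [Prod.mk_add_mk, Prod.mk.injEq] at this
      intro i
      fin_cases i
      · change e 0 ≤ d 0; omega
      · change e 1 ≤ d 1; omega
  · intro u hu
    rw [coeff_mono_mul]
    apply hf.ze
    intro p hp
    rw [sub_eq_iff_eq_add, ← map_add, Prod.mk_add_mk, add_zero] at hp
    exact hu _ hp

theorem Rel.X0 {f : MvPowerSeries (Fin 2) ℚ} {h : HH} (hf : Rel f h) : Rel (MvPowerSeries.X 0 * f) (C52.mono vs.vec * h) := by
  have := hf.mono (Finsupp.single 0 1)
  have e : emb (((Finsupp.single (0 : Fin 2) 1 : Fin 2 →₀ ℕ) 0, (Finsupp.single (0 : Fin 2) 1 : Fin 2 →₀ ℕ) 1), 0) = vs.vec := by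
    simp only [Finsupp.single_eq_same]
    rw [Finsupp.single_eq_of_ne (by decide)]
    rfl
  rwa [e] at this

theorem Rel.X1 {f : MvPowerSeries (Fin 2) ℚ} {h : HH} (hf : Rel f h) : Rel (MvPowerSeries.X 1 * f) (C52.mono vt.vec * h) := by
  have := hf.mono (Finsupp.single 1 1)
  have e : emb (((Finsupp.single (1 : Fin 2) 1 : Fin 2 →₀ ℕ) 0, (Finsupp.single (1 : Fin 2) 1 : Fin 2 →₀ ℕ) 1), 0) = vt.vec := by
    simp only [Finsupp.single_eq_same]
    rw [Finsupp.single_eq_of_ne (by decide)]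
    rfl
  rwa [e] at this

theorem Rel.pow0 {f : MvPowerSeries (Fin 2) ℚ} {h : HH} (hf : Rel f h) (n : ℕ) : Rel (MvPowerSeries.X 0 ^ n * f) (C52.mono vs.vec ^ n * h) := by
  induction n with
  | zero => simpa using hf
  | succ n ih => rw [pow_succ', pow_succ', mul_assoc, mul_assoc]; exact ih.X0

theorem Rel.pow1 {f : MvPowerSeries (Fin 2) ℚ} {h : HH} (hf : Rel f h) (n : ℕ) : Rel (MvPowerSeries.X 1 ^ n * f) (C52.mono vt.vec ^ n * h) := by
  induction n with
  | zero => simpa using hf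
  | succ n ih => rw [pow_succ', pow_succ', mul_assoc, mul_assoc]; exact ih.X1

theorem Rel.fac {f : MvPowerSeries (Fin 2) ℚ} {h : HH} (hf : Rel f h) (a b : ℕ) :
    Rel ((1 - MvPowerSeries.X 0 ^ a * MvPowerSeries.X 1 ^ b) * f) ((1 - C52.mono vs.vec ^ a * C52.mono vt.vec ^ b) * h) := by
  have := hf.add ((hf.pow1 b).pow0 a).neg
  convert this using 1 <;> ring

theorem Rel.const (c : ℤ) : Rel (c : MvPowerSeries (Fin 2) ℚ) (c : HH) := by
  have h1 : Rel 1 1 := by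
    constructor
    · intro d
      rw [MvPowerSeries.coeff_one, ← mono_zero, coeff_mono]
      congr 1
      rw [eq_iff_iff]
      constructor
      · intro h
        have h' : emb ((d 0, d 1), 0) = emb 0 := h.trans (map_zero emb).symm
        have := emb_inj h'
        have h2 := congrArg (fun x => x.1.1) this
        have h3 := congrArg (fun x => x.1.2) this
        ext i
        fin_cases i
        · exact h2
        · exact h3
      · rintro rfl
        exact map_zero emb
    · intro u hu
      rw [← mono_zero, coeff_mono, if_neg]
      rintro rfl
      exact hu 0 (map_zero emb).symm
  have h0 : Rel 0 0 := by
    have := h1.add h1.neg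
    simpa using this
  induction c with
  | zero => simpa using h0
  | succ n ih => push_cast at ih ⊢; exact ih.add h1
  | pred n ih =>
    have := ih.add h1.neg
    push_cast at this ⊢
    rw [sub_eq_add_neg, sub_eq_add_neg]
    exact this

theorem Rel_Th (K : Type*) [Field K] [CharZero K] : Rel (purePS2 K 5) (Th delta) := by
  have hTh : Th = lin (fun v => TT (C52.mono (zv v) * GG)) := by
    rw [hom_eq_lin Th]
    congr 1
    funext v
    rw [Th_apply, io_single]
  constructor
  · intro d
    change _ = ((pureDim K 5 (d 0) (d 1) : ℕ) : ℚ)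
    have h1 := pureDim_eq (K := K) (d 0) (d 1)
    have h2 : ((pureDim K 5 (d 0) (d 1) : ℕ) : ℚ) = (((pureDim K 5 (d 0) (d 1) : ℕ) : ℤ) : ℚ) := by norm_cast
    rw [h2, h1]
    have h3 := lin_comp (fun v => ((Nat.card {x : II (d 0) (d 1) // Finsupp.weight matwt x.1 = v} : ℕ) : ℤ)) (Int.castAddHom ℚ) delta
    change ((lin _ delta : ℤ) : ℚ) = _ at h3
    rw [h3]
    have h4 := lin_comp (fun v => TT (C52.mono (zv v) * GG))
      ({ toFun := fun h => h.coeff (emb ((d 0, d 1), 0)), map_zero' := rfl, map_add' := fun _ _ => rfl } : HH →+ ℚ) delta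
    rw [← hTh] at h4
    change (Th delta).coeff _ = _ at h4
    rw [h4]
    congr 2
    funext v
    change (TT (C52.mono (zv v) * GG)).coeff (emb ((d 0, d 1), 0)) = ((_ : ℤ) : ℚ)
    rw [coeff_TT_emb, coeff_mono_mul]
    have h5 : emb ((d 0, d 1), 0) - zv v = emb ((d 0, d 1), -v) := by
      rw [sub_eq_iff_eq_add, zv_apply, ← map_add, Prod.mk_add_mk, add_zero, neg_add_cancel]
    rw [h5, GG, CS_coeff, Int.cast_natCast]
    congr 1
    rw [← Nat.card_coe_set_eq]
    apply Nat.card_congr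
    refine { toFun := fun x => ⟨⟨x.1, ?_⟩, ?_⟩, invFun := fun x => ⟨x.1.1, Finset.subset_univ _, ?_⟩, left_inv := fun _ => rfl, right_inv := fun _ => rfl }
    · have := x.2.2
      rw [weight_wH] at this
      exact congrArg Prod.fst (emb_inj this)
    · have := x.2.2
      rw [weight_wH] at this
      exact neg_injective (congrArg Prod.snd (emb_inj this))
    · rw [weight_wH, x.1.2, x.2]
  · intro u hu
    have h4 := lin_comp (fun v => TT (C52.mono (zv v) * GG))
      ({ toFun := fun h => h.coeff u, map_zero' := rfl, map_add' := fun _ _ => rfl } : HH →+ ℚ) delta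
    rw [← hTh] at h4
    change (Th delta).coeff _ = _ at h4
    rw [h4]
    have h5 : (fun v => ({ toFun := fun h => h.coeff u, map_zero' := rfl, map_add' := fun _ _ => rfl } : HH →+ ℚ) (TT (C52.mono (zv v) * GG))) = fun _ => 0 := by
      funext w
      change (TT (C52.mono (zv w) * GG)).coeff u = 0
      rw [coeff_TT]
      split_ifs with hz
      · rw [coeff_mono_mul]
        by_contra hne
        rw [GG, CS_coeff] at hne
        have h2 : (dS Finset.univ (u - zv w)).ncard ≠ 0 := by exact_mod_cast hne
        obtain ⟨d, _, hd⟩ := Set.nonempty_of_ncard_ne_zero h2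
        rw [weight_wH] at hd
        have h3 := eq_sub_iff_add_eq.1 hd
        rw [zv_apply, ← map_add, Prod.mk_add_mk] at h3
        apply hu (Finsupp.weight (bideg 5) d)
        rw [← h3, add_zero]
        congr 2
        rw [← h3] at hz
        funext k
        fin_cases k
        · exact hz.1
        · exact hz.2.1
        · exact hz.2.2.1
        · exact hz.2.2.2.1
        · exact hz.2.2.2.2
      · rfl
    rw [h5]
    have : lin (fun _ : L5 => (0 : ℚ)) = 0 := by
      apply AddMonoidAlgebra.addMonoidHom_ext
      intro v n
      simp [lin_single]
    rw [this]; rfl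

end C52

namespace C52

def w (s t : Int) : V := ⟨s, t, 0, 0, 0, 0, 0⟩
def LL : List V := [w 0 2, w 0 2, w 0 2, w 0 2, w 0 3, w 0 3, w 1 0, w 1 0, w 1 1, w 1 1, w 1 1, w 1 1, w 1 1, w 1 1, w 1 2, w 1 2, w 1 2, w 0 4, w 1 (-1), w 1 (-1), w 1 (-1), w 1 (-1), w 1 3, w 1 3, w 0 5, w 1 (-2), w 1 (-2), w 1 4, w 2 0, w 2 1, w 2 1, w 2 1, w 2 2, w 2 2, w 2 3, w 1 (-3), w 2 (-1), w 2 (-1), w 0 1, w 2 (-2), w 3 0, w 3 1, w 3 1, w 3 2, w 3 (-1), w 4 1]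
def BB : List V := [w 1 (-1), w 1 (-1), w 1 (-1), w 1 (-1), w 1 1, w 1 1, w 1 1, w 1 1, w 1 (-2), w 1 (-2), w 2 (-1), w 2 (-1), w 0 2, w 0 2, w 0 2, w 1 0, w 1 0, w 0 3, w 2 0, w 1 (-3), w 2 (-2), w 3 0, w 3 (-1), w 0 1, w 0 1, w 0 1, w 0 1, w 0 1]
def PL : List V := [w 1 0, w 0 1, w 2 0, w 0 2, w 1 1, w 1 1, w 3 0, w 0 3, w 2 1, w 2 1, w 2 1, w 1 2, w 1 2, w 1 2, w 4 0, w 0 4, w 3 1, w 3 1, w 2 2, w 2 2, w 1 3, w 1 3, w 5 0, w 0 5, w 4 1, w 3 2, w 2 3, w 1 4]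
def NT : List (List Int) := [[1],
  [0, -1, -2, -1],
  [0, -2, 0, 3, 4, 3, 1],
  [0, -1, 3, 7, 4, -2, -5, -4, -2],
  [0, 0, 4, 4, -5, -13, -10, -2, 5, 4, 2],
  [0, 0, 3, -2, -13, -11, 3, 18, 18, 8, -1, -3, -1],
  [0, 0, 1, -5, -10, 3, 27, 29, 12, -11, -17, -10, -1, 1],
  [0, 0, 0, -4, -2, 18, 29, 11, -24, -40, -24, -1, 10, 6],
  [0, 0, 0, -2, 5, 18, 12, -24, -47, -33, 9, 34, 27, 5, -4, -2],
  [0, 0, 0, 0, 4, 8, -11, -40, -33, 13, 54, 49, 10, -19, -20, -4],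
  [0, 0, 0, 0, 2, -1, -17, -24, 9, 54, 62, 13, -37, -48, -19, 5, 6, 1],
  [0, 0, 0, 0, 0, -3, -10, -1, 34, 49, 13, -45, -72, -37, 10, 27, 10, -1, -1],
  [0, 0, 0, 0, 0, -1, -1, 10, 27, 10, -37, -72, -45, 13, 49, 34, -1, -10, -3],
  [0, 0, 0, 0, 0, 0, 1, 6, 5, -19, -48, -37, 13, 62, 54, 9, -24, -17, -1, 2],
  [0, 0, 0, 0, 0, 0, 0, 0, -4, -20, -19, 10, 49, 54, 13, -33, -40, -11, 8, 4],
  [0, 0, 0, 0, 0, 0, 0, 0, -2, -4, 5, 27, 34, 9, -33, -47, -24, 12, 18, 5, -2],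
  [0, 0, 0, 0, 0, 0, 0, 0, 0, 0, 6, 10, -1, -24, -40, -24, 11, 29, 18, -2, -4],
  [0, 0, 0, 0, 0, 0, 0, 0, 0, 0, 1, -1, -10, -17, -11, 12, 29, 27, 3, -10, -5, 1],
  [0, 0, 0, 0, 0, 0, 0, 0, 0, 0, 0, -1, -3, -1, 8, 18, 18, 3, -11, -13, -2, 3],
  [0, 0, 0, 0, 0, 0, 0, 0, 0, 0, 0, 0, 0, 2, 4, 5, -2, -10, -13, -5, 4, 4],
  [0, 0, 0, 0, 0, 0, 0, 0, 0, 0, 0, 0, 0, 0, 0, -2, -4, -5, -2, 4, 7, 3, -1],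
  [0, 0, 0, 0, 0, 0, 0, 0, 0, 0, 0, 0, 0, 0, 0, 0, 0, 1, 3, 4, 3, 0, -2],
  [0, 0, 0, 0, 0, 0, 0, 0, 0, 0, 0, 0, 0, 0, 0, 0, 0, 0, 0, 0, -1, -2, -1],
  [0, 0, 0, 0, 0, 0, 0, 0, 0, 0, 0, 0, 0, 0, 0, 0, 0, 0, 0, 0, 0, 0, 0, 1]]

def eraseAll : List V → List V → Option (List V)
  | L, [] => some L
  | L, v :: d => if L.contains v then eraseAll (L.erase v) d else none

def prepAll : List Tm → Option (List Tm)
  | [] => some []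
  | T :: l => match eraseAll LL T.den with
    | none => none
    | some cof => match prepAll l with
      | none => none
      | some l' => some (⟨T.c, T.m, T.num ++ cof, []⟩ :: l')

def ee (v : V) : Int := v.s + 52 * v.t
def sg : List V → Int
  | [] => 1
  | v :: l => if 0 ≤ ee v then - sg l else sg l
def mg : List V → Nat
  | [] => 1
  | v :: l => (2 ^ (44 * (ee v).natAbs) - 1) * mg l
def sh : List V → Int
  | [] => 0
  | v :: l => min (ee v) 0 + sh l
def ssum : List V → Int
  | [] => 0
  | v :: l => v.s + ssum l

def okT (T : Tm) : Bool := decide (T.c.natAbs ≤ 1) && decide (0 ≤ T.m.s) && T.num.all (fun v => decide (0 ≤ v.s)) &&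
  decide (T.m.s + ssum T.num ≤ 51) && decide (T.num.length ≤ 30) && decide (0 ≤ ee T.m + sh T.num + 819)

def tz (c : Int) (m : Int) (l : List V) : Int := c * sg l * ((mg l * 2 ^ (44 * (m + sh l + 819).toNat) : Nat) : Int)

def tsum : List Tm → Int
  | [] => 0
  | T :: l => tz T.c (ee T.m) T.num + tsum l

def hrowZ (x : Int) : List Int → Int
  | [] => 0
  | c :: l => c + x * hrowZ x l
def HNZ (x y : Int) : List (List Int) → Int
  | [] => 0
  | r :: l => hrowZ x r + y * HNZ x y l

def NZ : Int := HNZ ((2 ^ 44 : Nat) : Int) ((2 ^ (44 * 52) : Nat) : Int) NT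

def check2 (L : List Tm) : Bool := decide (L.length ≤ 1000) && L.all okT && decide (tsum L = NZ * tz 1 0 BB)
def check1 (L : List Tm) : Bool := match prepAll L with
  | none => false
  | some L' => check2 L'
def checkO (o : Option (List Tm)) : Bool := match o with
  | none => false
  | some L => L.all zft && check1 L

set_option maxRecDepth 100000 in
theorem check0_true : checkO leaves = true := by decide +kernel

end C52

namespace C52

def BQ : ℚ := 2 ^ 44
def BZ : ℤ := 2 ^ 44
theorem BQ_ne : BQ ≠ 0 := by norm_num [BQ]
theorem BZ_BQ : ((BZ : ℤ) : ℚ) = BQ := by norm_num [BQ, BZ]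

abbrev A2 := AddMonoidAlgebra ℤ (ℤ × ℤ)

def iA : A2 →+* HH := (AddMonoidAlgebra.lift ℤ HH (ℤ × ℤ)
  { toFun := fun v => mono (w v.toAdd.1 v.toAdd.2).vec
    map_one' := by
      change mono V.zero.vec = 1
      rw [V.vec_zero, mono_zero]
    map_mul' := fun x y => by
      rw [← mono_add, ← V.vec_add]
      rfl }).toRingHom

def evA : A2 →+* ℚ := (AddMonoidAlgebra.lift ℤ ℚ (ℤ × ℤ)
  { toFun := fun v => BQ ^ (v.toAdd.1 + 52 * v.toAdd.2)
    map_one' := by simp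
    map_mul' := fun x y => by
      rw [← zpow_add₀ BQ_ne]
      congr 1
      change (x.toAdd.1 + y.toAdd.1) + 52 * (x.toAdd.2 + y.toAdd.2) = _
      ring }).toRingHom

def tA (v : V) : A2 := AddMonoidAlgebra.single (v.s, v.t) 1
def prodA (l : List V) : A2 := (l.map fun v => 1 - tA v).prod

theorem iA_tA {v : V} (h : zf v = true) : iA (tA v) = mono v.vec := by
  change AddMonoidAlgebra.lift ℤ HH _ _ _ = _
  rw [tA, AddMonoidAlgebra.lift_single]
  simp only [zf, Bool.and_eq_true, beq_iff_eq] at h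
  obtain ⟨⟨⟨⟨h1, h2⟩, h3⟩, h4⟩, h5⟩ := h
  rw [one_smul]
  change mono (w v.s v.t).vec = _
  cases v
  simp only at h1 h2 h3 h4 h5
  subst h1 h2 h3 h4 h5
  rfl

theorem evA_single (x : ℤ × ℤ) (c : ℤ) : evA (AddMonoidAlgebra.single x c) = c * BQ ^ (x.1 + 52 * x.2) := by
  change AddMonoidAlgebra.lift ℤ ℚ _ _ _ = _
  rw [AddMonoidAlgebra.lift_single, zsmul_eq_mul]
  rfl

theorem evA_tA (v : V) : evA (tA v) = BQ ^ ee v := by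
  rw [tA, evA_single]
  simp [ee]

theorem iA_prodA {l : List V} (h : l.all zf = true) : iA (prodA l) = prodOM l := by
  induction l with
  | nil => simp [prodA, prodOM]
  | cons v l ih =>
    simp only [List.all_cons, Bool.and_eq_true] at h
    rw [prodOM_cons, ← ih h.2, prodA, List.map_cons, List.prod_cons, map_mul iA, map_sub iA, iA_tA h.1, map_one iA]
    rfl

theorem evA_prodA (l : List V) : evA (prodA l) = (sg l : ℚ) * (mg l : ℚ) * BQ ^ sh l := by
  induction l with
  | nil => simp [prodA, sg, mg, sh]
  | cons v l ih =>
    rw [prodA, List.map_cons, List.prod_cons, map_mul evA, map_sub evA, evA_tA, map_one evA]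
    change (1 - BQ ^ ee v) * evA (prodA l) = _
    rw [ih, sg, mg, sh]
    have hq := BQ_ne
    have h2 : (((2 ^ (44 * (ee v).natAbs) - 1 : ℕ)) : ℚ) = BQ ^ (ee v).natAbs - 1 := by
      rw [Nat.cast_sub Nat.one_le_two_pow]; push_cast; rw [pow_mul]; rfl
    rw [Nat.cast_mul, h2, zpow_add₀ hq]
    split_ifs with h
    · rw [min_eq_right h, zpow_zero]
      have : BQ ^ (ee v) = BQ ^ (ee v).natAbs := by
        rw [← zpow_natCast BQ]
        congr 1
        omega
      rw [this]; push_cast; ring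
    · rw [min_eq_left (by omega)]
      have : BQ ^ (ee v) * BQ ^ (ee v).natAbs = 1 := by
        rw [← zpow_natCast BQ, ← zpow_add₀ hq]
        convert zpow_zero _
        omega
      linear_combination (-(sg l : ℚ) * mg l * BQ ^ sh l) * this

/-- bounds -/
def Bd (Q : A2) (M D : ℤ) : Prop := ∀ v : ℤ × ℤ, |Q.coeff v| ≤ M ∧ (Q.coeff v ≠ 0 → 0 ≤ v.1 ∧ v.1 ≤ D)

theorem Bd.add {P Q : A2} {M N D : ℤ} (hP : Bd P M D) (hQ : Bd Q N D) : Bd (P + Q) (M + N) D := by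
  intro v
  have e : (P + Q).coeff v = P.coeff v + Q.coeff v := by simp
  rw [e]
  refine ⟨(abs_add_le _ _).trans (add_le_add (hP v).1 (hQ v).1), fun h => ?_⟩
  by_cases h0 : P.coeff v = 0
  · apply (hQ v).2; intro h1; simp [h0, h1] at h
  · exact (hP v).2 h0

theorem Bd.neg {P : A2} {M D : ℤ} (hP : Bd P M D) : Bd (-P) M D := by
  intro v
  have e : (-P).coeff v = -P.coeff v := by simp
  rw [e, abs_neg]
  exact ⟨(hP v).1, fun h => (hP v).2 (by simpa using h)⟩

theorem Bd.mono {P : A2} {M N D E : ℤ} (hP : Bd P M D) (h : M ≤ N) (h' : D ≤ E) : Bd P N E := fun v =>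
  ⟨(hP v).1.trans h, fun h1 => ⟨((hP v).2 h1).1, ((hP v).2 h1).2.trans h'⟩⟩

theorem Bd.tA {P : A2} {M D : ℤ} (hP : Bd P M D) {v : V} (hv : 0 ≤ v.s) : Bd (C52.tA v * P) M (v.s + D) := by
  intro u
  have e : (C52.tA v * P).coeff u = P.coeff (-(v.s, v.t) + u) := by
    rw [C52.tA, AddMonoidAlgebra.coeff_single_mul_apply, one_mul]
  rw [e]
  refine ⟨(hP _).1, fun h => ?_⟩
  have := (hP _).2 h
  simp only [Prod.neg_mk, Prod.fst_add] at this
  omega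

theorem Bd.om {P : A2} {M D : ℤ} (hP : Bd P M D) {v : V} (hv : 0 ≤ v.s) : Bd ((1 - C52.tA v) * P) (2 * M) (v.s + D) := by
  have := (hP.mono (le_refl M) (by omega : D ≤ v.s + D)).add (hP.tA hv).neg
  rw [two_mul]
  convert this using 1
  ring

theorem Bd.const (c : ℤ) {D : ℤ} (hD : 0 ≤ D) : Bd (c : A2) |c| D := by
  intro v
  have e : ((c : A2)).coeff v = if v = 0 then c else 0 := by
    have : (c : A2) = AddMonoidAlgebra.single 0 c := by
      rw [AddMonoidAlgebra.intCast_def]; simp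
    rw [this, AddMonoidAlgebra.coeff_single, Finsupp.single_apply]
    simp [eq_comm]
  rw [e]
  split_ifs with h
  · subst h; exact ⟨le_rfl, fun _ => ⟨le_rfl, hD⟩⟩
  · simp

theorem Bd.prod {P : A2} {M D : ℤ} (hP : Bd P M D) (l : List V) (hl : l.all (fun v => decide (0 ≤ v.s)) = true) :
    Bd (prodA l * P) (2 ^ l.length * M) (ssum l + D) := by
  induction l with
  | nil => simpa [prodA, ssum] using hP
  | cons v l ih =>
    simp only [List.all_cons, Bool.and_eq_true, decide_eq_true_eq] at hl
    have := (ih (by simpa using hl.2)).om hl.1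
    rw [prodA, List.map_cons, List.prod_cons, List.length_cons, ssum, mul_assoc]
    exact this.mono (by rw [pow_succ']; linarith) (by omega)

theorem inj {Q : A2} {M : ℤ} (hQ : Bd Q M 51) (hM : M < BZ) (h : evA Q = 0) : Q = 0 := by
  by_contra hne
  have hs : Q.coeff.support.Nonempty := by
    rw [Finsupp.support_nonempty_iff]
    intro h0
    exact hne (by ext v; simp [h0])
  obtain ⟨v0, hv0, hmin⟩ := Finset.exists_min_image Q.coeff.support (fun v => v.1 + 52 * v.2) hs
  have hq := BQ_ne
  have hev : evA Q = ∑ v ∈ Q.coeff.support, (Q.coeff v : ℚ) * BQ ^ (v.1 + 52 * v.2) := by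
    have hQs : Q = ∑ v ∈ Q.coeff.support, AddMonoidAlgebra.single v (Q.coeff v) := by
      conv_lhs => rw [← AddMonoidAlgebra.sum_coeff_single Q]
      rfl
    conv_lhs => rw [hQs]
    rw [map_sum]
    simp only [evA_single]
  have h2 : ∑ v ∈ Q.coeff.support, Q.coeff v * BZ ^ (v.1 + 52 * v.2 - (v0.1 + 52 * v0.2)).toNat = 0 := by
    have h3 : (((∑ v ∈ Q.coeff.support, Q.coeff v * BZ ^ (v.1 + 52 * v.2 - (v0.1 + 52 * v0.2)).toNat : ℤ)) : ℚ) * BQ ^ (v0.1 + 52 * v0.2) = 0 := by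
      rw [← h, hev]
      push_cast
      rw [BZ_BQ, Finset.sum_mul]
      apply Finset.sum_congr rfl
      intro v hv
      rw [mul_assoc, ← zpow_natCast BQ, ← zpow_add₀ hq]
      congr 2
      have := hmin v hv
      omega
    rcases mul_eq_zero.1 h3 with h4 | h4
    · exact_mod_cast h4
    · exact absurd h4 (zpow_ne_zero _ hq)
  rw [← Finset.add_sum_erase _ _ hv0] at h2
  have h5 : BZ ∣ ∑ v ∈ Q.coeff.support.erase v0, Q.coeff v * BZ ^ (v.1 + 52 * v.2 - (v0.1 + 52 * v0.2)).toNat := by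
    apply Finset.dvd_sum
    intro v hv
    obtain ⟨hvn, hv⟩ := Finset.mem_erase.1 hv
    apply Dvd.dvd.mul_left
    apply dvd_pow_self
    have h6 := hmin v hv
    have h7 := (hQ v).2 (Finsupp.mem_support_iff.1 hv)
    have h8 := (hQ v0).2 (Finsupp.mem_support_iff.1 hv0)
    intro h9
    apply hvn
    ext <;> omega
  have h6 : BZ ∣ Q.coeff v0 := by
    simp only [sub_self, Int.toNat_zero, pow_zero, mul_one] at h2
    rw [eq_neg_of_add_eq_zero_left h2]
    exact h5.neg_right
  have h7 := Int.eq_zero_of_abs_lt_dvd h6 (lt_of_le_of_lt (hQ v0).1 hM)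
  exact (Finsupp.mem_support_iff.1 hv0) h7

end C52

namespace C52

def hrow {R : Type*} [CommRing R] (x : R) : List ℤ → R
  | [] => 0
  | c :: l => (c : R) + x * hrow x l
def HN {R : Type*} [CommRing R] (x y : R) : List (List ℤ) → R
  | [] => 0
  | r :: l => hrow x r + y * HN x y l

theorem map_hrow {R S : Type*} [CommRing R] [CommRing S] (f : R →+* S) (x : R) (l : List ℤ) :
    f (hrow x l) = hrow (f x) l := by
  induction l with
  | nil => simp [hrow]
  | cons c l ih => rw [hrow, hrow, map_add, map_mul, map_intCast, ih]

theorem map_HN {R S : Type*} [CommRing R] [CommRing S] (f : R →+* S) (x y : R) (l : List (List ℤ)) :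
    f (HN x y l) = HN (f x) (f y) l := by
  induction l with
  | nil => simp [HN]
  | cons r l ih => rw [HN, HN, map_add, map_mul, map_hrow, ih]

theorem hrowZ_eq (x : ℤ) (l : List ℤ) : hrowZ x l = hrow x l := by
  induction l with
  | nil => rfl
  | cons c l ih => rw [hrow, hrowZ, ih, Int.cast_id]

theorem HNZ_eq (x y : ℤ) (l : List (List ℤ)) : HNZ x y l = HN x y l := by
  induction l with
  | nil => rfl
  | cons c l ih => rw [HN, HNZ, ih, hrowZ_eq]

def rowA (l : List ℤ) : ℤ := (l.map fun c => |c|).sum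
def tabA (l : List (List ℤ)) : ℤ := (l.map rowA).sum

theorem Bd_hrow (l : List ℤ) : Bd (hrow (tA vs) l) (rowA l) l.length := by
  induction l with
  | nil => simpa [rowA, hrow] using Bd.const 0 le_rfl
  | cons c l ih =>
    have h1 := ih.tA (v := vs) (by decide)
    have h2 := Bd.const c (D := ((c :: l).length : ℤ)) (by positivity)
    have h3 : vs.s + (l.length : ℤ) ≤ ((c :: l).length : ℤ) := by
      change 1 + (l.length : ℤ) ≤ _
      rw [List.length_cons]; push_cast; omega
    have := h2.add (h1.mono le_rfl h3)
    rw [hrow]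
    simpa [rowA] using this

theorem Bd_HN (D : ℤ) (hD : 0 ≤ D) (l : List (List ℤ)) (h : ∀ r ∈ l, (r.length : ℤ) ≤ D) :
    Bd (HN (tA vs) (tA vt) l) (tabA l) D := by
  induction l with
  | nil => simpa [tabA, HN] using Bd.const 0 hD
  | cons r l ih =>
    have h1 := (ih fun r hr => h r (List.mem_cons_of_mem _ hr)).tA (v := vt) (by decide)
    have h2 := (Bd_hrow r).mono le_rfl (h r List.mem_cons_self)
    have h3 : vt.s + D ≤ D := by
      change 0 + D ≤ _
      omega
    have := h2.add (h1.mono le_rfl h3)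
    rw [HN]
    simpa [tabA] using this

def NA : A2 := HN (tA vs) (tA vt) NT

theorem Bd_NA : Bd NA 3140 24 := by
  have h : ∀ r ∈ NT, (r.length : ℤ) ≤ 24 := by decide +kernel
  have h2 : tabA NT ≤ 3140 := by decide +kernel
  exact (Bd_HN 24 (by norm_num) NT h).mono h2 le_rfl

theorem evA_NA_aux (x y : ℤ) (hx : (x : ℚ) = BQ ^ ee vs) (hy : (y : ℚ) = BQ ^ ee vt) : evA NA = (HNZ x y NT : ℚ) := by
  have := map_HN (Int.castRingHom ℚ) x y NT
  rw [eq_intCast, eq_intCast, eq_intCast] at this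
  rw [NA, map_HN, HNZ_eq, this, evA_tA, evA_tA, hx, hy]

theorem pow_aux (n m : ℕ) : (((2 ^ (n * m) : ℕ) : ℤ) : ℚ) = ((2 : ℚ) ^ n) ^ m := by
  rw [← pow_mul]; push_cast; rfl

theorem evA_NA : evA NA = (NZ : ℚ) := by
  refine evA_NA_aux _ _ ?_ ?_
  · have h : ee vs = ((1 : ℕ) : ℤ) := by decide
    rw [h, zpow_natCast]
    exact pow_aux 44 1
  · have h : ee vt = ((52 : ℕ) : ℤ) := by decide
    rw [h, zpow_natCast]
    exact pow_aux 44 52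

theorem iA_NA : iA NA = HN (mono vs.vec) (mono vt.vec) NT := by
  rw [NA, map_HN, iA_tA (by decide), iA_tA (by decide)]

def TA (T : Tm) : A2 := prodA T.num * (tA T.m * (T.c : A2))

theorem tz_eq (c m : ℤ) (l : List V) (h : 0 ≤ m + sh l + 819) :
    (tz c m l : ℚ) = c * BQ ^ m * (sg l * mg l * BQ ^ sh l) * BQ ^ (819 : ℤ) := by
  rw [tz]
  push_cast
  rw [pow_mul]
  have : ((2 : ℚ) ^ 44) ^ (m + sh l + 819).toNat = BQ ^ m * BQ ^ sh l * BQ ^ (819 : ℤ) := by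
    rw [← zpow_add₀ BQ_ne, ← zpow_add₀ BQ_ne]
    change BQ ^ (m + sh l + 819).toNat = _
    rw [← zpow_natCast BQ, Int.toNat_of_nonneg h]
  rw [this]
  ring

theorem TA_spec {T : Tm} (h : okT T = true) : Bd (TA T) (2 ^ 30) 51 ∧
    (tz T.c (ee T.m) T.num : ℚ) = evA (TA T) * BQ ^ (819 : ℤ) := by
  simp only [okT, Bool.and_eq_true, decide_eq_true_eq] at h
  obtain ⟨⟨⟨⟨⟨h1, h2⟩, h3⟩, h4⟩, h5⟩, h6⟩ := h
  constructor
  · have := ((Bd.const T.c (D := 0) le_rfl).tA h2).prod T.num h3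
    refine this.mono ?_ (by omega)
    have h7 : |T.c| ≤ 1 := by rw [Int.abs_eq_natAbs]; exact_mod_cast h1
    calc (2 : ℤ) ^ T.num.length * |T.c| ≤ 2 ^ 30 * 1 :=
          mul_le_mul (pow_le_pow_right₀ (by norm_num) h5) h7 (abs_nonneg _) (by positivity)
      _ = 2 ^ 30 := by norm_num
  · rw [tz_eq _ _ _ h6, TA, map_mul evA, map_mul evA, evA_prodA, evA_tA, map_intCast]
    ring

theorem sum_spec {L : List Tm} (h : L.all okT = true) : Bd ((L.map TA).sum) (L.length * 2 ^ 30) 51 ∧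
    (tsum L : ℚ) = evA ((L.map TA).sum) * BQ ^ (819 : ℤ) := by
  induction L with
  | nil =>
    constructor
    · simpa using Bd.const 0 (D := 51) (by norm_num)
    · simp [tsum]
  | cons T L ih =>
    simp only [List.all_cons, Bool.and_eq_true] at h
    obtain ⟨i1, i2⟩ := ih (by simpa using h.2)
    obtain ⟨t1, t2⟩ := TA_spec h.1
    rw [List.map_cons, List.sum_cons, tsum]
    constructor
    · refine (t1.add i1).mono ?_ le_rfl
      rw [List.length_cons]; push_cast; linarith
    · rw [map_add evA]; push_cast; rw [i2, t2]; ring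

theorem check2_sound {L : List Tm} (h : check2 L = true) : (L.map TA).sum = prodA BB * NA := by
  simp only [check2, Bool.and_eq_true, decide_eq_true_eq] at h
  obtain ⟨⟨h1, h2⟩, h3⟩ := h
  obtain ⟨b, e⟩ := sum_spec h2
  have hb : BB.all (fun v => decide (0 ≤ v.s)) = true := by decide +kernel
  have hs : ssum BB = 27 := by decide +kernel
  have hl : BB.length = 28 := by decide +kernel
  have b2 := Bd_NA.prod BB hb
  rw [hs, hl] at b2
  rw [← sub_eq_zero, sub_eq_add_neg]
  refine inj (b.add b2.neg) ?_ ?_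
  · have : (L.length : ℤ) ≤ 1000 := by exact_mod_cast h1
    rw [BZ]
    linarith
  · have h4 : (tsum L : ℚ) = NZ * tz 1 0 BB := by exact_mod_cast h3
    have h5 : 0 ≤ 0 + sh BB + 819 := by decide +kernel
    rw [e, tz_eq _ _ _ h5] at h4
    have h6 : BQ ^ (819 : ℤ) ≠ 0 := zpow_ne_zero _ BQ_ne
    rw [map_add evA, map_neg evA, map_mul evA, evA_prodA, evA_NA]
    apply mul_right_cancel₀ h6
    rw [add_mul, h4]
    push_cast
    rw [zpow_zero]
    ring

theorem eraseAll_sound (L d c : List V) (h : eraseAll L d = some c) : prodOM L = prodOM d * prodOM c ∧ (∀ v ∈ c, v ∈ L) := by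
  induction d generalizing L with
  | nil =>
    simp only [eraseAll, Option.some.injEq] at h
    subst h
    simp [prodOM_nil]
  | cons v d ih =>
    rw [eraseAll] at h
    split_ifs at h with hc
    obtain ⟨i1, i2⟩ := ih _ h
    rw [prodOM_erase (v := v) (d := L) (by simpa using hc), i1, prodOM_cons, mul_assoc]
    exact ⟨rfl, fun u hu => List.mem_of_mem_erase (i2 u hu)⟩

theorem prodOM_ne {l : List V} (h : l.all V.pos = true) : prodOM l ≠ 0 := by
  rw [prodOM]
  apply List.prod_ne_zero
  intro h1
  obtain ⟨v, hv, h0⟩ := List.mem_map.1 h1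
  exact om_ne_zero (List.all_eq_true.1 h v hv) h0

theorem LL_ne : prodOM LL ≠ 0 := prodOM_ne (by decide +kernel)
theorem BB_ne : prodOM BB ≠ 0 := prodOM_ne (by decide +kernel)

theorem prepAll_sound (L L' : List Tm) (h : prepAll L = some L') (hz : L.all zft = true) :
    vals L * prodOM LL = iA ((L'.map TA).sum) := by
  induction L generalizing L' with
  | nil =>
    simp only [prepAll, Option.some.injEq] at h
    subst h
    simp [vals_nil]
  | cons T L ih =>
    rw [prepAll] at h
    simp only [List.all_cons, Bool.and_eq_true] at hz
    split at h
    · simp at h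
    · next cof hc =>
      split at h
      · simp at h
      · next l' hl =>
        simp only [Option.some.injEq] at h
        subst h
        have i := ih l' hl (by simpa using hz.2)
        obtain ⟨e1, e2⟩ := eraseAll_sound _ _ _ hc
        have hd : prodOM T.den ≠ 0 := by
          intro h0
          rw [h0, zero_mul] at e1
          exact LL_ne e1
        rw [List.map_cons, List.sum_cons, map_add iA, ← i, vals_cons, add_mul]
        congr 1
        have hz1 := hz.1
        simp only [zft, Bool.and_eq_true] at hz1
        have hLL : LL.all zf = true := by decide +kernel
        have hall : (T.num ++ cof).all zf = true := by
          rw [List.all_append, hz1.1.2, Bool.true_and, List.all_eq_true]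
          exact fun v hv => List.all_eq_true.1 hLL v (e2 v hv)
        rw [TA, map_mul iA, map_mul iA, iA_tA hz1.1.1, iA_prodA hall, map_intCast, Tm.val, e1, prodOM_append]
        field_simp

theorem checkO_sound (o : Option (List Tm)) (h : checkO o = true) :
    ∃ L L', o = some L ∧ L.all zft = true ∧ prepAll L = some L' ∧ check2 L' = true := by
  rw [checkO.eq_def] at h
  split at h
  · simp at h
  · next L =>
    rw [Bool.and_eq_true] at h
    obtain ⟨hz, h⟩ := h
    rw [check1] at h
    split at h
    · simp at h
    · next L' hL' => exact ⟨L, L', rfl, hz, hL', h⟩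

theorem BB_zf : BB.all zf = true := by decide +kernel
theorem PL_perm : (PL ++ BB).Perm (Elist ++ LL) := by decide +kernel

theorem HH_main : Th delta * prodOM PL = HN (mono vs.vec) (mono vt.vec) NT := by
  obtain ⟨L, L', hL, hz, hL', h⟩ := checkO_sound _ check0_true
  have e1 := prepAll_sound L L' hL' hz
  rw [check2_sound h, map_mul iA, iA_NA, iA_prodA BB_zf, ← leaves_sound L hL hz, ← Th_E] at e1
  have hp : prodOM (PL ++ BB) = prodOM (Elist ++ LL) := prodOM_perm PL_perm
  rw [prodOM_append, prodOM_append] at hp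
  apply mul_right_cancel₀ BB_ne
  linear_combination e1 + Th delta * hp

end C52

namespace C52

def PN : List (ℕ × ℕ) := [(1, 0), (0, 1), (2, 0), (0, 2), (1, 1), (1, 1), (3, 0), (0, 3), (2, 1), (2, 1), (2, 1), (1, 2), (1, 2), (1, 2),
  (4, 0), (0, 4), (3, 1), (3, 1), (2, 2), (2, 2), (1, 3), (1, 3), (5, 0), (0, 5), (4, 1), (3, 2), (2, 3), (1, 4)]

theorem PL_eq : PL = PN.map fun p => w p.1 p.2 := by decide +kernel

theorem om_w (a b : ℕ) : om (w a b) = 1 - mono vs.vec ^ a * mono vt.vec ^ b := by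
  have : w a b = (V.smul a vs).add (V.smul b vt) := by simp [w, V.smul, V.add, vs, vt]
  rw [om, this, V.vec_add, V.vec_smul, V.vec_smul, mono_add, mono_zsmul, mono_zsmul, zpow_natCast, zpow_natCast]

theorem Rel_prod {f : MvPowerSeries (Fin 2) ℚ} {h : HH} (hf : Rel f h) (l : List (ℕ × ℕ)) :
    Rel ((l.map fun p => 1 - MvPowerSeries.X 0 ^ p.1 * MvPowerSeries.X 1 ^ p.2).prod * f) (prodOM (l.map fun p => w p.1 p.2) * h) := by
  induction l with
  | nil => simpa [prodOM_nil] using hf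
  | cons p l ih =>
    have := ih.fac p.1 p.2
    rw [List.map_cons, List.map_cons, List.prod_cons, prodOM_cons, om_w, mul_assoc, mul_assoc]
    exact this

theorem Rel_hrow (l : List ℤ) : Rel (hrow (MvPowerSeries.X 0) l) (hrow (mono vs.vec) l) := by
  induction l with
  | nil => simpa [hrow] using Rel.const 0
  | cons c l ih => exact (Rel.const c).add ih.X0

theorem Rel_HN (l : List (List ℤ)) : Rel (HN (MvPowerSeries.X 0) (MvPowerSeries.X 1) l) (HN (mono vs.vec) (mono vt.vec) l) := by
  induction l with
  | nil => simpa [HN] using Rel.const 0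
  | cons c l ih => exact (Rel_hrow c).add ih.X1

theorem Pi_eq : PiPoly 5 = (PN.map fun p => 1 - qs ^ p.1 * qt ^ p.2).prod := by
  obtain ⟨f, hf⟩ : ∃ f : ℕ → ℕ → MvPolynomial (Fin 2) ℚ, ∀ a b, f a b = 1 - qs ^ a * qt ^ b := ⟨_, fun _ _ => rfl⟩
  have h1 : ∀ a, 1 - qs ^ a = f a 0 := fun a => by rw [hf, pow_zero, mul_one]
  have h2 : ∀ a, 1 - qt ^ a = f 0 a := fun a => by rw [hf, pow_zero, one_mul]
  simp only [PiPoly, h1, h2, ← hf]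
  simp only [Finset.prod_range_succ, Finset.prod_range_zero, PN, List.map_cons, List.map_nil, List.prod_cons, List.prod_nil]
  norm_num [-one_ne_zero]
  ring

theorem PS_main (K : Type*) [Field K] [CharZero K] :
    purePS2 K 5 * ((PiPoly 5 : MvPolynomial (Fin 2) ℚ) : MvPowerSeries (Fin 2) ℚ) = ((HN qs qt NT : MvPolynomial (Fin 2) ℚ) : MvPowerSeries (Fin 2) ℚ) := by
  have h1 := Rel_prod (Rel_Th K) PN
  rw [← PL_eq, mul_comm (prodOM PL), HH_main] at h1
  have h2 := h1.unique (Rel_HN NT)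
  obtain ⟨r, hr⟩ : ∃ r : MvPolynomial (Fin 2) ℚ →+* MvPowerSeries (Fin 2) ℚ, ∀ p, r p = (p : MvPowerSeries (Fin 2) ℚ) :=
    ⟨MvPolynomial.coeToMvPowerSeries.ringHom, fun _ => rfl⟩
  have rs : r qs = MvPowerSeries.X 0 := (hr _).trans (MvPolynomial.coe_X 0)
  have rt : r qt = MvPowerSeries.X 1 := (hr _).trans (MvPolynomial.coe_X 1)
  rw [← hr, ← hr]
  rw [map_HN, rs, rt, ← h2, Pi_eq, map_list_prod, List.map_map, mul_comm]
  congr 2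
  apply List.map_congr_left
  intro p _
  simp only [Function.comp_apply, map_sub, map_mul, map_pow, map_one, rs, rt]

/-- list polynomials -/
def addL : List ℤ → List ℤ → List ℤ
  | [], q => q
  | a :: p, [] => a :: p
  | a :: p, b :: q => (a + b) :: addL p q
def scaleL (c : ℤ) : List ℤ → List ℤ
  | [] => []
  | a :: p => (c * a) :: scaleL c p
def mulL : List ℤ → List ℤ → List ℤ
  | [], _ => []
  | a :: p, q => addL (scaleL a q) (0 :: mulL p q)
def colZ : List (List ℤ) → List ℤ
  | [] => []
  | r :: l => addL r (scaleL 2 (colZ l))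
def rowZ : List (List ℤ) → List ℤ
  | [] => []
  | r :: l => hrowZ 2 r :: rowZ l
def n2 : List ℤ := colZ NT
def fl (a b : ℕ) : List ℤ := 1 :: (List.replicate (b - 1) 0 ++ [-(((2 ^ a : ℕ)) : ℤ)])

section
variable {R : Type*} [CommRing R] (x : R)

theorem hrow_add (p q : List ℤ) : hrow x (addL p q) = hrow x p + hrow x q := by
  induction p generalizing q with
  | nil => simp [addL, hrow]
  | cons a p ih =>
    cases q with
    | nil => simp [addL, hrow]
    | cons b q => simp only [addL, hrow, ih]; push_cast; ring

theorem hrow_scale (c : ℤ) (p : List ℤ) : hrow x (scaleL c p) = c * hrow x p := by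
  induction p with
  | nil => simp [scaleL, hrow]
  | cons a p ih => simp only [scaleL, hrow, ih]; push_cast; ring

theorem hrow_mul (p q : List ℤ) : hrow x (mulL p q) = hrow x p * hrow x q := by
  induction p with
  | nil => simp [mulL, hrow]
  | cons a p ih => simp only [mulL, hrow, hrow_add, hrow_scale, ih]; push_cast; ring

theorem hrow_col (l : List (List ℤ)) : hrow x (colZ l) = HN x 2 l := by
  induction l with
  | nil => simp [colZ, hrow, HN]
  | cons r l ih => simp only [colZ, HN, hrow_add, hrow_scale, ih]; push_cast; ring

theorem hrow_row (l : List (List ℤ)) : hrow x (rowZ l) = HN 2 x l := by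
  induction l with
  | nil => simp [rowZ, hrow, HN]
  | cons r l ih =>
    have := map_hrow (Int.castRingHom R) 2 r
    rw [eq_intCast, map_ofNat] at this
    rw [rowZ, hrow, HN, ih, hrowZ_eq, this]

theorem hrow_fl (a b : ℕ) (hb : 1 ≤ b) : hrow x (fl a b) = 1 - 2 ^ a * x ^ b := by
  obtain ⟨b, rfl⟩ : ∃ k, b = k + 1 := ⟨b - 1, by omega⟩
  have : ∀ (k : ℕ) (c : ℤ), hrow x (List.replicate k 0 ++ [c]) = c * x ^ k := by
    intro k c
    induction k with
    | zero => simp [hrow]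
    | succ k ih => rw [List.replicate_succ, List.cons_append, hrow, ih]; push_cast; ring
  rw [fl, hrow, Nat.add_sub_cancel, this]
  push_cast
  ring

theorem hrow_zero (l : List ℤ) (h : l.all (fun c => decide (c = 0)) = true) : hrow x l = 0 := by
  induction l with
  | nil => rfl
  | cons c l ih =>
    simp only [List.all_cons, Bool.and_eq_true, decide_eq_true_eq] at h
    rw [hrow, h.1, ih (by simpa using h.2)]
    simp
end

theorem n2_row : rowZ NT = n2 := by decide +kernel

def certOK (a b : ℕ) (V : List ℤ) (m : ℤ) (Q : List ℤ) : Bool :=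
  decide (1 ≤ b) && decide (m ≠ 0) && (addL (mulL V n2) (scaleL (-1) (addL [m] (mulL (fl a b) Q)))).all (fun c => decide (c = 0))

theorem cert_1_1 : certOK 1 1 [-64] 31841
  [-31905, -62658, -140932, -200072, -658192, -1276192, -567616, -3736192, -11871488, 3462656, 10255360, -22163456, -12601344, 64806912, 136298496, 52887552, -46661632, 43057152, 293076992, 243269632, -155189248, -167772160, 268435456] = true := by decide +kernel
theorem cert_2_1 : certOK 2 1 [8388608] 11043285
  [-2654677, -161613652, 1400365744, -5119178048, 13346155264, 48116575232, -67681210368, 70188187648, 857352110080, -136488157184, -982428680192, 1663674875904, 2496365854720, -1812274872320, -8125272817664, -3703335550976, 5166845657088, 2791728742400, -15960098471936, -18897856102400, 8521215115264, 15393162788864, -17592186044416] = true := by decide +kernel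
theorem cert_3_1 : certOK 3 1 [70368744177664] 65699270545675
  [4669473631989, -1229281606142040, 7335720730213696, -31245489217345024, 33762862785581056, 225911330941075456, -374984846909112320, -140093011892633600, 3716121904654843904, -183933487756083200, -5132894399100878848, 5857597524952481792, 11978149285821677568, -3141407524893229056, -32481134791014481920, -18275994315962449920, 21398009204520779776, 21232220443238203392, -57700118425870794752, -84595615400527396864, 28823037615171174400, 73786976294838206464, -73786976294838206464] = true := by decide +kernel
theorem cert_4_1 : certOK 4 1 [590295810358705651712] 339627021716544848715
  [250668788642160802997, -6614623968182128882864, 38198194236610116891904, -143226937852663952617472, 88441701723677945823232, 1044361458673579983896576, -1596470332066899928547328, -1553903580092601171181568, 15712115539334372937170944, 466183195588498919784448, -23255340475168189753327616, 21514354011528153217892352, 51612947439915755464818688, -4384868649831541130657792, -131813115197650746000539648, -82547938033389781907406848, 85213719677577219664773120, 105532199532213858354593792, -220378676656077733187551232, -363508882385373809969463296, 102758694667243479850024960, 328827822935179135520079872, -309485009821345068724781056] = true := by decide +kernel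
theorem cert_2_2 : certOK 2 2 [200512, -3674624] 814333575
  [-814133063, -7283840, -3141464092, -1181997952, -7061222512, -19669997312, -32155504320, 43426257920, -264176343808, -164109168640, 494900151296, -331540445184, -569976088576, 213393354752, 2867143761920, 1925730222080, -668677865472, -1476666589184, 4507292401664, 7050560012288, 352657080320, -9090029846528, 7706245070848] = true := by decide +kernel
theorem cert_3_2 : certOK 3 2 [-22576431104, -93265854464] 1210388119209
  [-1232964550313, 313109905408, -13693580211528, 8600689704960, -81383049898560, -293064408825856, 107646838812160, -369660752035840, -4480963183284224, 228962156412928, 4973186939322368, -8369096846475264, -11211276172918784, 11031721180921856, 43836951410769920, 20491216491642880, -23255421892427776, -10104008207237120, 85708420128178176, 99815543543955456, -40384851634814976, -86347774865440768, 97796336610443264] = true := by decide +kernel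
theorem cert_0_1 : certOK 0 1 [1] 10821645
  [-10821644, -10821662, -10821418, -10822696, -10818664, -10819292, -10850304, -10809664, -10740928, -11166016, -11218048, -10551264, -11046976, -12453376, -12557824, -9124864, -6743040, -8873984, -12107776, -6750208, 3276800, 1048576, -8388608] = true := by decide +kernel
theorem cert_0_2 : certOK 0 2 [174467, 2338796] 27197639977635
  [-27197639803168, -801610, -27197639331548, 346895788, -27199924861892, 9667355984, -27206804196384, -55773046688, -27099763363232, 30822607072, -28103035344224, 25462177728, -26630048977664, -1379277453824, -29937554401280, -1024621786112, -21493011597312, 4174199250944, -27041044889600, -2454261727232, -12761404276736, 20608112918528, -19619242835968] = true := by decide +kernel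
theorem cert_0_3 : certOK 0 3 [79389052279, 357226130338, 77581837564] 5564457612456617745
  [-5564457533067565466, -1071776810684, 13018440247556, -5564473225573651708, -118580144228104, 1304348284532368, -5566846766903722272, -8019227207641792, 18872936172383264, -5572886879185384096, -158669874482143360, 20241987827031552, -5378085055149548800, -395673589151165440, -528911117475294208, -5251968265449385984, 1011656909539467264, 419100373654970368, -6085138544009740288, 116471601835802624, 2878114794971856896, -2264475898612809728, -650803623244070912] = true := by decide +kernel
theorem cert_0_4 : certOK 0 4 [9548907661257, 37289533055526, -5040220660712, 23151118311934] 702858682803429468225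
  [-702858673254521806968, -134590804847100, 1653681653686528, -2990982835333352, -702869474616047409512, 156310367336266168, -367804168402728320, -674835806991176160, -700555905854836565728, -2262479397208547200, -16121569118478391104, 7485826643577120576, -690004359780082980736, -38742269623060036608, -51627639578505661440, 31984306716362301440, -571280358766752581632, 10005683745232736256, -94496782924534808576, 28438952356396269568, -308786887632099737600, 260761798671704522752, -194205656280436047872] = true := by decide +kernel
theorem cert_0_5 : certOK 0 5 [650472311607, 78017631790, 588466931048, -252875566894, 285955299984] 14609616903748095075
  [-14609616253275783468, -11630483977136, 157899393590936, -823112592402744, 2671421473651592, -14610529092367696576, -17467426150625376, 22419008948433632, 30120629934045952, -236896039354109888, -14656234872576740160, 156287027894630784, -151476331864184832, -639396116310983680, -889762896194576384, -12942934251392792576, 2125857529845411840, 292656115295322112, -2405493983885000704, 1468271888291856384, -6685679197056139264, 4819886785175748608, -2398766917088182272] = true := by decide +kernel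

def eqv := MvPolynomial.finSuccEquiv ℚ 1
def phi : MvPolynomial (Fin 1) ℚ →+* ℚ := MvPolynomial.eval fun _ => 2

theorem eqv_s : eqv qs = Polynomial.X := by
  rw [eqv, qs, MvPolynomial.finSuccEquiv_X_zero]
theorem eqv_t : eqv qt = Polynomial.C (X 0) := by
  have : (1 : Fin 2) = Fin.succ 0 := rfl
  rw [eqv, qt, this, MvPolynomial.finSuccEquiv_X_succ]

theorem core {a b : ℕ} {V : List ℤ} {m : ℤ} {Q : List ℤ} (hc : certOK a b V m Q = true)
    {G : MvPolynomial (Fin 2) ℚ} (hG : (eqv G).map phi = hrow Polynomial.X n2) :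
    IsRelPrime (1 - qs ^ b * qt ^ a) G := by
  simp only [certOK, Bool.and_eq_true, decide_eq_true_eq] at hc
  obtain ⟨⟨hb, hm⟩, hc⟩ := hc
  intro c hcf hcG
  have h1 : eqv c ∣ 1 - Polynomial.C (X 0 ^ a) * Polynomial.X ^ b := by
    have := map_dvd eqv hcf
    rwa [map_sub, map_mul, map_pow, map_pow, map_one, eqv_s, eqv_t, mul_comm, ← Polynomial.C_pow] at this
  set P := eqv c with hP
  have hdeg : (1 - Polynomial.C (X 0 ^ a : MvPolynomial (Fin 1) ℚ) * Polynomial.X ^ b).leadingCoeff = - X 0 ^ a := by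
    have hx : (X 0 ^ a : MvPolynomial (Fin 1) ℚ) ≠ 0 := pow_ne_zero _ (X_ne_zero 0)
    rw [Polynomial.leadingCoeff_sub_of_degree_lt', Polynomial.leadingCoeff_mul, Polynomial.leadingCoeff_C, Polynomial.leadingCoeff_X_pow, mul_one]
    rw [Polynomial.degree_one, Polynomial.degree_C_mul_X_pow _ hx]
    exact_mod_cast hb
  have h2 : P.leadingCoeff ∣ - X 0 ^ a := by
    obtain ⟨q, hq⟩ := h1
    rw [← hdeg, hq, Polynomial.leadingCoeff_mul]
    exact dvd_mul_right _ _
  have h3 : phi P.leadingCoeff ≠ 0 := by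
    intro h0
    have := map_dvd phi h2
    rw [h0, zero_dvd_iff] at this
    simp [phi] at this
  have h4 := Polynomial.natDegree_map_of_leadingCoeff_ne_zero phi h3
  have d1 : P.map phi ∣ hrow Polynomial.X (fl a b) := by
    have := Polynomial.map_dvd phi h1
    rw [hrow_fl _ _ _ hb]
    convert this using 1
    simp [phi]
    rfl
  have d2 : P.map phi ∣ hrow Polynomial.X n2 := by
    rw [← hG]
    exact Polynomial.map_dvd phi (map_dvd eqv hcG)
  have h5 := hrow_zero (Polynomial.X : Polynomial ℚ) _ hc
  rw [hrow_add, hrow_mul, hrow_scale, hrow_add, hrow_mul] at h5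
  have d3 : P.map phi ∣ ((m : ℤ) : Polynomial ℚ) := by
    have e : ((m : ℤ) : Polynomial ℚ) = hrow Polynomial.X V * hrow Polynomial.X n2 - hrow Polynomial.X (fl a b) * hrow Polynomial.X Q := by
      simp only [hrow, mul_zero, add_zero] at h5
      push_cast at h5
      linear_combination (-1 : Polynomial ℚ) * h5
    rw [e]
    exact dvd_sub (d2.mul_left _) (d1.mul_right _)
  have h6 : IsUnit (((m : ℤ) : Polynomial ℚ)) := by
    have : ((m : ℤ) : Polynomial ℚ) = Polynomial.C (m : ℚ) := by simp
    rw [this, Polynomial.isUnit_C]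
    exact IsUnit.mk0 _ (by exact_mod_cast hm)
  have h7 := Polynomial.natDegree_eq_zero_of_isUnit (isUnit_of_dvd_unit d3 h6)
  rw [h4] at h7
  have h8 := Polynomial.eq_C_of_natDegree_eq_zero h7
  have h9 : IsUnit (P.coeff 0) := by
    have := map_dvd (Polynomial.evalRingHom (0 : MvPolynomial (Fin 1) ℚ)) h1
    rw [h8] at this
    simp only [Polynomial.coe_evalRingHom, Polynomial.eval_C, Polynomial.eval_sub, Polynomial.eval_one, Polynomial.eval_mul, Polynomial.eval_pow, Polynomial.eval_X] at this
    rw [zero_pow (by omega), mul_zero, sub_zero] at this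
    exact isUnit_of_dvd_one this
  have h10 : IsUnit P := by
    rw [h8]; exact Polynomial.isUnit_C.2 h9
  have := h10.map eqv.symm
  rwa [hP, AlgEquiv.symm_apply_apply] at this

theorem mapHN (x y : MvPolynomial (Fin 2) ℚ) (x' y' : Polynomial ℚ) (hx : (eqv x).map phi = x') (hy : (eqv y).map phi = y') :
    (eqv (HN x y NT)).map phi = HN x' y' NT := by
  have := map_HN ((Polynomial.mapRingHom phi).comp (eqv : MvPolynomial (Fin 2) ℚ →+* _)) x y NT
  subst hx hy
  exact this

theorem ms : (eqv qs).map phi = Polynomial.X := by rw [eqv_s, Polynomial.map_X]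
theorem mt : (eqv qt).map phi = 2 := by rw [eqv_t, Polynomial.map_C]; simp [phi]; rfl

theorem hG1 : (eqv (HN qs qt NT)).map phi = hrow Polynomial.X n2 := by
  rw [mapHN _ _ _ _ ms mt, n2, hrow_col]
theorem hG2 : (eqv (HN qt qs NT)).map phi = hrow Polynomial.X n2 := by
  rw [mapHN _ _ _ _ mt ms, ← n2_row, hrow_row]

def sw : MvPolynomial (Fin 2) ℚ ≃ₐ[ℚ] MvPolynomial (Fin 2) ℚ := renameEquiv ℚ (Equiv.swap 0 1)
theorem sw_s : sw qs = qt := by simp [sw, qs, qt]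
theorem sw_t : sw qt = qs := by simp [sw, qs, qt]

theorem core1 {a b : ℕ} {V : List ℤ} {m : ℤ} {Q : List ℤ} (hc : certOK a b V m Q = true) :
    IsRelPrime (1 - qs ^ b * qt ^ a) (HN qs qt NT) := core hc hG1

theorem core2 {a b : ℕ} {V : List ℤ} {m : ℤ} {Q : List ℤ} (hc : certOK a b V m Q = true) :
    IsRelPrime (1 - qs ^ a * qt ^ b) (HN qs qt NT) := by
  intro c h1 h2
  have h3 := map_dvd sw h1
  have h4 := map_dvd sw h2
  have e := map_HN (sw : MvPolynomial (Fin 2) ℚ →+* MvPolynomial (Fin 2) ℚ) qs qt NT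
  change sw _ = HN (sw qs) (sw qt) NT at e
  rw [e, sw_s, sw_t] at h4
  rw [map_sub, map_mul, map_pow, map_pow, map_one, sw_s, sw_t, mul_comm] at h3
  have := (core hc hG2 h3 h4).map sw.symm
  rwa [AlgEquiv.symm_apply_apply] at this

theorem relP (p : ℕ × ℕ) (hp : p ∈ PN) : IsRelPrime (1 - qs ^ p.1 * qt ^ p.2) (HN qs qt NT) := by
  simp only [PN, List.mem_cons, List.not_mem_nil, or_false] at hp
  rcases hp with rfl | rfl | rfl | rfl | rfl | rfl | rfl | rfl | rfl | rfl | rfl | rfl | rfl | rfl | rfl | rfl | rfl | rfl | rfl | rfl | rfl | rfl | rfl | rfl | rfl | rfl | rfl | rfl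
  all_goals dsimp only
  · exact core1 cert_0_1
  · exact core2 cert_0_1
  · exact core1 cert_0_2
  · exact core2 cert_0_2
  · exact core1 cert_1_1
  · exact core1 cert_1_1
  · exact core1 cert_0_3
  · exact core2 cert_0_3
  · exact core2 cert_2_1
  · exact core2 cert_2_1
  · exact core2 cert_2_1
  · exact core1 cert_2_1
  · exact core1 cert_2_1
  · exact core1 cert_2_1
  · exact core1 cert_0_4
  · exact core2 cert_0_4
  · exact core2 cert_3_1
  · exact core2 cert_3_1
  · exact core1 cert_2_2
  · exact core1 cert_2_2
  · exact core1 cert_3_1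
  · exact core1 cert_3_1
  · exact core1 cert_0_5
  · exact core2 cert_0_5
  · exact core2 cert_4_1
  · exact core2 cert_3_2
  · exact core1 cert_3_2
  · exact core1 cert_4_1

theorem relPi : IsRelPrime (PiPoly 5) (HN qs qt NT) := by
  rw [Pi_eq]
  have : ∀ l : List (ℕ × ℕ), (∀ p ∈ l, IsRelPrime (1 - qs ^ p.1 * qt ^ p.2) (HN qs qt NT)) →
      IsRelPrime ((l.map fun p => 1 - qs ^ p.1 * qt ^ p.2).prod) (HN qs qt NT) := by
    intro l hl
    induction l with
    | nil => exact isRelPrime_one_left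
    | cons p l ih =>
      rw [List.map_cons, List.prod_cons]
      exact IsRelPrime.mul_left (hl p List.mem_cons_self) (ih fun q hq => hl q (List.mem_cons_of_mem _ hq))
  exact this PN relP

end C52

open C52 in
theorem denominator_C52 (K : Type*) [Field K] [CharZero K]
    (N D : MvPolynomial (Fin 2) ℚ)
    (hPD : purePS2 K 5 * (D : MvPowerSeries (Fin 2) ℚ) = (N : MvPowerSeries (Fin 2) ℚ))
    (hcop : ∀ c : MvPolynomial (Fin 2) ℚ, c ∣ N → c ∣ D → IsUnit c)
    (hN : MvPolynomial.coeff 0 N = 1) (hD : MvPolynomial.coeff 0 D = 1) :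
    D = PiPoly 5 := by
  have hm := PS_main K
  have key : N * PiPoly 5 = HN qs qt NT * D := by
    apply MvPolynomial.coe_injective (σ := Fin 2) (R := ℚ)
    rw [MvPolynomial.coe_mul, MvPolynomial.coe_mul, ← hPD, ← hm]
    ring
  have h1 : D ∣ PiPoly 5 := by
    have : IsRelPrime D N := fun c h1 h2 => hcop c h2 h1
    exact this.dvd_of_dvd_mul_left (key ▸ dvd_mul_left _ _)
  have h2 : PiPoly 5 ∣ D := by
    exact relPi.dvd_of_dvd_mul_left (key ▸ dvd_mul_left _ _)
  obtain ⟨u, hu⟩ := associated_of_dvd_dvd h1 h2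
  have hPi : MvPolynomial.coeff 0 (PiPoly 5) = 1 := by
    rw [← MvPolynomial.constantCoeff_eq, Pi_eq, map_list_prod, List.map_map]
    simp [PN, qs, qt]
  obtain ⟨r, hr, hru⟩ := MvPolynomial.isUnit_iff_eq_C_of_isReduced.1 u.isUnit
  rw [← hu, hru, mul_comm, MvPolynomial.coeff_C_mul, hD, mul_one] at hPi
  rw [← hu, hru, hPi, C_1, mul_one]
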